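/- For every rational number t with t ≠ 1 and t ≠ 2, the polynomial f_t = X⁶ + uX⁵ + vX⁴ + wX³ + vX² + uX + 1 is irreducible over ℚ. -/

import Mathlib

open Polynomial

/-- `u` coefficient of the polynomial `f t`. -/
noncomputable def u (t : ℚ) : ℚ := (3*t^2 - 2*t + 2) / (t^2 + t - 1)

/-- `v` coefficient of the polynomial `f t`. -/
noncomputable def v (t : ℚ) : ℚ :=
  (t^5 - 5*t^4 + 10*t^3 - 20*t^2 + 15*t - 7) / ((t - 2) * (t^2 + t - 1)^2)

/-- `w` coefficient of the polynomial `f t`. -/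
noncomputable def w (t : ℚ) : ℚ :=
  (-3*t^5 + 10*t^4 - 20*t^3 + 20*t^2 - 20*t + 6) / ((t - 2) * (t^2 + t - 1)^2)

/-- The polynomial `f_t = X⁶ + uX⁵ + vX⁴ + wX³ + vX² + uX + 1 ∈ ℚ[X]`. -/
noncomputable def f (t : ℚ) : Polynomial ℚ :=
  X^6 + C (u t) * X^5 + C (v t) * X^4 + C (w t) * X^3 + C (v t) * X^2 + C (u t) * X + 1

namespace FQ
open NumberField Algebra

noncomputable abbrev P5 : ℚ[X] := X ^ 5 - C 2

theorem P5_irr : Irreducible P5 := by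
  refine X_pow_sub_C_irreducible_of_prime (by norm_num) ?_
  intro b hb
  have h1 : padicValRat 2 (b ^ 5) = padicValRat 2 2 := by rw [hb]
  have hb0 : b ≠ 0 := by rintro rfl; norm_num at hb
  have : Fact (Nat.Prime 2) := ⟨Nat.prime_two⟩
  rw [padicValRat.pow] at h1
  have h2 : padicValRat 2 (2 : ℚ) = 1 := by
    have := padicValRat.self (p := 2) (by norm_num)
    simpa using this
  rw [h2] at h1
  push_cast at h1
  omega

instance : Fact (Irreducible P5) := ⟨P5_irr⟩

noncomputable abbrev K5 := AdjoinRoot P5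

noncomputable def tau : K5 := AdjoinRoot.root P5

theorem tau_pow : tau ^ 5 = 2 := by
  have h := AdjoinRoot.eval₂_root P5
  rw [P5, eval₂_sub, eval₂_pow, eval₂_X, eval₂_C, sub_eq_zero] at h
  rw [tau, h]; exact map_ofNat _ 2

theorem P5_natDegree : P5.natDegree = 5 := by
  simp only [P5]; compute_degree!

theorem P5_monic : P5.Monic := by
  simp only [P5]; monicity!

noncomputable def pb : PowerBasis ℚ K5 := AdjoinRoot.powerBasis P5_irr.ne_zero

theorem pb_gen : pb.gen = tau := rfl
theorem pb_dim : pb.dim = 5 := by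
  rw [pb, AdjoinRoot.powerBasis_dim, P5_natDegree]

instance : FiniteDimensional ℚ K5 := pb.finite

theorem finrank_K5 : Module.finrank ℚ K5 = 5 := by
  rw [pb.finrank, pb_dim]

instance : NumberField K5 where

theorem tau_minpoly : minpoly ℚ tau = P5 := by
  refine (minpoly.eq_of_irreducible_of_monic P5_irr ?_ P5_monic).symm
  simp [P5, tau_pow]

theorem tau_int : IsIntegral ℤ tau := by
  refine ⟨X ^ 5 - C 2, by monicity!, ?_⟩
  simp [tau_pow]

noncomputable def t : 𝓞 K5 := ⟨tau, tau_int⟩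

theorem t_coe : (t : K5) = tau := rfl
theorem t_pow : t ^ 5 = 2 := by
  apply RingOfIntegers.ext
  exact tau_pow

theorem norm_tau : Algebra.norm ℚ tau = 2 := by
  have := Algebra.PowerBasis.norm_gen_eq_coeff_zero_minpoly pb
  rw [pb_gen, tau_minpoly, pb_dim] at this
  rw [this]; norm_num [P5]

theorem discr_pb : Algebra.discr ℚ pb.basis = 50000 := by
  rw [Algebra.discr_powerBasis_eq_norm, finrank_K5, pb_gen, tau_minpoly]
  have : aeval tau (derivative P5) = algebraMap ℚ K5 5 * tau ^ 4 := by
    norm_num [P5]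
  rw [this, map_mul, Algebra.norm_algebraMap, finrank_K5, map_pow, norm_tau]
  norm_num

theorem tau_minpolyZ : minpoly ℤ tau = X ^ 5 - C 2 := by
  have h := minpoly.isIntegrallyClosed_eq_field_fractions' ℚ tau_int
  rw [tau_minpoly] at h
  apply Polynomial.map_injective (algebraMap ℤ ℚ) (algebraMap ℤ ℚ).injective_int
  rw [← h]; simp [P5]; rfl

theorem sig_int : IsIntegral ℤ (tau - 2) := tau_int.sub (by
  have := isIntegral_algebraMap (R := ℤ) (A := K5) (x := 2); simpa using this)

theorem adj_eq {R : Type*} [CommRing R] [Algebra R K5] :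
    adjoin R ({tau - 2} : Set K5) = adjoin R {tau} := by
  apply le_antisymm
  · apply adjoin_le
    rintro _ rfl
    exact sub_mem (subset_adjoin rfl) (by exact_mod_cast natCast_mem (adjoin R {tau}) 2)
  · apply adjoin_le
    rintro _ rfl
    have : tau = (tau - 2) + 2 := by ring
    rw [this]
    exact add_mem (by simpa using subset_adjoin rfl) (by exact_mod_cast natCast_mem (adjoin R {_}) 2)

noncomputable def pb' : PowerBasis ℚ K5 :=
  PowerBasis.ofAdjoinEqTop (x := tau - 2) (sig_int.tower_top) (by
    rw [adj_eq, ← pb_gen, pb.adjoin_gen_eq_top])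

theorem pb'_gen : pb'.gen = tau - 2 := rfl

theorem sig_minpolyZ : minpoly ℤ (tau - 2) = X ^ 5 + 10 * X ^ 4 + 40 * X ^ 3 + 80 * X ^ 2 + 80 * X + 30 := by
  have h := minpoly.isIntegrallyClosed_eq_field_fractions' ℚ sig_int
  have h1 := minpoly.sub_algebraMap (A := ℚ) (B := K5) (x := tau) 2
  have h2 : (algebraMap ℚ K5 2) = 2 := by simp
  rw [h2, tau_minpoly] at h1
  rw [h1] at h
  apply Polynomial.map_injective (algebraMap ℤ ℚ) (algebraMap ℤ ℚ).injective_int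
  rw [← h]
  simp only [P5, sub_comp, pow_comp, X_comp, C_comp, Polynomial.map_add, Polynomial.map_mul,
    Polynomial.map_pow, map_X, Polynomial.map_ofNat]
  rw [show (C 2 : ℚ[X]) = 2 from rfl]
  ring

theorem eis2 : (minpoly ℤ tau).IsEisensteinAt (Submodule.span ℤ {2}) := by
  have hd : (X ^ 5 - C 2 : ℤ[X]).natDegree = 5 := by compute_degree!
  rw [tau_minpolyZ]
  refine ⟨?_, ?_, ?_⟩
  · rw [show (X ^ 5 - C 2 : ℤ[X]).leadingCoeff = 1 from (by monicity! : (X ^ 5 - C 2 : ℤ[X]).Monic)]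
    rw [Ideal.submodule_span_eq, Ideal.mem_span_singleton]; norm_num
  · intro n hn
    rw [hd] at hn
    rw [Ideal.submodule_span_eq, Ideal.mem_span_singleton]
    interval_cases n <;> simp [coeff_X, coeff_C, coeff_X_pow]
  · rw [Ideal.submodule_span_eq, Ideal.span_singleton_pow, Ideal.mem_span_singleton]
    simp [coeff_X_pow]

theorem eis5 : (minpoly ℤ (tau - 2)).IsEisensteinAt (Submodule.span ℤ {5}) := by
  have hd : (X ^ 5 + 10 * X ^ 4 + 40 * X ^ 3 + 80 * X ^ 2 + 80 * X + 30 : ℤ[X]).natDegree = 5 := by compute_degree!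
  rw [sig_minpolyZ]
  refine ⟨?_, ?_, ?_⟩
  · rw [show (X ^ 5 + 10 * X ^ 4 + 40 * X ^ 3 + 80 * X ^ 2 + 80 * X + 30 : ℤ[X]).leadingCoeff = 1 from (by monicity! : (X ^ 5 + 10 * X ^ 4 + 40 * X ^ 3 + 80 * X ^ 2 + 80 * X + 30 : ℤ[X]).Monic)]
    rw [Ideal.submodule_span_eq, Ideal.mem_span_singleton]; norm_num
  · intro n hn
    rw [hd] at hn
    rw [Ideal.submodule_span_eq, Ideal.mem_span_singleton]
    interval_cases n <;> simp [coeff_X, coeff_X_pow, coeff_ofNat_mul] <;> norm_num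
  · rw [Ideal.submodule_span_eq, Ideal.span_singleton_pow, Ideal.mem_span_singleton]
    simp

theorem mem_adj {z : K5} (hz : IsIntegral ℤ z) : z ∈ adjoin ℤ ({tau} : Set K5) := by
  have h1 := discr_mul_isIntegral_mem_adjoin (R := ℤ) ℚ (B := pb) tau_int hz
  rw [discr_pb, pb_gen] at h1
  have h2 : ((2:ℤ) ^ 4) • (((5:ℤ) ^ 5) • z) ∈ adjoin ℤ ({pb.gen} : Set K5) := by
    rw [pb_gen]
    convert h1 using 1
    simp only [Algebra.smul_def]
    norm_num
    ring
  have h3 := mem_adjoin_of_smul_prime_pow_smul_of_minpoly_isEisensteinAt (K := ℚ) (B := pb)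
    Int.prime_two tau_int (hz.smul ((5:ℤ)^5)) h2 eis2
  rw [pb_gen, ← adj_eq, ← pb'_gen] at h3
  have h4 := mem_adjoin_of_smul_prime_pow_smul_of_minpoly_isEisensteinAt (K := ℚ) (B := pb')
    (p := (5:ℤ)) (Int.prime_iff_natAbs_prime.mpr (by norm_num)) sig_int hz h3 eis5
  rwa [pb'_gen, adj_eq] at h4

/-- every algebraic integer is an explicit combination -/
theorem exists_coords (z : 𝓞 K5) : ∃ a b c d e : ℤ,
    z = a + b * t + c * t ^ 2 + d * t ^ 3 + e * t ^ 4 := by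
  have h := mem_adj z.isIntegral_coe
  rw [Algebra.adjoin_singleton_eq_range_aeval] at h
  obtain ⟨P, hP⟩ := h
  have hm : (X ^ 5 - C 2 : ℤ[X]).Monic := by monicity!
  have hd : (X ^ 5 - C 2 : ℤ[X]).natDegree = 5 := by compute_degree!
  have e1 := modByMonic_add_div P (q := (X ^ 5 - C 2 : ℤ[X]))
  set r := P %ₘ (X ^ 5 - C 2 : ℤ[X])
  have hr : r.natDegree < 5 := by
    rw [← hd]; exact natDegree_modByMonic_lt _ hm (by intro h; rw [h] at hd; simp at hd)
  refine ⟨r.coeff 0, r.coeff 1, r.coeff 2, r.coeff 3, r.coeff 4, ?_⟩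
  apply RingOfIntegers.ext
  have h2 : aeval tau P = aeval tau r := by
    rw [← e1]; simp only [map_add, map_mul, map_sub, map_pow, aeval_X, aeval_C, tau_pow]; simp
  have h3 := Polynomial.aeval_eq_sum_range' hr tau
  change algebraMap (𝓞 K5) K5 z = _
  rw [← hP]
  change aeval tau P = _
  rw [h2, h3]
  simp [Finset.sum_range_succ, t_coe]

end FQ

namespace FQ
open NumberField Algebra

noncomputable def bQ : Module.Basis (Fin 5) ℚ K5 := pb.basis.reindex (finCongr pb_dim)

theorem bQ_apply (i : Fin 5) : bQ i = tau ^ (i : ℕ) := by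
  simp [bQ, pb_gen]

theorem liQ {a b c d e : ℚ} (h : (a : K5) + b * tau + c * tau ^ 2 + d * tau ^ 3 + e * tau ^ 4 = 0) :
    a = 0 ∧ b = 0 ∧ c = 0 ∧ d = 0 ∧ e = 0 := by
  have h1 := Fintype.linearIndependent_iff.mp bQ.linearIndependent ![a, b, c, d, e] (by
    simp [Fin.sum_univ_five, bQ_apply, Algebra.smul_def]
    linear_combination h)
  exact ⟨h1 0, h1 1, h1 2, h1 3, h1 4⟩

theorem liZ {a b c d e : ℤ} (h : (a : 𝓞 K5) + b * t + c * t ^ 2 + d * t ^ 3 + e * t ^ 4 = 0) :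
    a = 0 ∧ b = 0 ∧ c = 0 ∧ d = 0 ∧ e = 0 := by
  have h2 := congrArg (algebraMap (𝓞 K5) K5) h
  have h1 := liQ (a := a) (b := b) (c := c) (d := d) (e := e) (by
    simp only [map_add, map_mul, map_pow, map_intCast, map_zero] at h2
    rw [show algebraMap (𝓞 K5) K5 t = tau from rfl] at h2
    push_cast
    exact h2)
  exact_mod_cast h1

noncomputable def b5 : Module.Basis (Fin 5) ℤ (𝓞 K5) :=
  Module.Basis.mk (v := fun i : Fin 5 => t ^ (i : ℕ)) (by
    rw [Fintype.linearIndependent_iff]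
    intro g hg i
    have := liZ (a := g 0) (b := g 1) (c := g 2) (d := g 3) (e := g 4) (by
      rw [← hg]; simp [Fin.sum_univ_five])
    obtain ⟨h0, h1, h2, h3, h4⟩ := this
    fin_cases i <;> assumption) (by
    intro z _
    obtain ⟨a, b, c, d, e, rfl⟩ := exists_coords z
    have hm : ∀ (n : ℤ) (i : Fin 5), (n : 𝓞 K5) * t ^ (i:ℕ) ∈ Submodule.span ℤ (Set.range fun i : Fin 5 => t ^ (i : ℕ)) := by
      intro n i
      rw [← zsmul_eq_mul]
      exact Submodule.smul_mem _ _ (Submodule.subset_span ⟨i, rfl⟩)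
    have h0 := hm a 0
    have h1 := hm b 1
    have h2 := hm c 2
    have h3 := hm d 3
    have h4 := hm e 4
    simp only [Fin.val_zero, Fin.val_one, Fin.val_two, pow_zero, pow_one, mul_one] at h0 h1 h2
    exact add_mem (add_mem (add_mem (add_mem h0 h1) h2) h3) h4)

theorem b5_apply (i : Fin 5) : b5 i = t ^ (i : ℕ) := by simp [b5]

theorem discr_K5 : discr K5 = 50000 := by
  rw [← discr_eq_discr K5 b5]
  have h := Algebra.discr_localizationLocalization ℤ (nonZeroDivisors ℤ) (Rₘ := ℚ) K5 b5
  have h2 : Algebra.discr ℚ (b5.localizationLocalization ℚ (nonZeroDivisors ℤ) K5) = 50000 := by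
    have : ⇑(b5.localizationLocalization ℚ (nonZeroDivisors ℤ) K5) = bQ := by
      funext i
      rw [Module.Basis.localizationLocalization_apply, b5_apply, bQ_apply, map_pow]
      rfl
    rw [this, bQ, Module.Basis.coe_reindex, ← discr_pb]
    exact Algebra.discr_reindex ℚ pb.basis (finCongr pb_dim)
  rw [h2] at h
  have h3 : ((Algebra.discr ℤ b5 : ℤ) : ℚ) = 50000 := h.symm
  exact_mod_cast h3

def MT : Matrix (Fin 5) (Fin 5) ℤ := !![0,0,0,0,2; 1,0,0,0,0; 0,1,0,0,0; 0,0,1,0,0; 0,0,0,1,0]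

theorem lmt : leftMulMatrix b5 t = MT := by
  have key : ∀ j : Fin 5, t * b5 j = ∑ i, MT i j • b5 i := by
    intro j
    fin_cases j <;> simp [MT, b5_apply, Fin.sum_univ_five] <;> ring_nf
    exact t_pow
  ext i j
  rw [leftMulMatrix_eq_repr_mul, key, Module.Basis.repr_sum_self]

theorem norm_alpha (A B C : ℤ) : Algebra.norm ℤ ((A : 𝓞 K5) - B * t ^ 2 + C * t ^ 4) =
    A^5 - 4*B^5 + 16*C^5 + 20*A*B^3*C - 20*A^2*B*C^2 := by
  rw [Algebra.norm_eq_matrix_det b5]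
  have : leftMulMatrix b5 ((A : 𝓞 K5) - B * t ^ 2 + C * t ^ 4) =
      !![A, 2*C, 0, -2*B, 0; 0, A, 2*C, 0, -2*B; -B, 0, A, 2*C, 0; 0, -B, 0, A, 2*C; C, 0, -B, 0, A] := by
    rw [map_add, map_sub, map_mul, map_mul, map_pow, map_pow, lmt, map_intCast, map_intCast, map_intCast,
      show MT ^ 2 = !![0,0,0,2,0; 0,0,0,0,2; 1,0,0,0,0; 0,1,0,0,0; 0,0,1,0,0] by decide +kernel,
      show MT ^ 4 = !![0,2,0,0,0; 0,0,2,0,0; 0,0,0,2,0; 0,0,0,0,2; 1,0,0,0,0] by decide +kernel,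
      ← zsmul_eq_mul, ← zsmul_eq_mul]
    ext i j
    fin_cases i <;> fin_cases j <;> simp [Matrix.intCast_apply] <;> ring
  rw [this]
  simp [Matrix.det_succ_row_zero, Fin.sum_univ_succ, Fin.succAbove]
  ring

theorem nrc_le : InfinitePlace.nrComplexPlaces K5 ≤ 2 := by
  have h1 := InfinitePlace.card_add_two_mul_card_eq_rank K5
  rw [finrank_K5] at h1
  omega

open Real in
theorem minkowski_lt :
    (4 / π) ^ InfinitePlace.nrComplexPlaces K5 *
      ((Module.finrank ℚ K5).factorial / (Module.finrank ℚ K5 : ℝ) ^ (Module.finrank ℚ K5) * √|(discr K5 : ℝ)|) < 14 := by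
  rw [finrank_K5, discr_K5]
  have hp := pi_gt_d2
  have h1 : (4 / π) ^ InfinitePlace.nrComplexPlaces K5 ≤ (4/π) ^ 2 := by
    apply pow_le_pow_right₀ _ nrc_le
    rw [le_div_iff₀ pi_pos]; linarith [pi_le_four]
  have h2 : (4 / π) ^ 2 ≤ (4/3.14) ^ 2 := by gcongr
  have h3 : √|((50000 : ℤ) : ℝ)| < 223.61 := by
    rw [Real.sqrt_lt' (by norm_num)]; norm_num
  have h4 : ((Nat.factorial 5 : ℕ) : ℝ) / ((5:ℕ):ℝ) ^ 5 * √|((50000 : ℤ) : ℝ)| ≤ 120/3125*223.61 := by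
    have : ((Nat.factorial 5 : ℕ) : ℝ) / ((5:ℕ):ℝ) ^ 5 = 120/3125 := by norm_num [Nat.factorial]
    rw [this]; gcongr
  calc _ ≤ (4/3.14:ℝ)^2 * (120/3125*223.61) := by
        gcongr
        exact h1.trans h2
    _ < 14 := by norm_num

end FQ

namespace FQ
open NumberField Algebra

theorem dvd_sub_int (z : 𝓞 K5) (c : ℤ) : ∃ (n : ℤ) (y : 𝓞 K5), z = n + (t - c) * y := by
  obtain ⟨a0, a1, a2, a3, a4, rfl⟩ := exists_coords z
  refine ⟨a0 + a1 * c + a2 * c ^ 2 + a3 * c ^ 3 + a4 * c ^ 4,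
    a1 + a2 * (t + c) + a3 * (t ^ 2 + t * c + c ^ 2) + a4 * (t ^ 3 + t ^ 2 * c + t * c ^ 2 + c ^ 3), ?_⟩
  push_cast
  ring

theorem princ_of {I : Ideal (𝓞 K5)} (hI : I.IsPrime) {p : ℕ} (hp : p.Prime) {c : ℤ} {g : 𝓞 K5}
    (hpI : (p : 𝓞 K5) ∈ I) (hcI : t - (c : 𝓞 K5) ∈ I) (hg : g ∈ I) (h1 : g ∣ p) (h2 : g ∣ t - (c : 𝓞 K5)) :
    Submodule.IsPrincipal I := by
  refine ⟨g, le_antisymm ?_ ?_⟩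
  · intro z hz
    rw [Ideal.submodule_span_eq, Ideal.mem_span_singleton]
    obtain ⟨n, y, rfl⟩ := dvd_sub_int z c
    have hn : (n : 𝓞 K5) ∈ I := by
      have := I.sub_mem hz (I.mul_mem_right y hcI)
      simpa using this
    have hpn : (p : ℤ) ∣ n := by
      by_contra hc
      have := (Int.isCoprime_iff_gcd_eq_one.mpr (by
        rw [Int.gcd_eq_natAbs]; simpa using (Nat.Prime.coprime_iff_not_dvd hp).mpr (by
          rwa [← Int.natCast_dvd])) : IsCoprime (p : ℤ) n)
      obtain ⟨a, b, hab⟩ := this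
      apply hI.ne_top
      rw [Ideal.eq_top_iff_one]
      have : (1 : 𝓞 K5) = a * p + b * n := by exact_mod_cast hab.symm
      rw [this]
      exact I.add_mem (I.mul_mem_left _ hpI) (I.mul_mem_left _ hn)
    obtain ⟨m, rfl⟩ := hpn
    push_cast
    exact dvd_add (h1.mul_right _) (h2.mul_right _)
  · rw [Ideal.submodule_span_eq, Ideal.span_singleton_le_iff_mem]; exact hg

theorem mem_of_quot {I : Ideal (𝓞 K5)} {z : 𝓞 K5} (h : Ideal.Quotient.mk I z = 0) : z ∈ I :=
  Ideal.Quotient.eq_zero_iff_mem.mp h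

theorem pid_aux {I : Ideal (𝓞 K5)} (hI : I.IsPrime) (hI0 : I ≠ ⊥) (hn : Ideal.absNorm I < 14) :
    Submodule.IsPrincipal I := by
  have hmax : I.IsMaximal := hI.isMaximal hI0
  let : Field (𝓞 K5 ⧸ I) := Ideal.Quotient.field I
  have hfin : Finite (𝓞 K5 ⧸ I) := Ideal.finiteQuotientOfFreeOfNeBot I hI0
  let : Fintype (𝓞 K5 ⧸ I) := Fintype.ofFinite _
  have hq : Fintype.card (𝓞 K5 ⧸ I) = Ideal.absNorm I := by
    rw [Ideal.absNorm_apply, Submodule.cardQuot_apply, Nat.card_eq_fintype_card]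
  set q := Ideal.absNorm I with hqdef
  have hpp : IsPrimePow q := hq ▸ Fintype.isPrimePow_card_of_field
  set θ := Ideal.Quotient.mk I t with hθ
  have h5 : θ ^ 5 = 2 := by rw [hθ, ← map_pow, t_pow]; exact map_ofNat _ 2
  have hfrob : θ ^ q = θ := by rw [← hq]; exact FiniteField.pow_card θ
  have hzero : (q : 𝓞 K5 ⧸ I) = 0 := by rw [← hq]; exact FiniteField.cast_card_eq_zero _
  have one_ne : (1 : 𝓞 K5 ⧸ I) ≠ 0 := one_ne_zero
  have hmem : ∀ (n : ℕ), (n : 𝓞 K5 ⧸ I) = 0 → (n : 𝓞 K5) ∈ I := fun n hn =>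
    mem_of_quot (by rw [map_natCast]; exact hn)
  have hmemc : ∀ (c : ℤ), θ = c → t - (c : 𝓞 K5) ∈ I := fun n hn =>
    mem_of_quot (by rw [map_sub, map_intCast, ← hθ, hn, sub_self])
  have T5 : t ^ 5 = 2 := t_pow
  have fin2 : (2 : 𝓞 K5 ⧸ I) = 0 → Submodule.IsPrincipal I := by
    intro h
    have hθ0 : θ = 0 := by rw [h] at h5; exact pow_eq_zero_iff (by norm_num) |>.mp h5
    have h2 := hmemc 0 (by simpa using hθ0)
    refine princ_of hI Nat.prime_two (c := 0) (g := t) (hmem 2 (by exact_mod_cast h)) h2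
      (by simpa using h2) ⟨t ^ 4, ?_⟩ (by simp)
    push_cast; rw [← T5]; ring
  have fin3 : (3 : 𝓞 K5 ⧸ I) = 0 → θ ^ 9 = θ → Submodule.IsPrincipal I := by
    intro h h9
    have hθ0 : θ ≠ 0 := by
      intro h0; rw [h0] at h5
      apply one_ne; linear_combination h + h5
    have h8 : θ ^ 8 = 1 := by
      apply mul_right_cancel₀ hθ0; linear_combination h9
    have h2 : θ = (-1 : ℤ) := by
      have hs : θ ^ 2 = 1 := by linear_combination -θ ^ 2 * h8 + (θ ^ 5 + 2) * h5 + h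
      push_cast
      linear_combination h5 + h - θ * (θ ^ 2 + 1) * hs
    have h3 := hmemc (-1) h2
    refine princ_of hI Nat.prime_three (c := -1) (g := 1 + t) (hmem 3 (by exact_mod_cast h)) h3
      (by rw [add_comm]; simpa using h3) ⟨1 - t + t ^ 2 - t ^ 3 + t ^ 4, ?_⟩ ⟨1, by push_cast; ring⟩
    push_cast; linear_combination -T5
  have hle : q < 14 := hn
  clear_value q
  interval_cases q
  · exact absurd hpp not_isPrimePow_zero
  · exact absurd hpp not_isPrimePow_one
  · exact fin2 (by exact_mod_cast hzero)
  · exact fin3 (by exact_mod_cast hzero) (by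
      calc θ ^ 9 = (θ ^ 3) ^ 3 := by ring
        _ = θ := by rw [hfrob, hfrob])
  · refine fin2 (pow_eq_zero_iff (n := 2) (by norm_num) |>.mp ?_)
    push_cast at hzero; linear_combination hzero
  · have h := hmemc 2 (by push_cast; rw [← h5, hfrob])
    have hp := hmem 5 hzero
    refine princ_of hI Nat.prime_five (c := 2) (g := 1 + t ^ 2) hp h ?_
      ⟨1 - t ^ 2 + t ^ 4 - t ^ 6 + t ^ 8, ?_⟩ ⟨t * (1 - t ^ 2), ?_⟩
    · have := I.add_mem (I.mul_mem_right (t + 2) h) hp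
      convert this using 1
      push_cast; ring
    · push_cast; linear_combination -(t ^ 5 + 2) * T5
    · push_cast; linear_combination T5
  · exact absurd hpp (by rw [isPrimePow_nat_iff_bounded]; decide)
  · have h7 : (7 : 𝓞 K5 ⧸ I) = 0 := by exact_mod_cast hzero
    have hθ0 : θ ≠ 0 := by
      intro h0; rw [h0] at h5
      apply one_ne; linear_combination h7 + 3 * h5
    have h6 : θ ^ 6 = 1 := by
      apply mul_right_cancel₀ hθ0; linear_combination hfrob
    have h := hmemc 4 (by push_cast; linear_combination 4 * h6 - 4 * θ * h5 - θ * h7)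
    have hp := hmem 7 hzero
    refine princ_of hI (by norm_num) (c := 4) (g := t ^ 3 - 1) hp h ?_
      ⟨t ^ 12 + t ^ 9 + t ^ 6 + t ^ 3 + 1, ?_⟩ ⟨-t * (t ^ 6 + t ^ 3 + 1), ?_⟩
    · have := I.add_mem (I.mul_mem_right (t ^ 2 + 4 * t + 16) h) (I.mul_mem_left 9 hp)
      convert this using 1
      push_cast; ring
    · push_cast; linear_combination -(t ^ 10 + 2 * t ^ 5 + 4) * T5
    · push_cast; linear_combination (t ^ 5 + 2) * T5
  · refine fin2 (pow_eq_zero_iff (n := 3) (by norm_num) |>.mp ?_)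
    push_cast at hzero; linear_combination hzero
  · refine fin3 (pow_eq_zero_iff (n := 2) (by norm_num) |>.mp ?_) hfrob
    push_cast at hzero; linear_combination hzero
  · exact absurd hpp (by rw [isPrimePow_nat_iff_bounded]; decide)
  · exfalso
    have h11 : (11 : 𝓞 K5 ⧸ I) = 0 := by exact_mod_cast hzero
    have hθ0 : θ ≠ 0 := by
      intro h0; rw [h0] at h5
      apply one_ne; linear_combination h11 + 5 * h5
    have h10 : θ ^ 10 = 1 := by
      apply mul_right_cancel₀ hθ0; linear_combination hfrob
    apply one_ne
    linear_combination 4 * h10 - 4 * (θ ^ 5 + 2) * h5 - h11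
  · exact absurd hpp (by rw [isPrimePow_nat_iff_bounded]; decide)
  · have h13 : (13 : 𝓞 K5 ⧸ I) = 0 := by exact_mod_cast hzero
    have hθ0 : θ ≠ 0 := by
      intro h0; rw [h0] at h5
      apply one_ne; linear_combination h13 + 6 * h5
    have h12 : θ ^ 12 = 1 := by
      apply mul_right_cancel₀ hθ0; linear_combination hfrob
    have h2 : θ ^ 2 = -3 := by
      linear_combination 10 * h12 - 10 * θ ^ 2 * (θ ^ 5 + 2) * h5 + (1 - 3 * θ^2) * h13
    have h := hmemc 6 (by push_cast; linear_combination 3 * h5 - 3 * θ * (θ^2 - 3) * h2 - 2 * θ * h13)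
    have hp := hmem 13 hzero
    refine princ_of hI (by norm_num) (c := 6) (g := 1 - t ^ 2 + t ^ 4) hp h ?_ ?_ ?_
    · have := I.add_mem (I.mul_mem_right (t ^ 3 + 6 * t ^ 2 + 35 * t + 210) h) (I.mul_mem_left 97 hp)
      convert this using 1
      push_cast; ring
    · refine ⟨-3 + 6 * t + t ^ 2 - 2 * t ^ 3 + 4 * t ^ 4, ?_⟩
      push_cast; linear_combination -(4 * t ^ 3 - 2 * t ^ 2 - 3 * t + 8) * T5
    · refine ⟨2 - 3 * t + t ^ 3 - 2 * t ^ 4, ?_⟩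
      push_cast; linear_combination -(-2 * t ^ 3 + t ^ 2 + 2 * t - 4) * T5

theorem pidO : IsPrincipalIdealRing (𝓞 K5) := by
  apply RingOfIntegers.isPrincipalIdealRing_of_isPrincipal_of_norm_le_of_isPrime
  intro I hI hle
  refine pid_aux hI (nonZeroDivisors.coe_ne_zero I) ?_
  have := lt_of_le_of_lt hle minkowski_lt
  exact_mod_cast this

end FQ

namespace FQ
open NumberField Algebra

noncomputable def cc (i : Fin 5) (x : 𝓞 K5) : ZMod 2 := ((b5.repr x i : ℤ) : ZMod 2)

theorem repr_coords (a b c d e : ℤ) (i : Fin 5) :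
    b5.repr ((a : 𝓞 K5) + b * t + c * t ^ 2 + d * t ^ 3 + e * t ^ 4) i = ![a, b, c, d, e] i := by
  have : ((a : 𝓞 K5) + b * t + c * t ^ 2 + d * t ^ 3 + e * t ^ 4) =
      ∑ i, (![a, b, c, d, e] : Fin 5 → ℤ) i • b5 i := by
    simp [Fin.sum_univ_five, b5_apply]
  rw [this, Module.Basis.repr_sum_self]

theorem cc_coords (a b c d e : ℤ) (i : Fin 5) :
    cc i ((a : 𝓞 K5) + b * t + c * t ^ 2 + d * t ^ 3 + e * t ^ 4) = ((![a, b, c, d, e] i : ℤ) : ZMod 2) := by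
  rw [cc, repr_coords]

theorem cc_mul (x y : 𝓞 K5) : cc 0 (x * y) = cc 0 x * cc 0 y ∧
    cc 1 (x * y) = cc 0 x * cc 1 y + cc 1 x * cc 0 y ∧
    cc 2 (x * y) = cc 0 x * cc 2 y + cc 1 x * cc 1 y + cc 2 x * cc 0 y ∧
    cc 3 (x * y) = cc 0 x * cc 3 y + cc 1 x * cc 2 y + cc 2 x * cc 1 y + cc 3 x * cc 0 y := by
  obtain ⟨a, b, c, d, e, rfl⟩ := exists_coords x
  obtain ⟨a', b', c', d', e', rfl⟩ := exists_coords y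
  have h : ((a : 𝓞 K5) + b * t + c * t ^ 2 + d * t ^ 3 + e * t ^ 4) *
      ((a' : 𝓞 K5) + b' * t + c' * t ^ 2 + d' * t ^ 3 + e' * t ^ 4) =
      ((a * a' + 2 * (b * e' + c * d' + d * c' + e * b') : ℤ) : 𝓞 K5) +
      ((a * b' + b * a' + 2 * (c * e' + d * d' + e * c') : ℤ) : 𝓞 K5) * t +
      ((a * c' + b * b' + c * a' + 2 * (d * e' + e * d') : ℤ) : 𝓞 K5) * t ^ 2 +
      ((a * d' + b * c' + c * b' + d * a' + 2 * (e * e') : ℤ) : 𝓞 K5) * t ^ 3 +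
      ((a * e' + b * d' + c * c' + d * b' + e * a' : ℤ) : 𝓞 K5) * t ^ 4 := by
    have T5 := t_pow
    push_cast
    linear_combination (b * e' + c * d' + d * c' + e * b' + (c * e' + d * d' + e * c') * t +
      (d * e' + e * d') * t ^ 2 + e * e' * t ^ 3 : 𝓞 K5) * T5
  rw [h]
  simp only [cc_coords]
  have h2 : (2 : ZMod 2) = 0 := by decide
  simp [h2]

theorem cc_one : cc 0 1 = 1 ∧ cc 1 1 = 0 ∧ cc 2 1 = 0 ∧ cc 3 1 = 0 := by
  have : (1 : 𝓞 K5) = ((1:ℤ) : 𝓞 K5) + (0:ℤ) * t + (0:ℤ) * t ^ 2 + (0:ℤ) * t ^ 3 + (0:ℤ) * t ^ 4 := by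
    push_cast; ring
  rw [this]; simp only [cc_coords]; simp

theorem cc_neg_one : cc 0 (-1) = 1 ∧ cc 1 (-1) = 0 ∧ cc 2 (-1) = 0 ∧ cc 3 (-1) = 0 := by
  have : (-1 : 𝓞 K5) = ((-1:ℤ) : 𝓞 K5) + (0:ℤ) * t + (0:ℤ) * t ^ 2 + (0:ℤ) * t ^ 3 + (0:ℤ) * t ^ 4 := by
    push_cast; ring
  rw [this]; simp only [cc_coords]; simp

theorem cc_unit (x : (𝓞 K5)ˣ) : cc 0 (x : 𝓞 K5) = 1 := by
  have h := (cc_mul (x : 𝓞 K5) (x⁻¹ : (𝓞 K5)ˣ)).1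
  rw [Units.mul_inv, cc_one.1] at h
  generalize cc 0 (x : 𝓞 K5) = a at *
  generalize cc 0 ((x⁻¹ : (𝓞 K5)ˣ) : 𝓞 K5) = b at *
  revert a b; decide

/-- the quadratic characters -/
noncomputable def chi (x : 𝓞 K5) : ZMod 2 × ZMod 2 := (cc 1 x, cc 3 x + cc 1 x * cc 2 x)

theorem chi_mul {x y : 𝓞 K5} (hx : cc 0 x = 1) (hy : cc 0 y = 1) : chi (x * y) = chi x + chi y := by
  obtain ⟨-, h1, h2, h3⟩ := cc_mul x y
  rw [hx, hy] at *
  unfold chi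
  rw [h1, h2, h3]
  generalize cc 1 x = a
  generalize cc 2 x = b
  generalize cc 3 x = c
  generalize cc 1 y = a'
  generalize cc 2 y = b'
  generalize cc 3 y = c'
  revert a b c a' b' c'
  decide

noncomputable def chiU : Additive (𝓞 K5)ˣ →+ ZMod 2 × ZMod 2 where
  toFun x := chi ((Additive.toMul x : (𝓞 K5)ˣ) : 𝓞 K5)
  map_zero' := by
    simp [chi, cc_one]
  map_add' x y := by
    simp only [toMul_add, Units.val_mul]
    exact chi_mul (cc_unit _) (cc_unit _)

theorem real_unique (w w' : InfinitePlace K5) (hw : w.IsReal) (hw' : w'.IsReal) : w = w' := by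
  have key : ∀ φ : K5 →+* ℝ, φ tau ^ 5 = 2 := by
    intro φ; rw [← map_pow, tau_pow, map_ofNat]
  have h1 := key (InfinitePlace.embedding_of_isReal hw)
  have h2 := key (InfinitePlace.embedding_of_isReal hw')
  have h3 : InfinitePlace.embedding_of_isReal hw tau = InfinitePlace.embedding_of_isReal hw' tau :=
    (Odd.strictMono_pow (by decide : Odd 5)).injective (h1.trans h2.symm)
  have h4 : (InfinitePlace.embedding_of_isReal hw).toRatAlgHom = (InfinitePlace.embedding_of_isReal hw').toRatAlgHom :=
    pb.algHom_ext h3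
  have h5 : w.embedding = w'.embedding := by
    refine RingHom.ext fun x => ?_
    rw [← InfinitePlace.embedding_of_isReal_apply hw, ← InfinitePlace.embedding_of_isReal_apply hw']
    exact congrArg _ (DFunLike.congr_fun h4 x)
  rw [← InfinitePlace.mk_embedding w, ← InfinitePlace.mk_embedding w', h5]

theorem rank_K5 : Units.rank K5 = 2 := by
  have h1 := InfinitePlace.card_add_two_mul_card_eq_rank K5
  have h2 := InfinitePlace.card_eq_nrRealPlaces_add_nrComplexPlaces K5
  have h3 : InfinitePlace.nrRealPlaces K5 ≤ 1 := by
    classical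
    rw [InfinitePlace.nrRealPlaces, Fintype.card_le_one_iff_subsingleton]
    refine ⟨?_⟩
    rintro ⟨a, ha⟩ ⟨b, hb⟩
    exact Subtype.ext (real_unique a b ha hb)
  rw [finrank_K5] at h1
  rw [Units.rank, h2]
  omega

theorem units_gen : ∃ f g : (𝓞 K5)ˣ, ∀ x : (𝓞 K5)ˣ, ∃ (a b : ℤ),
    x = f ^ a * g ^ b ∨ x = -1 * (f ^ a * g ^ b) := by
  have hr := rank_K5
  let e := finCongr hr
  refine ⟨Units.fundSystem K5 (e.symm 0), Units.fundSystem K5 (e.symm 1), fun x => ?_⟩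
  obtain ⟨⟨ζ, n⟩, h, -⟩ := Units.exist_unique_eq_mul_prod K5 x
  refine ⟨n (e.symm 0), n (e.symm 1), ?_⟩
  have hprod : ∏ i, (Units.fundSystem K5 i) ^ (n i) = Units.fundSystem K5 (e.symm 0) ^ n (e.symm 0) *
      Units.fundSystem K5 (e.symm 1) ^ n (e.symm 1) := by
    rw [← e.symm.prod_comp, Fin.prod_univ_two]
  simp only at h
  rw [hprod] at h
  rcases Units.torsion_eq_one_or_neg_one_of_odd_finrank (K := K5) (by rw [finrank_K5]; decide) ζ with h1 | h1
  · left; rw [h, h1, one_mul]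
  · right; rw [h, h1]

noncomputable def unitOf (x y : 𝓞 K5) (h : x * y = 1) : (𝓞 K5)ˣ := ⟨x, y, h, by rw [mul_comm]; exact h⟩

theorem chi_u1 : ∃ x : (𝓞 K5)ˣ, chi (x : 𝓞 K5) = (1, 0) := by
  refine ⟨unitOf (t - 1) (1 + t + t ^ 2 + t ^ 3 + t ^ 4) (by linear_combination t_pow), ?_⟩
  have : ((unitOf (t - 1) (1 + t + t ^ 2 + t ^ 3 + t ^ 4) (by linear_combination t_pow) : (𝓞 K5)ˣ) : 𝓞 K5)
    = ((-1:ℤ) : 𝓞 K5) + (1:ℤ) * t + (0:ℤ) * t ^ 2 + (0:ℤ) * t ^ 3 + (0:ℤ) * t ^ 4 := by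
    simp [unitOf]; ring
  rw [this, chi]; simp only [cc_coords]; simp

theorem chi_u2 : ∃ x : (𝓞 K5)ˣ, chi (x : 𝓞 K5) = (0, 1) := by
  have hu : (t ^ 3 + t ^ 2 - 1) * (-1 + t ^ 2 - t ^ 3 + t ^ 4) = 1 := by
    linear_combination (t ^ 2) * t_pow
  refine ⟨unitOf _ _ hu, ?_⟩
  have : ((unitOf _ _ hu : (𝓞 K5)ˣ) : 𝓞 K5)
    = ((-1:ℤ) : 𝓞 K5) + (0:ℤ) * t + (1:ℤ) * t ^ 2 + (1:ℤ) * t ^ 3 + (0:ℤ) * t ^ 4 := by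
    simp [unitOf]; ring
  rw [this, chi]; simp only [cc_coords]; simp

theorem unit_sq (x : (𝓞 K5)ˣ) (hx : chi (x : 𝓞 K5) = 0) : ∃ y : (𝓞 K5)ˣ, x = y ^ 2 ∨ x = -1 * y ^ 2 := by
  obtain ⟨f, g, hfg⟩ := units_gen
  have hchi : ∀ (a b : ℤ), ∀ z : (𝓞 K5)ˣ, z = f ^ a * g ^ b ∨ z = -1 * (f ^ a * g ^ b) →
      chi (z : 𝓞 K5) = ((a : ZMod 2) * (chi f).1 + (b : ZMod 2) * (chi g).1, (a : ZMod 2) * (chi f).2 + (b : ZMod 2) * (chi g).2) := by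
    intro a b z hz
    have h1 : chiU (Additive.ofMul (f ^ a * g ^ b)) = a • chiU (Additive.ofMul f) + b • chiU (Additive.ofMul g) := by
      rw [ofMul_mul, map_add, ofMul_zpow, ofMul_zpow, map_zsmul, map_zsmul]
    have h2 : chiU (Additive.ofMul (-1 * (f ^ a * g ^ b))) = chiU (Additive.ofMul (f ^ a * g ^ b)) := by
      rw [ofMul_mul, map_add]
      have : chiU (Additive.ofMul (-1)) = 0 := by
        change chi (((-1 : (𝓞 K5)ˣ)) : 𝓞 K5) = 0
        simp [chi, cc_neg_one]
      rw [this, zero_add]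
    have h3 : chi (z : 𝓞 K5) = chiU (Additive.ofMul (f ^ a * g ^ b)) := by
      rcases hz with rfl | rfl
      · rfl
      · rw [← h2]; rfl
    rw [h3, h1]
    change a • chi (f : 𝓞 K5) + b • chi (g : 𝓞 K5) = _
    ext <;> simp
  obtain ⟨u1, hu1⟩ := chi_u1
  obtain ⟨u2, hu2⟩ := chi_u2
  obtain ⟨a1, b1, h1⟩ := hfg u1
  obtain ⟨a2, b2, h2⟩ := hfg u2
  obtain ⟨a, b, h⟩ := hfg x
  have e1 := hchi _ _ _ h1
  have e2 := hchi _ _ _ h2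
  have e := hchi _ _ _ h
  rw [hu1] at e1
  rw [hu2] at e2
  rw [hx] at e
  have key : (a : ZMod 2) = 0 ∧ (b : ZMod 2) = 0 := by
    generalize (a : ZMod 2) = a at *
    generalize (b : ZMod 2) = b at *
    generalize (a1 : ZMod 2) = a1 at *
    generalize (b1 : ZMod 2) = b1 at *
    generalize (a2 : ZMod 2) = a2 at *
    generalize (b2 : ZMod 2) = b2 at *
    generalize (chi (f : 𝓞 K5)).1 = p at *
    generalize (chi (f : 𝓞 K5)).2 = q at *
    generalize (chi (g : 𝓞 K5)).1 = r at *
    generalize (chi (g : 𝓞 K5)).2 = s at *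
    clear hchi h h1 h2 hfg hu1 hu2 hx
    simp only [Prod.ext_iff, Prod.fst_zero, Prod.snd_zero] at e e1 e2
    obtain ⟨x1, x2⟩ := e
    obtain ⟨x3, x4⟩ := e1
    obtain ⟨x5, x6⟩ := e2
    have hd : (a1 * b2 - a2 * b1) * (p * s - q * r) = 1 := by
      have : (a1 * b2 - a2 * b1) * (p * s - q * r) =
        (a1 * p + b1 * r) * (a2 * q + b2 * s) - (a1 * q + b1 * s) * (a2 * p + b2 * r) := by ring
      rw [this, ← x3, ← x4, ← x5, ← x6]; ring
    have ha : a * (p * s - q * r) = 0 := by linear_combination -s * x1 + r * x2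
    have hb : b * (p * s - q * r) = 0 := by linear_combination q * x1 - p * x2
    constructor
    · linear_combination (a1 * b2 - a2 * b1) * ha - a * hd
    · linear_combination (a1 * b2 - a2 * b1) * hb - b * hd
  obtain ⟨m, rfl⟩ := (ZMod.intCast_zmod_eq_zero_iff_dvd a 2).mp key.1
  obtain ⟨n, rfl⟩ := (ZMod.intCast_zmod_eq_zero_iff_dvd b 2).mp key.2
  refine ⟨f ^ m * g ^ n, ?_⟩
  have : f ^ (((2:ℕ):ℤ) * m) * g ^ (((2:ℕ):ℤ) * n) = (f ^ m * g ^ n) ^ 2 := by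
    rw [zpow_mul', zpow_mul', zpow_natCast, zpow_natCast, mul_pow]
  rw [this] at h
  exact h

end FQ

namespace FQ
open NumberField Algebra

theorem sqfree_part {R : Type*} [CommRing R] [IsDomain R] [UniqueFactorizationMonoid R] (x : R) (hx : x ≠ 0) :
    ∃ c s : R, x = c ^ 2 * s ∧ Squarefree s := by
  revert hx
  refine UniqueFactorizationMonoid.induction_on_prime x ?_ ?_ ?_
  · intro h; exact absurd rfl h
  · intro u hu _
    exact ⟨1, u, by ring, hu.squarefree⟩
  · intro a p ha hp ih _
    obtain ⟨c, s, rfl, hs⟩ := ih ha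
    by_cases h : p ∣ s
    · obtain ⟨s', rfl⟩ := h
      exact ⟨c * p, s', by ring, hs.squarefree_of_dvd ⟨p, by ring⟩⟩
    · refine ⟨c, p * s, by ring, ?_⟩
      rw [squarefree_mul_iff]
      refine ⟨?_, hp.irreducible.squarefree, hs⟩
      exact (Irreducible.isRelPrime_iff_not_dvd hp.irreducible).mpr h

theorem cancel_sq {R : Type*} [CommRing R] [IsDomain R] [IsIntegrallyClosed R] {c s j e : R}
    (hc : c ≠ 0) (h : c ^ 2 * s * j = e ^ 2) : ∃ e', s * j = e' ^ 2 := by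
  have : c ∣ e := by
    rw [← IsIntegrallyClosed.pow_dvd_pow_iff (n := 2) (by norm_num)]
    exact ⟨s * j, by rw [← h]; ring⟩
  obtain ⟨e', rfl⟩ := this
  refine ⟨e', ?_⟩
  apply mul_left_cancel₀ (pow_ne_zero 2 hc)
  linear_combination h

theorem dvd_other {R : Type*} [CommRing R] [IsDomain R] {p s j e : R} (hp : Prime p) (hs : Squarefree s)
    (hps : p ∣ s) (h : s * j = e ^ 2) : p ∣ j := by
  obtain ⟨s', rfl⟩ := hps
  have hn : ¬ p ∣ s' := by
    rintro ⟨s'', rfl⟩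
    exact hp.not_isUnit (hs p ⟨s'', by ring⟩)
  have : p ∣ e := hp.dvd_of_dvd_pow (n := 2) (by rw [← h]; exact ⟨s' * j, by ring⟩)
  obtain ⟨e', rfl⟩ := this
  have h2 : s' * j = p * e' ^ 2 := by
    apply mul_left_cancel₀ hp.ne_zero
    linear_combination h
  exact (hp.dvd_or_dvd (show p ∣ s' * j from ⟨_, h2⟩)).resolve_left hn

instance : IsPrincipalIdealRing (𝓞 K5) := pidO

theorem norm_one_sub (l : ℕ) [NeZero l] (y : 𝓞 K5) : ((Algebra.norm ℤ (1 - (l : 𝓞 K5) * y) : ℤ) : ZMod l) = 1 := by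
  rw [Algebra.norm_eq_matrix_det b5]
  have := RingHom.map_det (Int.castRingHom (ZMod l)) (leftMulMatrix b5 (1 - (l : 𝓞 K5) * y))
  rw [eq_intCast] at this
  rw [this]
  have h2 : (Int.castRingHom (ZMod l)).mapMatrix (leftMulMatrix b5 (1 - (l : 𝓞 K5) * y)) = 1 := by
    rw [map_sub, map_mul, map_natCast, map_one, map_sub, map_mul, map_natCast, map_one]
    have h0 : ((l : ℕ) : Matrix (Fin 5) (Fin 5) (ZMod l)) = 0 := by
      rw [← Nat.cast_zero (R := Matrix (Fin 5) (Fin 5) (ZMod l))]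
      ext i j
      simp [Matrix.natCast_apply]
    rw [h0]; simp
  rw [h2, Matrix.det_one]

theorem exists_prime_of_dvd_norm {l : ℕ} (hl : l.Prime) {x : 𝓞 K5} (h : (l : ℤ) ∣ Algebra.norm ℤ x) :
    ∃ p : 𝓞 K5, Prime p ∧ p ∣ x ∧ p ∣ (l : 𝓞 K5) := by
  by_contra hc
  push Not at hc
  have hcop : IsCoprime x (l : 𝓞 K5) := isCoprime_of_prime_dvd (by
    rintro ⟨-, h0⟩
    exact hl.ne_zero (by exact_mod_cast h0)) hc
  obtain ⟨a, b, hab⟩ := hcop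
  have : NeZero l := ⟨hl.ne_zero⟩
  have h1 := norm_one_sub l b
  have h2 : 1 - (l : 𝓞 K5) * b = a * x := by linear_combination -hab
  rw [h2, map_mul] at h1
  obtain ⟨m, hm⟩ := h
  rw [hm] at h1
  push_cast at h1
  rw [ZMod.natCast_self] at h1
  have : Fact l.Prime := ⟨hl⟩
  simp at h1

theorem int_dvd {p : 𝓞 K5} (hp : Prime p) {l : ℕ} (hl : l.Prime) (hpl : p ∣ (l : 𝓞 K5)) {n : ℤ}
    (hn : p ∣ (n : 𝓞 K5)) : (l : ℤ) ∣ n := by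
  by_contra hc
  have := (Int.isCoprime_iff_gcd_eq_one.mpr (by
    rw [Int.gcd_eq_natAbs]; simpa using (Nat.Prime.coprime_iff_not_dvd hl).mpr (by
      rwa [← Int.natCast_dvd])) : IsCoprime (l : ℤ) n)
  obtain ⟨a, b, hab⟩ := this
  apply hp.not_isUnit
  apply isUnit_of_dvd_one
  have : (1 : 𝓞 K5) = a * l + b * n := by exact_mod_cast hab.symm
  rw [this]
  exact dvd_add (hpl.mul_left _) (hn.mul_left _)

theorem exists_nat_prime {p : 𝓞 K5} (hp : Prime p) {n : ℤ} (hn : n ≠ 0) (h : p ∣ (n : 𝓞 K5)) :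
    ∃ l : ℕ, l.Prime ∧ (l : ℤ) ∣ n ∧ p ∣ (l : 𝓞 K5) := by
  have h1 : p ∣ ((n.natAbs : ℕ) : 𝓞 K5) := by
    obtain ⟨k, hk⟩ : n ∣ (n.natAbs : ℤ) := Int.dvd_natAbs.mpr dvd_rfl
    have : ((n.natAbs : ℕ) : 𝓞 K5) = n * k := by
      rw [← Int.cast_natCast, hk, Int.cast_mul]
    rw [this]; exact h.mul_right _
  have h0 : n.natAbs ≠ 0 := by simpa using hn
  rw [← Nat.prod_primeFactorsList h0, Nat.cast_list_prod, hp.dvd_prod_iff] at h1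
  obtain ⟨a, ha, hpa⟩ := h1
  rw [List.mem_map] at ha
  obtain ⟨l, hl, rfl⟩ := ha
  exact ⟨l, Nat.prime_of_mem_primeFactorsList hl, Int.natCast_dvd.mpr (Nat.dvd_of_mem_primeFactorsList hl), hpa⟩

theorem dvd_of_same {p p' : 𝓞 K5} (hp' : Prime p') {l : ℕ} (hl : l.Prime) {c : ℤ}
    (h1 : p ∣ (l : 𝓞 K5)) (h2 : p ∣ t - (c : 𝓞 K5)) (h1' : p' ∣ (l : 𝓞 K5)) (h2' : p' ∣ t - (c : 𝓞 K5)) :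
    p ∣ p' := by
  obtain ⟨n, y, hz⟩ := dvd_sub_int p' c
  have hn : p' ∣ (n : 𝓞 K5) := by
    have : (n : 𝓞 K5) = p' - (t - c) * y := by linear_combination -hz
    rw [this]; exact dvd_sub dvd_rfl (h2'.mul_right _)
  obtain ⟨m, rfl⟩ := int_dvd hp' hl h1' hn
  rw [hz]
  push_cast
  exact dvd_add (h1.mul_right _) (h2.mul_right _)

theorem norm_deg_one {p : 𝓞 K5} (hp : Prime p) {l : ℕ} (hl : l.Prime) {c : ℤ}
    (h1 : p ∣ (l : 𝓞 K5)) (h2 : p ∣ t - (c : 𝓞 K5)) : (Algebra.norm ℤ p).natAbs = l := by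
  rw [← Ideal.absNorm_span_singleton, Ideal.absNorm_apply, Submodule.cardQuot_apply]
  have hker : ∀ z : 𝓞 K5, Ideal.Quotient.mk (Ideal.span {p}) z = 0 ↔ p ∣ z := fun z => by
    rw [Ideal.Quotient.eq_zero_iff_mem, Ideal.mem_span_singleton]
  have hchar : CharP (𝓞 K5 ⧸ Ideal.span {p}) l := by
    constructor
    intro n
    have : (n : 𝓞 K5 ⧸ Ideal.span {p}) = Ideal.Quotient.mk (Ideal.span {p}) (n : 𝓞 K5) := by simp
    rw [this, hker]
    constructor
    · intro h
      have := int_dvd hp hl h1 (n := n) (by exact_mod_cast h)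
      exact_mod_cast this
    · rintro ⟨m, rfl⟩
      push_cast; exact h1.mul_right _
  have hb : Function.Bijective (ZMod.castHom (dvd_refl l) (𝓞 K5 ⧸ Ideal.span {p})) := by
    refine ⟨ZMod.castHom_injective _, ?_⟩
    intro q
    obtain ⟨z, rfl⟩ := Ideal.Quotient.mk_surjective q
    obtain ⟨n, y, rfl⟩ := dvd_sub_int z c
    refine ⟨(n : ZMod l), ?_⟩
    rw [map_intCast, map_add, map_intCast, (hker _).mpr (h2.mul_right _), add_zero]
  have := Nat.card_eq_of_bijective _ hb
  rw [Nat.card_zmod] at this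
  exact this.symm

end FQ

namespace FQ
open NumberField Algebra

theorem dvd_two_of_dvd_t {p : 𝓞 K5} (h : p ∣ t) : p ∣ ((2:ℕ) : 𝓞 K5) := by
  push_cast; rw [← t_pow]; exact dvd_pow h (by norm_num)

theorem t_of_dvd_two {p : 𝓞 K5} (hp : Prime p) (h : p ∣ (2 : 𝓞 K5)) : p ∣ t := by
  rw [← t_pow] at h; exact hp.dvd_of_dvd_pow h

theorem t_of_dvd_five {p : 𝓞 K5} (hp : Prime p) (h : p ∣ (5 : 𝓞 K5)) : p ∣ t - ((2:ℤ) : 𝓞 K5) := by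
  apply hp.dvd_of_dvd_pow (n := 5)
  have : (t - ((2:ℤ) : 𝓞 K5)) ^ 5 = 5 * (-2 * t ^ 4 + 8 * t ^ 3 - 16 * t ^ 2 + 16 * t - 6) := by
    push_cast; linear_combination t_pow
  rw [this]; exact h.mul_right _

section
variable (A B C d G0 G1 J1 J2 J3 : ℤ)

theorem H_int (hA : 0 < A) (hodd : ¬ (2:ℤ) ∣ A) (hd : d ≠ 0)
    (hg : ∀ l : ℕ, l.Prime → (l:ℤ) ∣ G0 → (l:ℤ) ∣ G1 → (l:ℤ) ∣ d → False)
    (E1 : A * J1 = G1 ^ 2) (E2 : A * J2 + B * J1 = 2 * G0 * G1 - d ^ 2)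
    (E3 : A * J3 + B * J2 + C * J1 = G0 ^ 2) (E4 : B * J3 + C * J2 = d * G1) (E5 : C * J3 = d * G0)
    (hN : ∃ m : ℤ, A * Algebra.norm ℤ ((A : 𝓞 K5) - B * t ^ 2 + C * t ^ 4) = m ^ 2) :
    ∃ γ : 𝓞 K5, (A : 𝓞 K5) * ((A : 𝓞 K5) - B * t ^ 2 + C * t ^ 4) = γ ^ 2 := by
  have T5 : t ^ 5 = 2 := t_pow
  set α : 𝓞 K5 := (A : 𝓞 K5) - B * t ^ 2 + C * t ^ 4 with hα
  set j : 𝓞 K5 := (J1 : 𝓞 K5) - J2 * t ^ 2 + J3 * t ^ 4 with hj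
  set η : 𝓞 K5 := (G1 : 𝓞 K5) - d * t - G0 * t ^ 2 with hη
  have c1 : (A : 𝓞 K5) * J1 = G1 ^ 2 := by exact_mod_cast E1
  have c2 : (A : 𝓞 K5) * J2 + B * J1 = 2 * G0 * G1 - d ^ 2 := by exact_mod_cast E2
  have c3 : (A : 𝓞 K5) * J3 + B * J2 + C * J1 = G0 ^ 2 := by exact_mod_cast E3
  have c4 : (B : 𝓞 K5) * J3 + C * J2 = d * G1 := by exact_mod_cast E4
  have c5 : (C : 𝓞 K5) * J3 = d * G0 := by exact_mod_cast E5
  have hprod : α * j = η ^ 2 := by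
    rw [hα, hj, hη]
    linear_combination c1 - t ^ 2 * c2 + t ^ 4 * c3 - t ^ 6 * c4 + t ^ 8 * c5 +
      (d * G0 * t ^ 3 - d * G1 * t : 𝓞 K5) * T5
  have hder : (-2 * B * t + 4 * C * t ^ 3 : 𝓞 K5) * j + α * (-2 * J2 * t + 4 * J3 * t ^ 3) -
      2 * η * (-d - 2 * G0 * t) = -10 * d * η - 10 * d ^ 2 * t := by
    rw [hα, hj, hη]
    linear_combination - 2 * t * c2 + 4 * t ^ 3 * c3 - 6 * t ^ 5 * c4 + 8 * t ^ 7 * c5 +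
      (8 * d * G0 * t ^ 2 - 6 * d * G1 : 𝓞 K5) * T5
  have hα2 : ∀ p : 𝓞 K5, Prime p → p ∣ α → ¬ p ∣ (2 : 𝓞 K5) := by
    intro p hp h1 h2
    have ht := t_of_dvd_two hp h2
    have : p ∣ (A : 𝓞 K5) := by
      have e : (A : 𝓞 K5) = α + t * (B * t - C * t ^ 3) := by rw [hα]; ring
      rw [e]; exact dvd_add h1 (ht.mul_right _)
    exact hodd (by exact_mod_cast int_dvd hp Nat.prime_two (by exact_mod_cast h2) this)
  obtain ⟨m, hm⟩ := hN
  have hA0 : A ≠ 0 := hA.ne'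
  have hAsq : ∃ c : ℤ, A = c ^ 2 := by
    obtain ⟨c, s, hcs, hsf⟩ := sqfree_part A hA0
    have hc0 : c ≠ 0 := by rintro rfl; apply hA0; rw [hcs]; ring
    have hs1 : s.natAbs = 1 := by
      by_contra hne
      obtain ⟨l, hl, hls⟩ := Nat.exists_prime_and_dvd hne
      have hls' : (l : ℤ) ∣ s := Int.natCast_dvd.mpr hls
      have hlA : (l : ℤ) ∣ A := by rw [hcs]; exact hls'.mul_left _
      have hlp : Prime (l : ℤ) := Nat.prime_iff_prime_int.mp hl
      by_cases hld : (l : ℤ) ∣ d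
      · have hG1 : (l : ℤ) ∣ G1 := hlp.dvd_of_dvd_pow (n := 2) (by rw [← E1]; exact hlA.mul_right _)
        obtain ⟨e, he⟩ := cancel_sq hc0 (s := s) (by rw [← hcs]; exact hm)
        have hlN := dvd_other hlp hsf hls' he
        obtain ⟨p, hp, hpa, hpl⟩ := exists_prime_of_dvd_norm hl hlN
        have hpη : p ∣ η := hp.dvd_of_dvd_pow (n := 2) (by rw [← hprod]; exact hpa.mul_right _)
        have tr : ∀ {n : ℤ}, (l : ℤ) ∣ n → p ∣ (n : 𝓞 K5) := by
          rintro n ⟨k, rfl⟩; push_cast; exact hpl.mul_right _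
        have h3 : p ∣ (G0 : 𝓞 K5) * t ^ 2 := by
          have e : (G0 : 𝓞 K5) * t ^ 2 = G1 - d * t - η := by rw [hη]; ring
          rw [e]; exact dvd_sub (dvd_sub (tr hG1) ((tr hld).mul_right _)) hpη
        rcases hp.dvd_or_dvd h3 with h4 | h4
        · exact hg l hl (int_dvd hp hl hpl h4) hG1 hld
        · exact hα2 p hp hpa (by exact_mod_cast dvd_two_of_dvd_t (hp.dvd_of_dvd_pow h4))
      · obtain ⟨e, he⟩ := cancel_sq hc0 (s := s) (by rw [← hcs]; exact E1)
        have hJ := dvd_other hlp hsf hls' he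
        have hG1 : (l : ℤ) ∣ G1 := hlp.dvd_of_dvd_pow (n := 2) (by rw [← E1]; exact hlA.mul_right _)
        apply hld
        apply hlp.dvd_of_dvd_pow (n := 2)
        have e : d ^ 2 = 2 * G0 * G1 - A * J2 - B * J1 := by linear_combination E2
        rw [e]
        exact dvd_sub (dvd_sub (hG1.mul_left _) (hlA.mul_right _)) (hJ.mul_left _)
    rcases Int.natAbs_eq s with h | h
    · rw [hs1] at h; exact ⟨c, by rw [hcs, h]; simp⟩
    · rw [hs1] at h; exfalso
      rw [hcs, h] at hA
      push_cast at hA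
      nlinarith [sq_nonneg c]
  obtain ⟨c, hc⟩ := hAsq
  have hc0 : c ≠ 0 := by rintro rfl; apply hA0; rw [hc]; ring
  have hm' : c ^ 2 * 1 * Algebra.norm ℤ α = m ^ 2 := by rw [mul_one, ← hc]; exact hm
  obtain ⟨e, he⟩ := cancel_sq hc0 hm'
  rw [one_mul] at he
  have hα0 : α ≠ 0 := by
    intro h0
    have := liZ (a := A) (b := 0) (c := -B) (d := 0) (e := C) (by rw [← h0, hα]; push_cast; ring)
    exact hA0 this.1
  obtain ⟨γ, σ, hγσ, hsf⟩ := sqfree_part α hα0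
  have hγ0 : γ ≠ 0 := by rintro rfl; apply hα0; rw [hγσ]; ring
  have hNγ0 : Algebra.norm ℤ γ ≠ 0 := Algebra.norm_ne_zero_iff.mpr hγ0
  have hNσ : ∃ f : ℤ, Algebra.norm ℤ σ = f ^ 2 := by
    rw [hγσ, map_mul, map_pow] at he
    obtain ⟨f, hf⟩ := cancel_sq hNγ0 (j := 1) (by rw [mul_one]; exact he)
    exact ⟨f, by rw [← hf, mul_one]⟩
  obtain ⟨f, hf⟩ := hNσ
  have hσα : σ ∣ α := ⟨γ ^ 2, by rw [hγσ]; ring⟩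
  have hunit : IsUnit σ := by
    by_contra hnu
    obtain ⟨p, hpirr, hpσ⟩ := WfDvdMonoid.exists_irreducible_factor hnu hsf.ne_zero
    have hp : Prime p := hpirr.prime
    have hpα := hpσ.trans hσα
    have hpj : p ∣ j := by
      obtain ⟨e', he'⟩ := cancel_sq hγ0 (s := σ) (by rw [← hγσ]; exact hprod)
      exact dvd_other hp hsf hpσ he'
    have hpη : p ∣ η := hp.dvd_of_dvd_pow (n := 2) (by rw [← hprod]; exact hpα.mul_right _)
    have hp10 : p ∣ (2 : 𝓞 K5) * (5 * (d ^ 2 * t)) := by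
      have e2 : (2 : 𝓞 K5) * (5 * (d ^ 2 * t)) = -10 * d * η -
        ((-2 * B * t + 4 * C * t ^ 3 : 𝓞 K5) * j + α * (-2 * J2 * t + 4 * J3 * t ^ 3) -
          2 * η * (-d - 2 * G0 * t)) := by linear_combination hder
      rw [e2]
      refine dvd_sub (hpη.mul_left _) (dvd_sub (dvd_add (hpj.mul_left _) (hpα.mul_right _)) ?_)
      exact (hpη.mul_left _).mul_right _
    have hp2 := hα2 p hp hpα
    have hp5 := (hp.dvd_or_dvd hp10).resolve_left hp2
    have key : ∃ (l : ℕ) (r : ℤ), l.Prime ∧ p ∣ (l : 𝓞 K5) ∧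
        ∀ p' : 𝓞 K5, Prime p' → p' ∣ α → p' ∣ (l : 𝓞 K5) → p' ∣ t - (r : 𝓞 K5) := by
      rcases hp.dvd_or_dvd hp5 with h5 | h5
      · refine ⟨5, 2, Nat.prime_five, by exact_mod_cast h5, fun p' hp' _ h => t_of_dvd_five hp' (by exact_mod_cast h)⟩
      · rcases hp.dvd_or_dvd h5 with h6 | h6
        · have h7 := hp.dvd_of_dvd_pow h6
          obtain ⟨l, hl, hld, hpl⟩ := exists_nat_prime hp hd h7
          have hlp : Prime (l : ℤ) := Nat.prime_iff_prime_int.mp hl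
          have hl2 : ¬ l ∣ 2 := by
            intro h
            have : l = 2 := (Nat.prime_dvd_prime_iff_eq hl Nat.prime_two).mp h
            subst this
            exact hp2 (by exact_mod_cast hpl)
          have hrel : ∀ p' : 𝓞 K5, Prime p' → p' ∣ α → p' ∣ (l : 𝓞 K5) → p' ∣ (G1 : 𝓞 K5) - G0 * t ^ 2 := by
            intro p' hp' ha' hl'
            have hη' : p' ∣ η := hp'.dvd_of_dvd_pow (n := 2) (by rw [← hprod]; exact ha'.mul_right _)
            have hd' : p' ∣ (d : 𝓞 K5) := by
              obtain ⟨k, hk⟩ := hld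
              rw [hk]; push_cast; exact hl'.mul_right _
            have e3 : (G1 : 𝓞 K5) - G0 * t ^ 2 = η + d * t := by rw [hη]; ring
            rw [e3]; exact dvd_add hη' (hd'.mul_right _)
          have hG0 : ¬ (l : ℤ) ∣ G0 := by
            intro h
            have h8 : p ∣ (G0 : 𝓞 K5) := by
              obtain ⟨k, hk⟩ := h
              rw [hk]; push_cast; exact hpl.mul_right _
            have h9 : p ∣ (G1 : 𝓞 K5) := by
              have e4 : (G1 : 𝓞 K5) = (G1 - G0 * t ^ 2) + G0 * t ^ 2 := by ring
              rw [e4]; exact dvd_add (hrel p hp hpα hpl) (h8.mul_right _)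
            exact hg l hl h (int_dvd hp hl hpl h9) hld
          have h2G : ¬ (l : ℤ) ∣ 2 * G0 ^ 3 := by
            intro h
            rcases hlp.dvd_or_dvd h with h | h
            · exact hl2 (by exact_mod_cast h)
            · exact hG0 (hlp.dvd_of_dvd_pow h)
          have hcop : IsCoprime (l : ℤ) (2 * G0 ^ 3) :=
            (Irreducible.coprime_iff_not_dvd hlp.irreducible).mpr h2G
          obtain ⟨x, y, hxy⟩ := hcop
          refine ⟨l, y * G1 ^ 3, hl, hpl, fun p' hp' ha' hl' => ?_⟩
          have h10 := hrel p' hp' ha' hl'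
          have hxy' : (x : 𝓞 K5) * l + y * (2 * G0 ^ 3) = 1 := by exact_mod_cast hxy
          have e5 : t - ((y * G1 ^ 3 : ℤ) : 𝓞 K5) = l * (x * t) -
              (G1 - G0 * t ^ 2) * (y * (G1 ^ 2 + G1 * (G0 * t ^ 2) + G0 ^ 2 * t ^ 4)) := by
            push_cast
            linear_combination -t * hxy' - y * G0 ^ 3 * t * T5
          rw [e5]
          exact dvd_sub (hl'.mul_right _) (h10.mul_right _)
        · exact absurd (by exact_mod_cast dvd_two_of_dvd_t h6) hp2
    obtain ⟨l, r, hl, hpl, hres⟩ := key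
    have hlp : Prime (l : ℤ) := Nat.prime_iff_prime_int.mp hl
    have hnp := norm_deg_one hp hl hpl (hres p hp hpα hpl)
    obtain ⟨σ', hσ'⟩ := hpσ
    have hlN : (l : ℤ) ∣ Algebra.norm ℤ p := by rw [← hnp]; exact Int.natAbs_dvd.mpr dvd_rfl
    have hlN' : (l : ℤ) ∣ Algebra.norm ℤ σ' := by
      have h1 : Algebra.norm ℤ p * Algebra.norm ℤ σ' = f ^ 2 := by rw [← map_mul, ← hσ', hf]
      have hsqf : Squarefree (Algebra.norm ℤ p) := by
        rw [← Int.squarefree_natAbs, hnp]; exact hl.squarefree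
      exact dvd_other hlp hsqf hlN h1
    obtain ⟨p', hp', hpσ', hpl'⟩ := exists_prime_of_dvd_norm hl hlN'
    have hpα' : p' ∣ α := (hpσ'.trans ⟨p, by rw [hσ']; ring⟩).trans hσα
    have hdvd : p ∣ p' := dvd_of_same hp' hl hpl (hres p hp hpα hpl) hpl' (hres p' hp' hpα' hpl')
    obtain ⟨k, hk⟩ := hdvd.trans hpσ'
    exact hp.not_isUnit (hsf p ⟨k, by rw [hσ', hk]; ring⟩)
  obtain ⟨ε, rfl⟩ := hunit
  have hαform : α = ((A:ℤ) : 𝓞 K5) + (0:ℤ) * t + (-B:ℤ) * t ^ 2 + (0:ℤ) * t ^ 3 + (C:ℤ) * t ^ 4 := by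
    rw [hα]; push_cast; ring
  have hcα : cc 0 α = 1 := by
    rw [hαform, cc_coords]
    simp only [Matrix.cons_val_zero]
    have h1 : (A : ZMod 2) ≠ 0 := by
      intro h; exact hodd (by exact_mod_cast (ZMod.intCast_zmod_eq_zero_iff_dvd A 2).mp h)
    generalize (A : ZMod 2) = a at *
    revert a; decide
  have hχα : chi α = 0 := by
    rw [hαform, chi]; simp only [cc_coords]; simp
  have hcγ : cc 0 γ = 1 := by
    rw [hγσ, (cc_mul _ _).1, sq, (cc_mul _ _).1, cc_unit] at hcα
    generalize cc 0 γ = a at *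
    revert a; decide
  have hχ : chi (ε : 𝓞 K5) = 0 := by
    have hcγ2 : cc 0 (γ ^ 2) = 1 := by rw [sq, (cc_mul _ _).1, hcγ]; rfl
    rw [hγσ, chi_mul hcγ2 (cc_unit _), sq, chi_mul hcγ hcγ] at hχα
    generalize chi γ = a at *
    generalize chi (ε : 𝓞 K5) = b at *
    revert a b; decide
  obtain ⟨y, hy⟩ := unit_sq ε hχ
  rcases hy with hy | hy
  · refine ⟨c * γ * y, ?_⟩
    rw [hγσ, hy, hc]; push_cast; ring
  · exfalso
    have h1 : Algebra.norm ℤ (-1 : 𝓞 K5) = -1 := by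
      have := norm_alpha (-1) 0 0
      simpa using this
    rw [hy] at hf
    push_cast at hf
    rw [map_mul, h1, map_pow] at hf
    have h2 : Algebra.norm ℤ (y : 𝓞 K5) ≠ 0 := Algebra.norm_ne_zero_iff.mpr y.ne_zero
    have h3 : 0 < (Algebra.norm ℤ (y : 𝓞 K5)) ^ 2 := by positivity
    nlinarith [sq_nonneg f]
end
end FQ

namespace FQ

/-- The ring of 2-integral rationals. -/
noncomputable def R : Subring ℚ := (PadicInt.subring 2).comap (Rat.castHom ℚ_[2])

theorem mem_R {x : ℚ} : x ∈ R ↔ ‖(x : ℚ_[2])‖ ≤ 1 := Iff.rfl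

@[simp, norm_cast] theorem coe_ofNat (n : ℕ) [n.AtLeastTwo] : ((ofNat(n) : R) : ℚ) = ofNat(n) := rfl

/-- The embedding into the 2-adic integers. -/
noncomputable def toZ2 : R →+* ℤ_[2] :=
  RingHom.codRestrict ((Rat.castHom ℚ_[2]).comp R.subtype) (PadicInt.subring 2) (fun x => x.2)

theorem toZ2_coe (x : R) : ((toZ2 x : ℤ_[2]) : ℚ_[2]) = ((x : ℚ) : ℚ_[2]) := rfl

/-- Reduction modulo 2. -/
noncomputable def red : R →+* ZMod 2 := (PadicInt.toZMod).comp toZ2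

theorem red_eq_zero_iff_norm {x : R} : red x = 0 ↔ ‖((x : ℚ) : ℚ_[2])‖ < 1 := by
  have : red x = 0 ↔ toZ2 x ∈ RingHom.ker (PadicInt.toZMod : ℤ_[2] →+* ZMod 2) := Iff.rfl
  rw [this, PadicInt.ker_toZMod, IsLocalRing.mem_maximalIdeal, PadicInt.mem_nonunits]
  rfl

theorem norm_two : ‖((2:ℚ) : ℚ_[2])‖ = 1 / 2 := by
  have := Padic.norm_p (p := 2)
  push_cast at this ⊢
  rw [this]; norm_num

theorem even_iff {x : R} : red x = 0 ↔ ∃ y : R, x = 2 * y := by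
  constructor
  · intro h
    rw [red_eq_zero_iff_norm] at h
    have h1 : ((2:ℕ):ℤ_[2]) ∣ toZ2 x := (PadicInt.norm_lt_one_iff_dvd _).mp h
    obtain ⟨y, hy⟩ := h1
    refine ⟨⟨(x:ℚ)/2, ?_⟩, ?_⟩
    · rw [mem_R]
      have h2 : ((((x:ℚ)/2 : ℚ)) : ℚ_[2]) = (y : ℚ_[2]) := by
        have h3 := toZ2_coe x
        rw [hy] at h3
        have h4 : (((2:ℕ) : ℤ_[2]) : ℚ_[2]) = 2 := by norm_cast
        rw [PadicInt.coe_mul, h4] at h3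
        rw [Rat.cast_div, ← h3, Rat.cast_ofNat]
        field_simp
      rw [h2]; exact y.2
    · apply Subtype.ext; push_cast; ring
  · rintro ⟨y, rfl⟩
    rw [map_mul, map_ofNat]
    have : (2 : ZMod 2) = 0 := rfl
    rw [this, zero_mul]

theorem unit_of_red {x : R} (h : red x ≠ 0) : ∃ y : R, x * y = 1 := by
  rw [Ne, red_eq_zero_iff_norm, not_lt] at h
  have hx := mem_R.mp x.2
  have h1 : ‖((x : ℚ) : ℚ_[2])‖ = 1 := le_antisymm hx h
  refine ⟨⟨(x:ℚ)⁻¹, ?_⟩, ?_⟩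
  · rw [mem_R]; push_cast; rw [norm_inv, h1]; norm_num
  · apply Subtype.ext; push_cast
    apply mul_inv_cancel₀
    intro h0; rw [h0] at h1; simp at h1

theorem red_zero_or_one (a : ZMod 2) : a = 0 ∨ a = 1 := by revert a; decide

theorem int_or_inv (x : ℚ) : (∃ y : R, (y:ℚ) = x) ∨ (∃ y : R, (y : ℚ) * x = 1 ∧ red y = 0) := by
  by_cases h : ‖(x : ℚ_[2])‖ ≤ 1
  · exact Or.inl ⟨⟨x, mem_R.mpr h⟩, rfl⟩
  · right
    push Not at h
    have hx : x ≠ 0 := by rintro rfl; simp at h; linarith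
    have h2 : ‖((x⁻¹ : ℚ) : ℚ_[2])‖ < 1 := by
      push_cast; rw [norm_inv]; exact inv_lt_one_of_one_lt₀ h
    exact ⟨⟨x⁻¹, mem_R.mpr h2.le⟩, inv_mul_cancel₀ hx, red_eq_zero_iff_norm.mpr h2⟩

theorem zero_of_pow (x : R) (h : ∀ n : ℕ, ∃ y : R, x = 2 ^ n * y) : x = 0 := by
  have h1 : ∀ n : ℕ, ‖((x:ℚ) : ℚ_[2])‖ ≤ (1/2:ℝ) ^ n := by
    intro n
    obtain ⟨y, hy⟩ := h n
    have : (x : ℚ) = 2 ^ n * (y : ℚ) := by rw [hy]; push_cast; rfl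
    rw [this]
    have h2 := norm_two
    have h3 := mem_R.mp y.2
    push_cast at h2 ⊢
    rw [norm_mul, norm_pow, h2]
    exact mul_le_of_le_one_right (by positivity) h3
  have h2 : ‖((x:ℚ) : ℚ_[2])‖ ≤ 0 :=
    ge_of_tendsto' (tendsto_pow_atTop_nhds_zero_of_lt_one (by norm_num) (by norm_num)) h1
  have h3 := norm_le_zero_iff.mp h2
  apply Subtype.ext
  exact_mod_cast h3

theorem den_odd (x : R) : ¬ (2:ℕ) ∣ (x:ℚ).den := by
  intro h
  have h1 := PadicInt.isUnit_den (p := 2) (x:ℚ) (mem_R.mp x.2)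
  rw [PadicInt.isUnit_iff] at h1
  have h2 := (PadicInt.norm_int_lt_one_iff_dvd (p := 2) ((x:ℚ).den : ℤ)).mpr (by exact_mod_cast h)
  push_cast at h2
  rw [h1] at h2; exact lt_irrefl _ h2

/-- normalisation of a nonzero tuple -/
theorem scale {n : ℕ} (x : Fin n → ℚ) (hx : x ≠ 0) :
    ∃ (c : ℚ) (y : Fin n → R), c ≠ 0 ∧ (∀ i, x i = c * y i) ∧ ∃ i, y i = 1 := by
  obtain ⟨i0, hi0⟩ : ∃ i, x i ≠ 0 := by
    by_contra h; push Not at h; exact hx (funext h)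
  obtain ⟨i, -, hi⟩ := Finset.exists_max_image Finset.univ (fun i => ‖(x i : ℚ_[2])‖) ⟨i0, Finset.mem_univ _⟩
  have hi1 : 0 < ‖(x i : ℚ_[2])‖ :=
    lt_of_lt_of_le (norm_pos_iff.mpr (by exact_mod_cast hi0)) (hi i0 (Finset.mem_univ _))
  have hi2 : x i ≠ 0 := by intro h; rw [h] at hi1; simp at hi1
  refine ⟨x i, fun k => ⟨x k / x i, ?_⟩, hi2, fun k => ?_, i, ?_⟩
  · rw [mem_R]; push_cast; rw [norm_div]
    exact (div_le_one hi1).mpr (hi k (Finset.mem_univ _))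
  · change x k = x i * (x k / x i); field_simp
  · apply Subtype.ext; exact div_self hi2

theorem red_two : red 2 = 0 := by rw [map_ofNat]; rfl

end FQ

namespace FQ

/-- Descent data. -/
structure KD (p q g0 g1 k1 k2 k3 : R) : Prop where
  hp : red p = 0
  hq : red q = 0
  e0 : q * k3 = g0
  e1 : q * k2 + p * k3 = g1
  e2 : k3 + p * k2 + q * k1 = g0 ^ 2
  e3 : k2 + p * k1 = 2 * g0 * g1 - 1
  e4 : k1 = g1 ^ 2

theorem prim3 (a b c : ℤ) (h : 0 < a) : ∃ g A B Cc : ℤ, 0 < g ∧ 0 < A ∧ a = g * A ∧ b = g * B ∧ c = g * Cc ∧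
    (C A * X ^ 2 + C B * X + C Cc : ℤ[X]).IsPrimitive := by
  set P : ℤ[X] := C a * X ^ 2 + C b * X + C c with hP
  have hdeg : P.natDegree = 2 := by rw [hP]; exact natDegree_quadratic h.ne'
  have hP0 : P ≠ 0 := by intro h0; rw [h0] at hdeg; simp at hdeg
  have hcont := P.eq_C_content_mul_primPart
  have hc0 : P.content ≠ 0 := by rwa [Ne, content_eq_zero_iff]
  have hcpos : 0 < P.content :=
    lt_of_le_of_ne (Int.nonneg_of_normalize_eq_self P.normalize_content) (Ne.symm hc0)
  have hdeg2 : P.primPart.natDegree ≤ 2 := by rw [natDegree_primPart, hdeg]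
  have hco : ∀ n, P.coeff n = P.content * P.primPart.coeff n := by
    intro n; conv_lhs => rw [hcont]
    rw [coeff_C_mul]
  have c2 : P.coeff 2 = a := by rw [hP]; simp only [coeff_add, coeff_C_mul, coeff_X_pow, coeff_X, coeff_C]; norm_num
  have c1 : P.coeff 1 = b := by rw [hP]; simp only [coeff_add, coeff_C_mul, coeff_X_pow, coeff_X, coeff_C]; norm_num
  have c0 : P.coeff 0 = c := by rw [hP]; simp only [coeff_add, coeff_C_mul, coeff_X_pow, coeff_X, coeff_C]; norm_num
  refine ⟨P.content, P.primPart.coeff 2, P.primPart.coeff 1, P.primPart.coeff 0, hcpos, ?_, ?_, ?_, ?_, ?_⟩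
  · have := hco 2; rw [c2] at this; rw [this] at h; exact (mul_pos_iff_of_pos_left hcpos).mp h
  · rw [← hco, c2]
  · rw [← hco, c1]
  · rw [← hco, c0]
  · have : (C (P.primPart.coeff 2) * X ^ 2 + C (P.primPart.coeff 1) * X + C (P.primPart.coeff 0) : ℤ[X]) = P.primPart := by
      conv_rhs => rw [P.primPart.as_sum_range' 3 (by omega)]
      simp only [Finset.sum_range_succ, Finset.sum_range_zero, ← C_mul_X_pow_eq_monomial]
      simp; ring
    rw [this]; exact P.isPrimitive_primPart

theorem KD.H {p q g0 g1 k1 k2 k3 : R} (h : KD p q g0 g1 k1 k2 k3) :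
    ∃ δ : K5, 1 - ((p:ℚ):K5) * tau ^ 2 + ((q:ℚ) : K5) * tau ^ 4 = δ ^ 2 := by
  obtain ⟨-, -, e0, e1, e2, e3, e4⟩ := h
  have hpd := den_odd p
  have hqd := den_odd q
  have e0' := congrArg (Subtype.val) e0
  have e1' := congrArg (Subtype.val) e1
  have e2' := congrArg (Subtype.val) e2
  have e3' := congrArg (Subtype.val) e3
  have e4' := congrArg (Subtype.val) e4
  push_cast at e0' e1' e2' e3' e4'
  clear e0 e1 e2 e3 e4
  generalize (p:ℚ) = p at *
  generalize (q:ℚ) = q at *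
  generalize (g0:ℚ) = g0 at *
  generalize (g1:ℚ) = g1 at *
  generalize (k1:ℚ) = k1 at *
  generalize (k2:ℚ) = k2 at *
  generalize (k3:ℚ) = k3 at *
  obtain ⟨n, A, B, Cc, hn, hA, hnA, hnB, hnC, hprim⟩ := prim3 (p.den * q.den) (p.num * q.den) (q.num * p.den)
    (by have := p.pos; have := q.pos; positivity)
  obtain ⟨n', d, G0, G1, hn', hd, hnd, hnG0, hnG1, hprim'⟩ := prim3 (g0.den * g1.den) (g0.num * g1.den) (g1.num * g0.den)
    (by have := g0.pos; have := g1.pos; positivity)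
  have hA0 : (A:ℚ) ≠ 0 := by exact_mod_cast hA.ne'
  have hd0 : (d:ℚ) ≠ 0 := by exact_mod_cast hd.ne'
  have frac : ∀ {x y : ℚ} {n A B : ℤ}, 0 < n → 0 < A → (x.den * y.den : ℤ) = n * A → x.num * y.den = n * B → x * A = B := by
    intro x y n A B hn hA h1 h2
    have h1' : (x.den * y.den : ℚ) = n * A := by exact_mod_cast h1
    have h2' : (x.num * y.den : ℚ) = n * B := by exact_mod_cast h2
    have hx := Rat.num_div_den x
    have hxd : (x.den : ℚ) ≠ 0 := by exact_mod_cast x.pos.ne'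
    have hn0 : (n:ℚ) ≠ 0 := by exact_mod_cast hn.ne'
    rw [div_eq_iff hxd] at hx
    apply mul_left_cancel₀ hn0
    linear_combination -x * h1' + h2' - y.den * hx
  have hpA : p * A = B := frac hn hA hnA hnB
  have hqA : q * A = Cc := frac (x := q) (y := p) hn hA (by rw [mul_comm]; exact hnA) hnC
  have hg0 : g0 * d = G0 := frac hn' hd hnd hnG0
  have hg1 : g1 * d = G1 := frac (x := g1) (y := g0) hn' hd (by rw [mul_comm]; exact hnd) hnG1
  set Q : ℤ[X] := C (G1 ^ 2) * X ^ 4 + C (2 * G0 * G1 - d ^ 2) * X ^ 3 + C (G0 ^ 2) * X ^ 2 + C (d * G1) * X + C (d * G0) with hQ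
  set J : ℚ[X] := C (d ^ 2 * k1 / A) * X ^ 2 + C (d ^ 2 * k2 / A) * X + C (d ^ 2 * k3 / A) with hJ
  have hfac : Q.map (Int.castRingHom ℚ) = (C A * X ^ 2 + C B * X + C Cc : ℤ[X]).map (Int.castRingHom ℚ) * J := by
    have f1 : (A:ℚ) * (d ^ 2 * k1 / A) = G1 ^ 2 := by
      rw [← hg1]; field_simp; linear_combination e4'
    have f2 : (A:ℚ) * (d ^ 2 * k2 / A) + B * (d ^ 2 * k1 / A) = 2 * G0 * G1 - d ^ 2 := by
      rw [← hg1, ← hg0, ← hpA]; field_simp; linear_combination e3'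
    have f3 : (A:ℚ) * (d ^ 2 * k3 / A) + B * (d ^ 2 * k2 / A) + Cc * (d ^ 2 * k1 / A)= G0 ^ 2 := by
      rw [← hg0, ← hpA, ← hqA]; field_simp; linear_combination e2'
    have f4 : B * (d ^ 2 * k3 / A) + Cc * (d ^ 2 * k2 / A) = d * G1 := by
      rw [← hg1, ← hpA, ← hqA]; field_simp; linear_combination e1'
    have f5 : Cc * (d ^ 2 * k3 / A) = d * G0 := by
      rw [← hg0, ← hqA]; field_simp; linear_combination e0'
    rw [hQ, hJ]
    simp only [Polynomial.map_add, Polynomial.map_mul, Polynomial.map_pow, map_X, map_C]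
    simp only [eq_intCast]
    push_cast
    have f1' := congrArg (C : ℚ → ℚ[X]) f1
    have f2' := congrArg (C : ℚ → ℚ[X]) f2
    have f3' := congrArg (C : ℚ → ℚ[X]) f3
    have f4' := congrArg (C : ℚ → ℚ[X]) f4
    have f5' := congrArg (C : ℚ → ℚ[X]) f5
    rw [← f1, ← f2, ← f3, ← f4, ← f5]
    simp only [C_add, C_mul]
    ring
  have hdvd : (C A * X ^ 2 + C B * X + C Cc : ℤ[X]) ∣ Q := by
    rw [IsPrimitive.Int.dvd_iff_map_cast_dvd_map_cast _ _ hprim]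
    exact ⟨J, hfac⟩
  obtain ⟨Z, hZ⟩ := hdvd
  have hZJ : Z.map (Int.castRingHom ℚ) = J := by
    have h0 : (C A * X ^ 2 + C B * X + C Cc : ℤ[X]).map (Int.castRingHom ℚ) ≠ 0 :=
      (Polynomial.map_ne_zero_iff (RingHom.injective_int _)).mpr hprim.ne_zero
    apply mul_left_cancel₀ h0
    rw [← hfac, ← Polynomial.map_mul, ← hZ]
  have hco : ∀ n, ((Z.coeff n : ℤ) : ℚ) = J.coeff n := by
    intro n; rw [← hZJ, coeff_map]; rfl
  have j1 : ((Z.coeff 2 : ℤ) : ℚ) = d ^ 2 * k1 / A := by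
    rw [hco, hJ]; simp only [coeff_add, coeff_C_mul, coeff_X_pow, coeff_X, coeff_C]; norm_num
  have j2 : ((Z.coeff 1 : ℤ) : ℚ) = d ^ 2 * k2 / A := by
    rw [hco, hJ]; simp only [coeff_add, coeff_C_mul, coeff_X_pow, coeff_X, coeff_C]; norm_num
  have j3 : ((Z.coeff 0 : ℤ) : ℚ) = d ^ 2 * k3 / A := by
    rw [hco, hJ]; simp only [coeff_add, coeff_C_mul, coeff_X_pow, coeff_X, coeff_C]; norm_num
  have hodd : ¬ (2:ℤ) ∣ A := by
    intro h2
    have h3 : (2:ℤ) ∣ p.den * q.den := by rw [hnA]; exact h2.mul_left _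
    have h4 : 2 ∣ p.den * q.den := by exact_mod_cast h3
    rcases (Nat.Prime.dvd_mul Nat.prime_two).mp h4 with h | h
    · exact hpd h
    · exact hqd h
  have key := H_int A B Cc d G0 G1 (Z.coeff 2) (Z.coeff 1) (Z.coeff 0) hA hodd hd.ne' ?_ ?_ ?_ ?_ ?_ ?_ ?_
  · obtain ⟨γ, hγ⟩ := key
    refine ⟨(γ : K5) / A, ?_⟩
    have h1 := congrArg (algebraMap (NumberField.RingOfIntegers K5) K5) hγ
    simp only [map_mul, map_sub, map_add, map_pow, map_intCast] at h1
    have h2 : (A : K5) ≠ 0 := by exact_mod_cast hA.ne'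
    have hB : (B : K5) = ((p:ℚ) : K5) * A := by
      have := congrArg (fun x : ℚ => (x : K5)) hpA
      push_cast at this; exact this.symm
    have hC : (Cc : K5) = ((q:ℚ) : K5) * A := by
      have := congrArg (fun x : ℚ => (x : K5)) hqA
      push_cast at this; exact this.symm
    rw [hB, hC] at h1
    change _ * (_ - _ * tau ^ 2 + _ * tau ^ 4) = (γ : K5) ^ 2 at h1
    rw [div_pow, eq_div_iff (pow_ne_zero 2 h2)]
    linear_combination h1
  · intro l hl h0 h1 h2
    have : C (l:ℤ) ∣ (C d * X ^ 2 + C G0 * X + C G1 : ℤ[X]) := by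
      refine dvd_add (dvd_add ?_ ?_) ?_
      · exact (map_dvd C h2).mul_right _
      · exact (map_dvd C h0).mul_right _
      · exact map_dvd C h1
    have h5 := hprim' _ this
    rw [Int.isUnit_iff_natAbs_eq] at h5
    simp at h5
    exact hl.ne_one h5
  · have : (A * Z.coeff 2 : ℚ) = G1 ^ 2 := by
      rw [j1, ← hg1]; field_simp; linear_combination e4'
    exact_mod_cast this
  · have : (A * Z.coeff 1 + B * Z.coeff 2 : ℚ) = 2 * G0 * G1 - d ^ 2 := by
      rw [j1, j2, ← hg1, ← hg0, ← hpA]; field_simp; linear_combination e3'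
    exact_mod_cast this
  · have : (A * Z.coeff 0 + B * Z.coeff 1 + Cc * Z.coeff 2 : ℚ) = G0 ^ 2 := by
      rw [j1, j2, j3, ← hg0, ← hpA, ← hqA]; field_simp; linear_combination e2'
    exact_mod_cast this
  · have : (B * Z.coeff 0 + Cc * Z.coeff 1 : ℚ) = d * G1 := by
      rw [j2, j3, ← hg1, ← hpA, ← hqA]; field_simp; linear_combination e1'
    exact_mod_cast this
  · have : (Cc * Z.coeff 0 : ℚ) = d * G0 := by
      rw [j3, ← hg0, ← hqA]; field_simp; linear_combination e0'
    exact_mod_cast this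
  · rw [norm_alpha]
    obtain ⟨b1, hb1⟩ : ∃ b1 : ℚ, b1 = 2 * (g1 * (p ^ 2 - q) - g0 * p) := ⟨_, rfl⟩
    obtain ⟨b0, hb0⟩ : ∃ b0 : ℚ, b0 = 1 + 2 * (g1 * p * q - g0 * q) := ⟨_, rfl⟩
    have hf1 : 4 * (p ^ 4 - 3 * p ^ 2 * q + q ^ 2) = 2 * b1 * b0 - b1 ^ 2 * p := by
      rw [hb1, hb0]
      linear_combination 4 * (-p) * e0' + 4 * (p ^ 2 - q) * e1' + 4 * (-p ^ 3 + 2 * p * q) * e2' +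
        4 * (p ^ 4 - 3 * p ^ 2 * q + q ^ 2) * e3' + 4 * (-p ^ 5 + 4 * p ^ 3 * q - 3 * p * q ^ 2) * e4'
    have hf0 : 4 * (p ^ 3 * q - 2 * p * q ^ 2) + 1 = b0 ^ 2 - b1 ^ 2 * q := by
      rw [hb1, hb0]
      linear_combination 4 * (-q) * e0' + 4 * (p * q) * e1' + 4 * (-p ^ 2 * q + q ^ 2) * e2' +
        4 * (p ^ 3 * q - 2 * p * q ^ 2) * e3' - 4 * q * (p ^ 4 - 3 * p ^ 2 * q + q ^ 2) * e4'
    have hN : 1 - 4 * p ^ 5 + 16 * q ^ 5 + 20 * p ^ 3 * q - 20 * p * q ^ 2 =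
        (b1 ^ 2 * q - b1 * b0 * p + b0 ^ 2) ^ 2 := by
      have : 1 - 4 * p ^ 5 + 16 * q ^ 5 + 20 * p ^ 3 * q - 20 * p * q ^ 2 =
        (4 * (p ^ 4 - 3 * p ^ 2 * q + q ^ 2)) ^ 2 * q - (4 * (p ^ 4 - 3 * p ^ 2 * q + q ^ 2)) *
        (4 * (p ^ 3 * q - 2 * p * q ^ 2) + 1) * p + (4 * (p ^ 3 * q - 2 * p * q ^ 2) + 1) ^ 2 := by ring
      rw [this, hf1, hf0]; ring
    have hsq : IsSquare (((A * (A ^ 5 - 4 * B ^ 5 + 16 * Cc ^ 5 + 20 * A * B ^ 3 * Cc - 20 * A ^ 2 * B * Cc ^ 2) : ℤ)) : ℚ) := by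
      refine ⟨A ^ 3 * (b1 ^ 2 * q - b1 * b0 * p + b0 ^ 2), ?_⟩
      push_cast
      rw [← hpA, ← hqA]
      linear_combination (A:ℚ) ^ 6 * hN
    rw [Rat.isSquare_intCast_iff] at hsq
    obtain ⟨m, hm⟩ := hsq
    exact ⟨m, by rw [hm]; ring⟩

end FQ

namespace FQ

theorem cst {p q g0 g1 k1 k2 k3 : R} (h : KD p q g0 g1 k1 k2 k3) :
    red g0 = 0 ∧ red g1 = 0 ∧ red k1 = 0 ∧ red k2 = 1 ∧ red k3 = 0 := by
  obtain ⟨hp, hq, e0, e1, e2, e3, e4⟩ := h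
  have e0 := congrArg red e0
  have e1 := congrArg red e1
  have e2 := congrArg red e2
  have e3 := congrArg red e3
  have e4 := congrArg red e4
  simp only [map_mul, map_add, map_sub, map_pow, map_one, hp, hq, red_two] at e0 e1 e2 e3 e4
  generalize red g0 = a at *
  generalize red g1 = b at *
  generalize red k1 = c at *
  generalize red k2 = d at *
  generalize red k3 = e at *
  clear hp hq
  revert a b c d e; decide

theorem tau_ne : tau ≠ 0 := by
  intro h; have := tau_pow; rw [h] at this; norm_num at this

/-- Linear independence of powers of `-1/tau^2`. -/
theorem liTheta (a b c d e : ℚ) (h : (a : K5) + b * (-tau ^ 3 / 2) + c * (tau / 2) + d * (-tau ^ 4 / 4) + e * (tau ^ 2 / 4) = 0) :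
    a = 0 ∧ b = 0 ∧ c = 0 ∧ d = 0 ∧ e = 0 := by
  have := liQ (a := a) (b := c / 2) (c := e / 4) (d := - b / 2) (e := - d / 4)
    (by push_cast; linear_combination h)
  obtain ⟨h1, h2, h3, h4, h5⟩ := this
  refine ⟨h1, ?_, ?_, ?_, ?_⟩ <;> linarith

theorem or6 {P : Fin 6 → Prop} (h : ∃ j, P j) : P 0 ∨ P 1 ∨ P 2 ∨ P 3 ∨ P 4 ∨ P 5 := by
  obtain ⟨j, hj⟩ := h
  fin_cases j <;> simp_all

theorem halve_mod : ∀ a0 a1 a2 a3 a4 a5 : ZMod 2, (a0 = 1 ∨ a1 = 1 ∨ a2 = 1 ∨ a3 = 1 ∨ a4 = 1 ∨ a5 = 1) →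
    a0 * a1 - a3 ^ 2 = 0 → a0 * a2 + a1 ^ 2 = 0 → a4 ^ 2 = 0 → a2 ^ 2 = 0 → a0 ^ 2 - a5 ^ 2 = 0 →
    (a0 = 1 ∧ a1 = 0 ∧ a2 = 0 ∧ a3 = 0 ∧ a4 = 0 ∧ a5 = 1) := by
  intro a0 a1 a2 a3 a4 a5 h h0 h1 h2 h3 h4
  have b4 : a4 = 0 := pow_eq_zero_iff two_ne_zero |>.mp h2
  have b2 : a2 = 0 := pow_eq_zero_iff two_ne_zero |>.mp h3
  subst b4 b2
  have b1 : a1 = 0 := pow_eq_zero_iff two_ne_zero |>.mp (by linear_combination h1)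
  subst b1
  have b3 : a3 = 0 := pow_eq_zero_iff two_ne_zero |>.mp (by linear_combination - h0)
  subst b3
  clear h0 h1 h2 h3
  revert a0 a5
  decide

theorem halve_aux {p q g0 g1 k1 k2 k3 : R} (h : KD p q g0 g1 k1 k2 k3) :
    ∃ y : Fin 6 → R, (∃ j, y j = 1) ∧ y 0 * y 1 + k3 * y 1 ^ 2 - y 3 ^ 2 = 0 ∧
      y 0 * y 2 + k2 * y 1 ^ 2 + 2 * k3 * y 1 * y 2 - 2 * y 3 * y 4 = 0 ∧
      y 0 ^ 2 * q + 2 * y 0 * g0 * y 1 + k1 * y 1 ^ 2 + 2 * k2 * y 1 * y 2 + k3 * y 2 ^ 2 - (y 4 ^ 2 + 2 * y 3 * y 5) = 0 ∧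
      y 0 ^ 2 * p + 2 * y 0 * g1 * y 1 + 2 * y 0 * g0 * y 2 + 2 * k1 * y 1 * y 2 + k2 * y 2 ^ 2 - 2 * y 4 * y 5 = 0 ∧
      y 0 ^ 2 + 2 * y 0 * g1 * y 2 + k1 * y 2 ^ 2 - y 5 ^ 2 = 0 := by
  obtain ⟨δ, hδ⟩ := h.H
  obtain ⟨rg0, rg1, rk1, rk2, rk3⟩ := cst h
  obtain ⟨hp, hq, e0, e1, e2, e3, e4⟩ := h
  have toK : ∀ {x y : R}, x = y → (((x:ℚ)) : K5) = ((y : ℚ) : K5) := by rintro x y rfl; rfl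
  have E0 := toK e0
  have E1 := toK e1
  have E2 := toK e2
  have E3 := toK e3
  have E4 := toK e4
  push_cast at E0 E1 E2 E3 E4
  have T5 := tau_pow
  have tau0 := tau_ne
  set P : K5 := ((p:ℚ):K5) with hP
  set Q : K5 := ((q:ℚ):K5) with hQ
  set G0 : K5 := ((g0:ℚ):K5) with hG0
  set G1 : K5 := ((g1:ℚ):K5) with hG1
  set L1 : K5 := ((k1:ℚ):K5) with hK1
  set L2 : K5 := ((k2:ℚ):K5) with hK2
  set L3 : K5 := ((k3:ℚ):K5) with hK3
  obtain ⟨θ, hθ⟩ : ∃ θ : K5, θ = -tau ^ 3 / 2 := ⟨_, rfl⟩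
  have t2 : θ ^ 2 = tau / 2 := by
    rw [hθ]; linear_combination tau / 4 * T5
  have t3 : θ ^ 3 = -tau ^ 4 / 4 := by
    rw [pow_succ, t2, hθ]; field_simp; ring
  have t4 : θ ^ 4 = tau ^ 2 / 4 := by
    have : θ ^ 4 = (θ ^ 2) ^ 2 := by ring
    rw [this, t2]; field_simp; ring
  have t5 : θ ^ 5 = -1 / 4 := by
    rw [pow_succ, t4, hθ]; field_simp; linear_combination -T5
  have hδ0 : δ ≠ 0 := by
    intro h0
    rw [h0] at hδ
    have := liQ (a := 1) (b := 0) (c := -p) (d := 0) (e := q) (by push_cast; linear_combination hδ)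
    exact one_ne_zero this.1
  have ha : 4 * (θ ^ 2 + P * θ + Q) = (tau ^ 3 * δ) ^ 2 := by
    rw [mul_pow, ← hδ, t2, hθ]; linear_combination (-tau + P * tau ^ 3 - Q * (tau ^ 5 + 2)) * T5
  obtain ⟨b, hb⟩ : ∃ b : K5, b = 1 + 2 * G0 * θ ^ 2 + 2 * G1 * θ ^ 3 := ⟨_, rfl⟩
  obtain ⟨a1, ha1⟩ : ∃ a1 : K5, a1 = L1 * θ ^ 2 + L2 * θ + L3 := ⟨_, rfl⟩
  have hF : b ^ 2 = 4 * (θ ^ 2 + P * θ + Q) * θ ^ 2 * a1 := by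
    rw [hb, ha1]
    linear_combination -4 * θ ^ 2 * E0 - 4 * θ ^ 3 * E1 - 4 * θ ^ 4 * E2 - 4 * θ ^ 5 * E3 - 4 * θ ^ 6 * E4 + 4 * t5
  have hθ0 : θ ≠ 0 := by rw [hθ]; exact div_ne_zero (neg_ne_zero.mpr (pow_ne_zero _ tau0)) two_ne_zero
  obtain ⟨γ, hγ⟩ : ∃ γ : K5, γ ^ 2 = a1 := by
    refine ⟨b / (tau ^ 3 * δ * θ), ?_⟩
    rw [div_pow, hF, mul_pow, ← ha]
    have : 4 * (θ ^ 2 + P * θ + Q) ≠ 0 := by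
      rw [ha]; exact pow_ne_zero _ (mul_ne_zero (pow_ne_zero _ tau0) hδ0)
    exact mul_div_cancel_left₀ _ (mul_ne_zero this (pow_ne_zero _ hθ0))
  have ha10 : a1 ≠ 0 := by
    intro h0
    rw [ha1, t2, hθ] at h0
    have := (liTheta k3 k2 k1 0 0 (by push_cast; linear_combination h0)).2.1
    have h1 : k2 = 0 := Subtype.ext this
    rw [h1, map_zero] at rk2; exact zero_ne_one rk2
  have hdep : ¬ LinearIndependent ℚ ![b, a1, a1 * θ, γ, γ * θ, γ * θ ^ 2] := by
    intro hl
    have := hl.fintype_card_le_finrank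
    rw [finrank_K5] at this
    simp at this
  rw [Fintype.not_linearIndependent_iff] at hdep
  obtain ⟨g, hg, i, hi⟩ := hdep
  simp only [Fin.sum_univ_six, Rat.smul_def] at hg
  simp at hg
  obtain ⟨c, y, hc, hy, j, hj⟩ := scale ![2 * g 0, g 1, g 2, g 3, g 4, g 5] (by
    intro h0
    apply hi
    have h1 := congrFun h0
    have h2 := h1 0
    have h3 := h1 1
    have h4 := h1 2
    have h5 := h1 3
    have h6 := h1 4
    have h7 := h1 5
    simp at h2 h3 h4 h5 h6 h7
    fin_cases i <;> assumption)
  have y0 := hy 0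
  have y1 := hy 1
  have y2 := hy 2
  have y3 := hy 3
  have y4 := hy 4
  have y5 := hy 5
  simp at y0 y1 y2 y3 y4 y5
  have z0 : ((g 0 : ℚ) : K5) = c * ((y 0 : ℚ) : K5) / 2 := by
    have : g 0 = c * y 0 / 2 := by linarith
    rw [this]; push_cast; rfl
  rw [y1, y2, y3, y4, y5, z0] at hg
  push_cast at hg
  set l : K5 := ((y 0 : ℚ) : K5) with hl
  set H0 : K5 := ((y 1 : ℚ) : K5) with hH0
  set H1 : K5 := ((y 2 : ℚ) : K5) with hH1
  set R0 : K5 := ((y 3 : ℚ) : K5) with hR0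
  set R1 : K5 := ((y 4 : ℚ) : K5) with hR1
  set R2 : K5 := ((y 5 : ℚ) : K5) with hR2
  have hcK : (c : K5) ≠ 0 := by exact_mod_cast hc
  have hg' : l / 2 * b + a1 * (H0 + H1 * θ) = - γ * (R0 + R1 * θ + R2 * θ ^ 2) := by
    apply mul_left_cancel₀ hcK
    linear_combination hg
  have hW : (R0 + R1 * θ + R2 * θ ^ 2) ^ 2 = l ^ 2 * (θ ^ 2 + P * θ + Q) * θ ^ 2 + l * b * (H0 + H1 * θ) +
      a1 * (H0 + H1 * θ) ^ 2 := by
    apply mul_left_cancel₀ ha10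
    have h1 := congrArg (· ^ 2) hg'
    linear_combination - h1 + l ^ 2 / 4 * hF - (R0 + R1 * θ + R2 * θ ^ 2) ^ 2 * hγ
  rw [hb, ha1] at hW
  have hlin := liTheta (y 0 * y 1 + k3 * y 1 ^ 2 - y 3 ^ 2)
    (y 0 * y 2 + k2 * y 1 ^ 2 + 2 * k3 * y 1 * y 2 - 2 * y 3 * y 4)
    (y 0 ^ 2 * q + 2 * y 0 * g0 * y 1 + k1 * y 1 ^ 2 + 2 * k2 * y 1 * y 2 + k3 * y 2 ^ 2 - (y 4 ^ 2 + 2 * y 3 * y 5))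
    (y 0 ^ 2 * p + 2 * y 0 * g1 * y 1 + 2 * y 0 * g0 * y 2 + 2 * k1 * y 1 * y 2 + k2 * y 2 ^ 2 - 2 * y 4 * y 5)
    (y 0 ^ 2 + 2 * y 0 * g1 * y 2 + k1 * y 2 ^ 2 - y 5 ^ 2) (by
      rw [← hθ, ← t2, ← t3, ← t4]
      push_cast
      rw [← hl, ← hH0, ← hH1, ← hR0, ← hR1, ← hR2, ← hP, ← hQ, ← hG0, ← hG1, ← hK1, ← hK2, ← hK3]
      linear_combination -hW)
  obtain ⟨w0, w1, w2, w3, w4⟩ := hlin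
  have v0 : y 0 * y 1 + k3 * y 1 ^ 2 - y 3 ^ 2 = 0 := Subtype.ext (by push_cast; exact w0)
  have v1 : y 0 * y 2 + k2 * y 1 ^ 2 + 2 * k3 * y 1 * y 2 - 2 * y 3 * y 4 = 0 :=
    Subtype.ext (by push_cast; exact w1)
  have v2 : y 0 ^ 2 * q + 2 * y 0 * g0 * y 1 + k1 * y 1 ^ 2 + 2 * k2 * y 1 * y 2 + k3 * y 2 ^ 2 - (y 4 ^ 2 + 2 * y 3 * y 5) = 0 :=
    Subtype.ext (by push_cast; exact w2)
  have v3 : y 0 ^ 2 * p + 2 * y 0 * g1 * y 1 + 2 * y 0 * g0 * y 2 + 2 * k1 * y 1 * y 2 + k2 * y 2 ^ 2 - 2 * y 4 * y 5 = 0 :=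
    Subtype.ext (by push_cast; exact w3)
  have v4 : y 0 ^ 2 + 2 * y 0 * g1 * y 2 + k1 * y 2 ^ 2 - y 5 ^ 2 = 0 :=
    Subtype.ext (by push_cast; exact w4)
  exact ⟨y, ⟨j, hj⟩, v0, v1, v2, v3, v4⟩

theorem halve {p q g0 g1 k1 k2 k3 : R} (h : KD p q g0 g1 k1 k2 k3) :
    ∃ h0 h1 r0 r1 r2 : R, r0 ^ 2 = h0 + k3 * h0 ^ 2 ∧
      2 * r0 * r1 = h1 + k2 * h0 ^ 2 + 2 * k3 * h0 * h1 ∧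
      r1 ^ 2 + 2 * r0 * r2 = q + 2 * g0 * h0 + k1 * h0 ^ 2 + 2 * k2 * h0 * h1 + k3 * h1 ^ 2 ∧
      2 * r1 * r2 = p + 2 * g1 * h0 + 2 * g0 * h1 + 2 * k1 * h0 * h1 + k2 * h1 ^ 2 ∧
      r2 ^ 2 = 1 + 2 * g1 * h1 + k1 * h1 ^ 2 ∧
      red h0 = 0 ∧ red h1 = 0 ∧ red r0 = 0 ∧ red r1 = 0 ∧ red r2 = 1 := by
  obtain ⟨y, hj, v0, v1, v2, v3, v4⟩ := halve_aux h
  obtain ⟨rg0, rg1, rk1, rk2, rk3⟩ := cst h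
  have hp := h.hp
  have hq := h.hq
  have m0 := congrArg red v0
  have m1 := congrArg red v1
  have m2 := congrArg red v2
  have m3 := congrArg red v3
  have m4 := congrArg red v4
  simp only [map_mul, map_add, map_sub, map_pow, map_one, map_zero, hp, hq, red_two, rg0, rg1, rk1, rk2, rk3] at m0 m1 m2 m3 m4
  have hall : red (y 0) = 1 ∧ red (y 1) = 0 ∧ red (y 2) = 0 ∧ red (y 3) = 0 ∧ red (y 4) = 0 ∧ red (y 5) = 1 := by
    have hone : red (y 0) = 1 ∨ red (y 1) = 1 ∨ red (y 2) = 1 ∨ red (y 3) = 1 ∨ red (y 4) = 1 ∨ red (y 5) = 1 := by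
      apply or6 (P := fun j => red (y j) = 1)
      obtain ⟨j, hj⟩ := hj
      exact ⟨j, by rw [hj, map_one]⟩
    apply halve_mod _ _ _ _ _ _ hone
    · linear_combination m0
    · linear_combination m1
    · linear_combination - m2
    · linear_combination m3
    · linear_combination m4
  obtain ⟨n0, n1, n2, n3, n4, n5⟩ := hall
  obtain ⟨i0, hi0⟩ := unit_of_red (x := y 0) (by rw [n0]; exact one_ne_zero)
  have ri0 : red i0 = 1 := by
    have := congrArg red hi0
    rw [map_mul, n0, one_mul, map_one] at this; exact this
  refine ⟨y 1 * i0, y 2 * i0, y 3 * i0, y 4 * i0, y 5 * i0, ?_, ?_, ?_, ?_, ?_, ?_, ?_, ?_, ?_, ?_⟩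
  · linear_combination - i0 ^ 2 * v0 + y 1 * i0 * hi0
  · linear_combination - i0 ^ 2 * v1 + y 2 * i0 * hi0
  · linear_combination - i0 ^ 2 * v2 + (q * (y 0 * i0 + 1) + 2 * g0 * y 1 * i0) * hi0
  · linear_combination - i0 ^ 2 * v3 + (p * (y 0 * i0 + 1) + 2 * g1 * y 1 * i0 + 2 * g0 * y 2 * i0) * hi0
  · linear_combination - i0 ^ 2 * v4 + ((y 0 * i0 + 1) + 2 * g1 * y 2 * i0) * hi0
  all_goals simp [n1, n2, n3, n4, n5, ri0]
end FQ

namespace FQ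

theorem lemmaM {l1 l2 l3 b0 b1 b2 b3 A0 A1 A2 A3 A4 : R} (hb : red b0 = 0)
    (c0 : b0 ^ 2 + b0 = l3 * A0)
    (c1 : 2 * b0 * b1 + b1 = l2 * A0 + l3 * A1)
    (c2 : b1 ^ 2 + 2 * b0 * b2 + b2 = l1 * A0 + l2 * A1 + l3 * A2)
    (c3 : 2 * b0 * b3 + 2 * b1 * b2 + b3 = l1 * A1 + l2 * A2 + l3 * A3)
    (c4 : b2 ^ 2 + 2 * b1 * b3 = l1 * A2 + l2 * A3 + l3 * A4)
    (c5 : 2 * b2 * b3 - 1 = l1 * A3 + l2 * A4)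
    (c6 : b3 ^ 2 = l1 * A4) :
    ∃ g0 g1 k1 k2 k3 : R, l3 * k3 = g0 ∧ l3 * k2 + l2 * k3 = g1 ∧ l1 * k3 + l2 * k2 + l3 * k1 = g0 ^ 2 ∧
      l1 * k2 + l2 * k1 = 2 * g0 * g1 - 1 ∧ l1 * k1 = g1 ^ 2 := by
  obtain ⟨i, hi⟩ := unit_of_red (x := 1 + b0) (by rw [map_add, map_one, hb, add_zero]; exact one_ne_zero)
  obtain ⟨m0, hm0⟩ : ∃ m0 : R, (1 + b0) * m0 = - A0 := ⟨-A0 * i, by linear_combination -A0 * hi⟩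
  obtain ⟨m1, hm1⟩ : ∃ m1 : R, (1 + b0) * m1 = - (A1 + b1 * m0) :=
    ⟨-(A1 + b1 * m0) * i, by linear_combination -(A1 + b1 * m0) * hi⟩
  have N0 : b0 + l3 * m0 = 0 := by
    linear_combination -(b0 + l3 * m0) * hi + i * c0 + i * l3 * hm0
  have N1 : b1 + l2 * m0 + l3 * m1 = 0 := by
    linear_combination -(b1 + l2 * m0 + l3 * m1) * hi + i * c1 + i * l2 * hm0 + i * l3 * hm1 - i * b1 * N0
  have W0 : A0 + (2 * b0 + 1) * m0 + l3 * m0 ^ 2 = 0 := by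
    linear_combination hm0 + m0 * N0
  have W1 : A1 + (2 * b0 + 1) * m1 + 2 * b1 * m0 + l2 * m0 ^ 2 + 2 * l3 * m0 * m1 = 0 := by
    linear_combination hm1 + m1 * N0 + m0 * N1
  obtain ⟨g0, hg0⟩ : ∃ g0 : R, g0 = b2 + l1 * m0 + l2 * m1 := ⟨_, rfl⟩
  obtain ⟨g1, hg1⟩ : ∃ g1 : R, g1 = b3 + l1 * m1 := ⟨_, rfl⟩
  refine ⟨g0, g1, A4 + 2 * b3 * m1 + l1 * m1 ^ 2, A3 + 2 * b3 * m0 + 2 * b2 * m1 + 2 * l1 * m0 * m1 + l2 * m1 ^ 2,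
    A2 + 2 * b2 * m0 + 2 * b1 * m1 + l1 * m0 ^ 2 + 2 * l2 * m0 * m1 + l3 * m1 ^ 2, ?_, ?_, ?_, ?_, ?_⟩
  · rw [hg0]; linear_combination -c2 - l1 * W0 - l2 * W1 + 2 * (b2 + l1 * m0 + l2 * m1) * N0 + (b1 + l2 * m0 + l3 * m1) * N1
  · rw [hg1]; linear_combination -c3 - l1 * W1 + 2 * (b3 + l1 * m1) * N0 + 2 * (b2 + l1 * m0 + l2 * m1) * N1
  · rw [hg0]; linear_combination -c4 + 2 * (b3 + l1 * m1) * N1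
  · rw [hg0, hg1]; linear_combination -c5
  · rw [hg1]; linear_combination -c6

theorem KD.step {p q g0 g1 k1 k2 k3 h0 h1 r0 r1 r2 : R} (h : KD p q g0 g1 k1 k2 k3)
    (E0 : r0 ^ 2 = h0 + k3 * h0 ^ 2)
    (E1 : 2 * r0 * r1 = h1 + k2 * h0 ^ 2 + 2 * k3 * h0 * h1)
    (E2 : r1 ^ 2 + 2 * r0 * r2 = q + 2 * g0 * h0 + k1 * h0 ^ 2 + 2 * k2 * h0 * h1 + k3 * h1 ^ 2)
    (E3 : 2 * r1 * r2 = p + 2 * g1 * h0 + 2 * g0 * h1 + 2 * k1 * h0 * h1 + k2 * h1 ^ 2)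
    (E4 : r2 ^ 2 = 1 + 2 * g1 * h1 + k1 * h1 ^ 2)
    (m0 : red h0 = 0) (n0 : red r0 = 0) (n1 : red r1 = 0) (n2 : red r2 = 1) :
    ∃ p' q' g0' g1' k1' k2' k3' : R, KD p' q' g0' g1' k1' k2' k3' ∧ r1 = r2 * p' ∧ r0 = r2 * q' := by
  obtain ⟨j, hj⟩ := unit_of_red (x := r2) (by rw [n2]; exact one_ne_zero)
  obtain ⟨hp, hq, e0, e1, e2, e3, e4⟩ := h
  obtain ⟨P, hP⟩ : ∃ P : R, P = r1 * j := ⟨_, rfl⟩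
  obtain ⟨Q, hQ⟩ : ∃ Q : R, Q = r0 * j := ⟨_, rfl⟩
  have hr1 : r1 = r2 * P := by rw [hP]; linear_combination -r1 * hj
  have hr0 : r0 = r2 * Q := by rw [hQ]; linear_combination -r0 * hj
  subst hr1 hr0
  obtain ⟨g0', g1', k1', k2', k3', f0, f1, f2, f3, f4⟩ := lemmaM (l1 := 1) (l2 := P) (l3 := Q)
    (b0 := k3 * h0) (b1 := k2 * h0 + k3 * h1) (b2 := g0 + k1 * h0 + k2 * h1) (b3 := g1 + k1 * h1)
    (A0 := r2 ^ 2 * (k3 * Q)) (A1 := r2 ^ 2 * (k2 * Q + k3 * P)) (A2 := r2 ^ 2 * (k1 * Q + k2 * P + k3))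
    (A3 := r2 ^ 2 * (k1 * P + k2)) (A4 := r2 ^ 2 * k1) (by rw [map_mul, m0, mul_zero])
    (by linear_combination -k3 * E0)
    (by linear_combination -k3 * E1 - k2 * E0)
    (by linear_combination -k3 * E2 - k2 * E1 - k1 * E0 - e0)
    (by linear_combination -k3 * E3 - k2 * E2 - k1 * E1 - e1)
    (by linear_combination -k3 * E4 - k2 * E3 - k1 * E2 - e2)
    (by linear_combination -k2 * E4 - k1 * E3 - e3)
    (by linear_combination -k1 * E4 - e4)
  refine ⟨P, Q, g0', g1', k1', k2', k3', ⟨?_, ?_, ?_, ?_, ?_, ?_, ?_⟩, rfl, rfl⟩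
  · rw [hP, map_mul, n1, zero_mul]
  · rw [hQ, map_mul, n0, zero_mul]
  · exact f0
  · exact f1
  · linear_combination f2
  · linear_combination f3
  · linear_combination f4

theorem KD.pow (n : ℕ) : ∀ {p q g0 g1 k1 k2 k3 : R}, KD p q g0 g1 k1 k2 k3 →
    (∃ y, p = 2 ^ (n + 1) * y) ∧ (∃ y, q = 2 ^ (n + 1) * y) := by
  induction n with
  | zero =>
    intro p q g0 g1 k1 k2 k3 h
    simp only [zero_add, pow_one]; exact ⟨even_iff.mp h.hp, even_iff.mp h.hq⟩
  | succ n ih =>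
    intro p q g0 g1 k1 k2 k3 h
    obtain ⟨h0, h1, r0, r1, r2, E0, E1, E2, E3, E4, m0, m1, n0, n1, n2⟩ := halve h
    obtain ⟨p', q', g0', g1', k1', k2', k3', hKD, hr1, hr0⟩ := h.step E0 E1 E2 E3 E4 m0 n0 n1 n2
    obtain ⟨⟨y, hy⟩, ⟨z, hz⟩⟩ := ih hKD
    obtain ⟨i, hi⟩ := unit_of_red (x := 1 + k3 * h0) (by rw [map_add, map_one, map_mul, m0, mul_zero, add_zero]; exact one_ne_zero)
    obtain ⟨i', hi'⟩ := unit_of_red (x := 1 + 2 * k3 * h0) (by rw [map_add, map_one, map_mul, m0, mul_zero, add_zero]; exact one_ne_zero)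
    have d0 : (2:R) ^ (n + 1) ∣ r0 := ⟨r2 * z, by rw [hr0, hz]; ring⟩
    have d1 : (2:R) ^ (n + 1) ∣ r1 := ⟨r2 * y, by rw [hr1, hy]; ring⟩
    have dd : (2:R) ^ (n + 1 + 1) ∣ 2 ^ (n + 1) * 2 ^ (n + 1) := by
      rw [← pow_add]; exact pow_dvd_pow _ (by omega)
    have d2 : ∀ x : R, (2:R) ^ (n + 1) ∣ x → 2 ^ (n + 1 + 1) ∣ 2 * x := by
      rintro x ⟨c, rfl⟩; exact ⟨c, by ring⟩
    have dh0 : (2:R) ^ (n + 1 + 1) ∣ h0 := by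
      have : h0 = r0 * r0 * i := by linear_combination -h0 * hi - i * E0
      rw [this]
      exact (dd.trans (mul_dvd_mul d0 d0)).mul_right _
    have dh1 : (2:R) ^ (n + 1 + 1) ∣ h1 := by
      have : h1 = 2 * r0 * (r1 * i') - h0 * (k2 * h0 * i') := by linear_combination -h1 * hi' - i' * E1
      rw [this]
      exact dvd_sub ((d2 _ d0).mul_right _) (dh0.mul_right _)
    have hq : q = r1 * r1 + 2 * r0 * r2 - h0 * (2 * g0 + k1 * h0 + 2 * k2 * h1) - h1 * (k3 * h1) := by
      linear_combination -E2
    have hp : p = 2 * r1 * r2 - h0 * (2 * g1 + 2 * k1 * h1) - h1 * (2 * g0 + k2 * h1) := by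
      linear_combination -E3
    constructor
    · have : (2:R) ^ (n + 1 + 1) ∣ p := by
        rw [hp]
        exact dvd_sub (dvd_sub ((d2 _ d1).mul_right _) (dh0.mul_right _)) (dh1.mul_right _)
      exact this
    · have : (2:R) ^ (n + 1 + 1) ∣ q := by
        rw [hq]
        exact dvd_sub (dvd_sub (dvd_add (dd.trans (mul_dvd_mul d1 d1)) ((d2 _ d0).mul_right _)) (dh0.mul_right _)) (dh1.mul_right _)
      exact this

theorem KD.main {p q g0 g1 k1 k2 k3 : R} (h : KD p q g0 g1 k1 k2 k3) : p = 0 ∧ q = 0 := by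
  constructor
  · apply zero_of_pow
    intro n
    obtain ⟨⟨y, hy⟩, -⟩ := KD.pow n h
    exact ⟨2 * y, by rw [hy]; ring⟩
  · apply zero_of_pow
    intro n
    obtain ⟨-, ⟨y, hy⟩⟩ := KD.pow n h
    exact ⟨2 * y, by rw [hy]; ring⟩

end FQ

namespace FQ

theorem or5 {P : Fin 5 → Prop} (h : ∃ j, P j) : P 0 ∨ P 1 ∨ P 2 ∨ P 3 ∨ P 4 := by
  obtain ⟨j, hj⟩ := h
  fin_cases j <;> simp_all

theorem or3 {P : Fin 3 → Prop} (h : ∃ j, P j) : P 0 ∨ P 1 ∨ P 2 := by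
  obtain ⟨j, hj⟩ := h
  fin_cases j <;> simp_all

theorem mod_up {x y : R} (h : (x : ℚ) = y) : x = y := Subtype.ext h

theorem int_quot {l1 l2 l3 : R} (h1 : red l1 = 0) (h2 : red l2 = 1) (h3 : red l3 = 0)
    {D1 D2 D3 D4 D5 : R} {A0 A1 A2 A3 A4 : ℚ}
    (c1 : (D1 : ℚ) = l2 * A0 + l3 * A1)
    (c2 : (D2 : ℚ) = l1 * A0 + l2 * A1 + l3 * A2)
    (c3 : (D3 : ℚ) = l1 * A1 + l2 * A2 + l3 * A3)
    (c4 : (D4 : ℚ) = l1 * A2 + l2 * A3 + l3 * A4)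
    (c5 : (D5 : ℚ) = l1 * A3 + l2 * A4) :
    ∃ B0 B1 B2 B3 B4 : R, A0 = B0 ∧ A1 = B1 ∧ A2 = B2 ∧ A3 = B3 ∧ A4 = B4 := by
  by_cases hz : ![A0, A1, A2, A3, A4] = 0
  · have h := congrFun hz
    exact ⟨0, 0, 0, 0, 0, by simpa using h 0, by simpa using h 1, by simpa using h 2, by simpa using h 3, by simpa using h 4⟩
  obtain ⟨c, y, hc, hy, hj⟩ := scale _ hz
  have y0 : A0 = c * y 0 := hy 0
  have y1 : A1 = c * y 1 := hy 1
  have y2 : A2 = c * y 2 := hy 2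
  have y3 : A3 = c * y 3 := hy 3
  have y4 : A4 = c * y 4 := hy 4
  rcases int_or_inv c with ⟨e, rfl⟩ | ⟨e, he, hr⟩
  · exact ⟨e * y 0, e * y 1, e * y 2, e * y 3, e * y 4, y0, y1, y2, y3, y4⟩
  · exfalso
    rw [y0, y1] at c1
    rw [y0, y1, y2] at c2
    rw [y1, y2, y3] at c3
    rw [y2, y3, y4] at c4
    rw [y3, y4] at c5
    have d1 : e * D1 = l2 * y 0 + l3 * y 1 :=
      mod_up (by push_cast; linear_combination e * c1 + (l2 * y 0 + l3 * y 1 : ℚ) * he)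
    have d2 : e * D2 = l1 * y 0 + l2 * y 1 + l3 * y 2 :=
      mod_up (by push_cast; linear_combination e * c2 + (l1 * y 0 + l2 * y 1 + l3 * y 2 : ℚ) * he)
    have d3 : e * D3 = l1 * y 1 + l2 * y 2 + l3 * y 3 :=
      mod_up (by push_cast; linear_combination e * c3 + (l1 * y 1 + l2 * y 2 + l3 * y 3 : ℚ) * he)
    have d4 : e * D4 = l1 * y 2 + l2 * y 3 + l3 * y 4 :=
      mod_up (by push_cast; linear_combination e * c4 + (l1 * y 2 + l2 * y 3 + l3 * y 4 : ℚ) * he)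
    have d5 : e * D5 = l1 * y 3 + l2 * y 4 :=
      mod_up (by push_cast; linear_combination e * c5 + (l1 * y 3 + l2 * y 4 : ℚ) * he)
    have m1 := congrArg red d1
    have m2 := congrArg red d2
    have m3 := congrArg red d3
    have m4 := congrArg red d4
    have m5 := congrArg red d5
    simp only [map_mul, map_add, h1, h2, h3, hr, zero_mul, one_mul, add_zero, zero_add] at m1 m2 m3 m4 m5
    have := or5 hj
    rcases this with h | h | h | h | h
    · rw [h, map_one] at m1; exact zero_ne_one m1
    · rw [h, map_one] at m2; exact zero_ne_one m2
    · rw [h, map_one] at m3; exact zero_ne_one m3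
    · rw [h, map_one] at m4; exact zero_ne_one m4
    · rw [h, map_one] at m5; exact zero_ne_one m5

theorem classP_kd {l1 l2 l3 : R} (h1 : red l1 = 0) (h2 : red l2 = 1) (h3 : red l3 = 0) (hne : l1 ≠ 0)
    {g0 g1 k1 k2 k3 : R} (f0 : l3 * k3 = g0) (f1 : l3 * k2 + l2 * k3 = g1)
    (f2 : l1 * k3 + l2 * k2 + l3 * k1 = g0 ^ 2) (f3 : l1 * k2 + l2 * k1 = 2 * g0 * g1 - 1)
    (f4 : l1 * k1 = g1 ^ 2) : False := by
  have m0 := congrArg red f0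
  have m1 := congrArg red f1
  have m2 := congrArg red f2
  have m3 := congrArg red f3
  have m4 := congrArg red f4
  simp only [map_mul, map_add, map_sub, map_pow, map_one, h1, h2, h3, red_two, zero_mul, one_mul, add_zero, zero_add, zero_sub] at m0 m1 m2 m3 m4
  have g1z : red g1 = 0 := pow_eq_zero_iff two_ne_zero |>.mp m4.symm
  have k3z : red k3 = 0 := m1.trans g1z
  have k2z : red k2 = 0 := by rw [m2, ← m0]; ring
  have k1z : red k1 ≠ 0 := by rw [m3]; decide
  obtain ⟨i, hi⟩ := unit_of_red k1z
  have hKD : KD (k2 * i) (k3 * i) g0 g1 (k1 * l1) (k1 * l2) (k1 * l3) := by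
    refine ⟨by rw [map_mul, k2z, zero_mul], by rw [map_mul, k3z, zero_mul], ?_, ?_, ?_, ?_, ?_⟩
    · linear_combination f0 + k3 * l3 * hi
    · linear_combination f1 + (k3 * l2 + k2 * l3) * hi
    · linear_combination f2 + (k3 * l1 + k2 * l2) * hi
    · linear_combination f3 + (k2 * l1) * hi
    · linear_combination f4
  obtain ⟨hp, hq⟩ := hKD.main
  have k2e : k2 = 0 := by linear_combination k1 * hp - k2 * hi
  have k3e : k3 = 0 := by linear_combination k1 * hq - k3 * hi
  rw [k2e, k3e] at f1
  have : l1 = 0 := by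
    linear_combination i * f4 - l1 * hi - i * g1 * f1
  exact hne this

/-- Class P theorem, integral version. -/
theorem classP_int {l1 l2 l3 : R} (h1 : red l1 = 0) (h2 : red l2 = 1) (h3 : red l3 = 0) (hne : l1 ≠ 0)
    {b0 b1 b2 b3 A0 A1 A2 A3 A4 : R} (hb : red b0 = 0)
    (c0 : b0 ^ 2 + b0 = l3 * A0)
    (c1 : 2 * b0 * b1 + b1 = l2 * A0 + l3 * A1)
    (c2 : b1 ^ 2 + 2 * b0 * b2 + b2 = l1 * A0 + l2 * A1 + l3 * A2)
    (c3 : 2 * b0 * b3 + 2 * b1 * b2 + b3 = l1 * A1 + l2 * A2 + l3 * A3)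
    (c4 : b2 ^ 2 + 2 * b1 * b3 = l1 * A2 + l2 * A3 + l3 * A4)
    (c5 : 2 * b2 * b3 - 1 = l1 * A3 + l2 * A4)
    (c6 : b3 ^ 2 = l1 * A4) : False := by
  obtain ⟨g0, g1, k1, k2, k3, f0, f1, f2, f3, f4⟩ := lemmaM hb c0 c1 c2 c3 c4 c5 c6
  exact classP_kd h1 h2 h3 hne f0 f1 f2 f3 f4

theorem classP3 {l1 l2 l3 : R} (h1 : red l1 = 0) (h2 : red l2 = 1) (h3 : red l3 = 0) (hne : l1 ≠ 0)
    {b0 b3 A0 A1 A2 A3 A4 : ℚ}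
    (c0 : b0 ^ 2 + b0 = l3 * A0)
    (c1 : 0 = l2 * A0 + l3 * A1)
    (c2 : 0 = l1 * A0 + l2 * A1 + l3 * A2)
    (c3 : 2 * b0 * b3 + b3 = l1 * A1 + l2 * A2 + l3 * A3)
    (c4 : 0 = l1 * A2 + l2 * A3 + l3 * A4)
    (c5 : - 1 = l1 * A3 + l2 * A4)
    (c6 : b3 ^ 2 = l1 * A4) : False := by
  obtain ⟨c, y, hc, hy, hj⟩ := scale ![1, b0, b3] (by intro h; have := congrFun h 0; simp at this)
  have y0 : 1 = c * y 0 := hy 0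
  have y1 : b0 = c * y 1 := hy 1
  have y2 : b3 = c * y 2 := hy 2
  have z1 : (y 1 : ℚ) = y 0 * b0 := by rw [y1]; linear_combination (y 1 : ℚ) * y0
  have z2 : (y 2 : ℚ) = y 0 * b3 := by rw [y2]; linear_combination (y 2 : ℚ) * y0
  have hor := or3 hj
  generalize y 0 = κ at *
  generalize y 1 = x at *
  generalize y 2 = z at *
  obtain ⟨B0, B1, B2, B3, B4, hB0, hB1, hB2, hB3, hB4⟩ := int_quot h1 h2 h3 (D1 := 0) (D2 := 0) (D3 := 2 * x * z + κ * z)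
    (D4 := 0) (D5 := - κ ^ 2) (A0 := κ ^ 2 * A0) (A1 := κ ^ 2 * A1) (A2 := κ ^ 2 * A2) (A3 := κ ^ 2 * A3) (A4 := κ ^ 2 * A4)
    (by push_cast; linear_combination (κ : ℚ) ^ 2 * c1)
    (by push_cast; linear_combination (κ : ℚ) ^ 2 * c2)
    (by push_cast; rw [z1, z2]; linear_combination (κ : ℚ) ^ 2 * c3)
    (by push_cast; linear_combination (κ : ℚ) ^ 2 * c4)
    (by push_cast; linear_combination (κ : ℚ) ^ 2 * c5)
  have d0 : x ^ 2 + κ * x = l3 * B0 := mod_up (by push_cast; rw [z1, ← hB0]; linear_combination (κ : ℚ) ^ 2 * c0)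
  have d1 : 0 = l2 * B0 + l3 * B1 := mod_up (by push_cast; rw [← hB0, ← hB1]; linear_combination (κ : ℚ) ^ 2 * c1)
  have d2 : 0 = l1 * B0 + l2 * B1 + l3 * B2 :=
    mod_up (by push_cast; rw [← hB0, ← hB1, ← hB2]; linear_combination (κ : ℚ) ^ 2 * c2)
  have d3 : 2 * x * z + κ * z = l1 * B1 + l2 * B2 + l3 * B3 :=
    mod_up (by push_cast; rw [z1, z2, ← hB1, ← hB2, ← hB3]; linear_combination (κ : ℚ) ^ 2 * c3)
  have d4 : 0 = l1 * B2 + l2 * B3 + l3 * B4 :=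
    mod_up (by push_cast; rw [← hB2, ← hB3, ← hB4]; linear_combination (κ : ℚ) ^ 2 * c4)
  have d5 : - κ ^ 2 = l1 * B3 + l2 * B4 :=
    mod_up (by push_cast; rw [← hB3, ← hB4]; linear_combination (κ : ℚ) ^ 2 * c5)
  have d6 : z ^ 2 = l1 * B4 :=
    mod_up (by push_cast; rw [z2, ← hB4]; linear_combination (κ : ℚ) ^ 2 * c6)
  have hκ : red κ ≠ 0 := by
    intro h0
    have m0 := congrArg red d0
    have m6 := congrArg red d6
    simp only [map_mul, map_add, map_pow, h0, h1, h3, zero_mul, add_zero] at m0 m6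
    have x0 := pow_eq_zero_iff two_ne_zero |>.mp m0
    have z0 := pow_eq_zero_iff two_ne_zero |>.mp m6
    rcases hor with h | h | h
    · rw [h, map_one] at h0; exact one_ne_zero h0
    · rw [h, map_one] at x0; exact one_ne_zero x0
    · rw [h, map_one] at z0; exact one_ne_zero z0
  obtain ⟨i, hi⟩ := unit_of_red hκ
  rcases red_zero_or_one (red (x * i)) with hx | hx
  · refine classP_int h1 h2 h3 hne (b0 := x * i) (b1 := 0) (b2 := 0) (b3 := z * i) (A0 := B0 * i ^ 2) (A1 := B1 * i ^ 2)
      (A2 := B2 * i ^ 2) (A3 := B3 * i ^ 2) (A4 := B4 * i ^ 2) hx ?_ ?_ ?_ ?_ ?_ ?_ ?_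
    · linear_combination i ^ 2 * d0 - x * i * hi
    · linear_combination i ^ 2 * d1
    · linear_combination i ^ 2 * d2
    · linear_combination i ^ 2 * d3 - z * i * hi
    · linear_combination i ^ 2 * d4
    · linear_combination i ^ 2 * d5 + (κ * i + 1) * hi
    · linear_combination i ^ 2 * d6
  · refine classP_int h1 h2 h3 hne (b0 := - 1 - x * i) (b1 := 0) (b2 := 0) (b3 := - z * i) (A0 := B0 * i ^ 2) (A1 := B1 * i ^ 2)
      (A2 := B2 * i ^ 2) (A3 := B3 * i ^ 2) (A4 := B4 * i ^ 2) ?_ ?_ ?_ ?_ ?_ ?_ ?_ ?_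
    · rw [map_sub, hx, map_neg, map_one]; decide
    · linear_combination i ^ 2 * d0 - x * i * hi
    · linear_combination i ^ 2 * d1
    · linear_combination i ^ 2 * d2
    · linear_combination i ^ 2 * d3 - z * i * hi
    · linear_combination i ^ 2 * d4
    · linear_combination i ^ 2 * d5 + (κ * i + 1) * hi
    · linear_combination i ^ 2 * d6

theorem classP {l1 l2 l3 : R} (h1 : red l1 = 0) (h2 : red l2 = 1) (h3 : red l3 = 0) (hne : l1 ≠ 0)
    {b0 b1 b2 A0 A1 A2 A3 : ℚ}
    (c0 : b0 ^ 2 + b0 = l3 * A0)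
    (c1 : 2 * b0 * b1 + b1 = l2 * A0 + l3 * A1)
    (c2 : b1 ^ 2 + 2 * b0 * b2 + b2 = l1 * A0 + l2 * A1 + l3 * A2)
    (c3 : 2 * b1 * b2 = l1 * A1 + l2 * A2 + l3 * A3)
    (c4 : b2 ^ 2 = l1 * A2 + l2 * A3)
    (c5 : - 1 = l1 * A3) : False := by
  obtain ⟨i, hi⟩ := unit_of_red (x := l2 ^ 2 - l1 * l3) (by simp [h1, h2, h3])
  have hi' : ((l2 : ℚ) ^ 2 - l1 * l3) * i = 1 := by exact_mod_cast congrArg Subtype.val hi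
  obtain ⟨n0, hn0⟩ : ∃ n0 : ℚ, n0 = (l3 * b2 - l2 * b1) * i := ⟨_, rfl⟩
  obtain ⟨n1, hn1⟩ : ∃ n1 : ℚ, n1 = (l1 * b1 - l2 * b2) * i := ⟨_, rfl⟩
  have N1 : b1 + l2 * n0 + l3 * n1 = 0 := by rw [hn0, hn1]; linear_combination -b1 * hi'
  have N2 : b2 + l1 * n0 + l2 * n1 = 0 := by rw [hn0, hn1]; linear_combination -b2 * hi'
  refine classP3 h1 h2 h3 hne (b0 := b0 + l3 * n0) (b3 := l1 * n1)
    (A0 := A0 + (2 * b0 + 1) * n0 + l3 * n0 ^ 2)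
    (A1 := A1 + (2 * b0 + 1) * n1 + 2 * b1 * n0 + l2 * n0 ^ 2 + 2 * l3 * n0 * n1)
    (A2 := A2 + 2 * b1 * n1 + 2 * b2 * n0 + l1 * n0 ^ 2 + 2 * l2 * n0 * n1 + l3 * n1 ^ 2)
    (A3 := A3 + 2 * b2 * n1 + 2 * l1 * n0 * n1 + l2 * n1 ^ 2)
    (A4 := l1 * n1 ^ 2) ?_ ?_ ?_ ?_ ?_ ?_ ?_
  · linear_combination c0
  · linear_combination c1 - (2 * (b0 + l3 * n0) + 1) * N1
  · linear_combination c2 - (2 * (b0 + l3 * n0) + 1) * N2 - (b1 + l2 * n0 + l3 * n1) * N1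
  · linear_combination c3 - 2 * (b1 + l2 * n0 + l3 * n1) * N2
  · linear_combination c4 - (b2 + l1 * n0 + l2 * n1) * N2 - 2 * l1 * n1 * N1
  · linear_combination c5 - 2 * l1 * n1 * N2
  · ring
end FQ

namespace FQ

theorem int_of_pow {x : ℚ} {y : R} {n : ℕ} (hn : n ≠ 0) (h : x ^ n = y) : ∃ z : R, (z : ℚ) = x := by
  refine ⟨⟨x, ?_⟩, rfl⟩
  have h1 := mem_R.mp y.2
  rw [← h] at h1
  rw [mem_R]
  push_cast at h1
  rw [norm_pow] at h1
  exact (pow_le_one_iff_of_nonneg (norm_nonneg _) hn).mp h1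

theorem red_of_pow {x y : R} {n : ℕ} (hn : n ≠ 0) (h : x ^ n = y) (hy : red y = 0) : red x = 0 := by
  have := congrArg red h
  rw [map_pow, hy] at this
  exact (pow_eq_zero_iff hn).mp this

theorem C2_even {S m P : ℚ} (hE : S ^ 5 - 5 * S ^ 3 * m + 5 * S * m ^ 2 = 1) (hm : m ≠ 0)
    (hP : m = P * S ^ 2) {P' : R} (hP' : (P' : ℚ) = P) (hr : red P' = 0) : False := by
  have r5 : red 5 = 1 := by rw [map_ofNat]; rfl
  have hS : S ≠ 0 := by rintro rfl; simp at hP; exact hm hP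
  obtain ⟨W, hW⟩ := unit_of_red (x := 5 * P' ^ 2 - 5 * P' + 1) (by simp [hr])
  have hW' : (5 * P ^ 2 - 5 * P + 1) * W = 1 := by
    have := congrArg Subtype.val hW; push_cast at this; rw [← hP']; exact this
  have hS5 : S ^ 5 * (5 * P ^ 2 - 5 * P + 1) = 1 := by rw [hP] at hE; linear_combination hE
  have hS5' : S ^ 5 = W := by linear_combination W * hS5 - S ^ 5 * hW'
  obtain ⟨s, hs⟩ := int_of_pow (by norm_num) hS5'
  have hsW : s ^ 5 = W := mod_up (by push_cast; rw [hs, hS5'])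
  have rW : red W = 1 := by
    have := congrArg red hW
    simpa [hr] using this
  have rs : red s = 1 := by
    rcases red_zero_or_one (red s) with h | h
    · have := congrArg red hsW
      rw [map_pow, h, rW] at this; simp at this
    · exact h
  obtain ⟨mm, hmm⟩ : ∃ mm : R, mm = P' * s ^ 2 := ⟨_, rfl⟩
  have hmq : (mm : ℚ) = m := by rw [hmm, hP]; push_cast; rw [hs, hP']
  have rm : red mm = 0 := by rw [hmm, map_mul, hr, zero_mul]
  have hmm0 : mm ≠ 0 := by intro h; rw [h] at hmq; exact hm hmq.symm
  have hE' : s ^ 5 - 5 * s ^ 3 * mm + 5 * s * mm ^ 2 = 1 := mod_up (by push_cast; rw [hs, hmq]; exact hE)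
  obtain ⟨i, hi⟩ := unit_of_red (x := s ^ 2 - mm) (by simp [rs, rm])
  refine classP_kd (l1 := mm ^ 2) (l2 := - s * (s ^ 2 - 3 * mm)) (l3 := mm) (by simp [rm]) (by simp [rs, rm]) rm
    (pow_ne_zero 2 hmm0) (k1 := s ^ 2 * (s ^ 2 - 2 * mm) ^ 2 * i ^ 2) (k2 := s * mm * i) (k3 := - mm * i)
    (g1 := mm * s * (s ^ 2 - 2 * mm) * i) (g0 := - mm ^ 2 * i) ?_ ?_ ?_ ?_ ?_
  · ring
  · ring
  · linear_combination mm * (mm ^ 2 + s ^ 4 - 3 * mm * s ^ 2) * i * hi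
  · linear_combination (- i ^ 2 * (s ^ 2 - mm) ^ 2) * hE' - (mm ^ 3 * s * i + 1 + (s ^ 2 - mm) * i) * hi
  · ring

theorem C2_inv {S m P : ℚ} (hE : S ^ 5 - 5 * S ^ 3 * m + 5 * S * m ^ 2 = 1) (hm : m ≠ 0)
    (hP : m = P * S ^ 2) {e : R} (he : (e : ℚ) * P = 1) (hr : red e = 0) : False := by
  have r5 : red 5 = 1 := by rw [map_ofNat]; rfl
  have hS : S ≠ 0 := by rintro rfl; simp at hP; exact hm hP
  have he0 : (e : ℚ) ≠ 0 := by intro h; rw [h] at he; simp at he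
  have hS5 : S ^ 5 * (5 * P ^ 2 - 5 * P + 1) = 1 := by rw [hP] at hE; linear_combination hE
  have hS5e : S ^ 5 * (5 - 5 * e + e ^ 2) = e ^ 2 := by
    linear_combination e ^ 2 * hS5 - S ^ 5 * (5 * (e * P + 1) - 5 * e) * he
  obtain ⟨W, hW⟩ := unit_of_red (x := 5 - 5 * e + e ^ 2) (by simp [hr, r5])
  have hW' : (5 - 5 * e + e ^ 2) * (W : ℚ) = 1 := by
    have := congrArg Subtype.val hW; push_cast at this; exact this
  obtain ⟨s, hs⟩ := int_of_pow (n := 5) (y := e ^ 2 * W) (by norm_num)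
    (show S ^ 5 = _ by push_cast; linear_combination W * hS5e - S ^ 5 * hW')
  have hn5 : (e / S ^ 2 : ℚ) ^ 5 = ((e * (5 - 5 * e + e ^ 2) ^ 2 : R) : ℚ) := by
    rw [div_pow, div_eq_iff (by positivity)]
    push_cast
    have : (e:ℚ) ^ 4 = S ^ 10 * (5 - 5 * e + e ^ 2) ^ 2 := by
      linear_combination - (e ^ 2 + S ^ 5 * (5 - 5 * e + e ^ 2)) * hS5e
    linear_combination e * this
  obtain ⟨n, hn⟩ := int_of_pow (n := 5) (by norm_num) hn5
  have rn : red n = 0 := red_of_pow (n := 5) (y := e * (5 - 5 * e + e ^ 2) ^ 2) (by norm_num)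
    (mod_up (by rw [← hn5, ← hn]; push_cast; rfl)) (by simp [hr])
  have n0 : n ≠ 0 := by
    rintro rfl
    have : (e : ℚ) / S ^ 2 ≠ 0 := div_ne_zero he0 (pow_ne_zero 2 hS)
    exact this (by rw [← hn]; rfl)
  have hnS : (n : ℚ) * S ^ 2 = e := by rw [hn]; field_simp
  have hF : s ^ 5 * n ^ 2 - 5 * s ^ 3 * n + 5 * s = n ^ 2 := mod_up (by
    push_cast; rw [hs]
    have h4 : S ^ 4 ≠ 0 := pow_ne_zero 4 hS
    apply mul_left_cancel₀ h4
    have : S ^ 5 * (5 - 5 * (n * S ^ 2) + (n * S ^ 2) ^ 2) = (n * S ^ 2) ^ 2 := by rw [hnS]; exact hS5e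
    linear_combination this)
  obtain ⟨i, hi⟩ := unit_of_red (x := s ^ 2 * n - 1) (by simp [rn])
  have hKD : KD (- s * n * (s ^ 2 * n - 3)) n (- s * n ^ 2 * (s ^ 2 * n - 2) * i) (n * i) ((n * i) ^ 2)
    (2 * (- s * n ^ 2 * (s ^ 2 * n - 2) * i) * (n * i) - 1 - (- s * n * (s ^ 2 * n - 3)) * (n * i) ^ 2)
    (- s * n * (s ^ 2 * n - 2) * i) := by
    refine ⟨by simp [rn], rn, by ring, ?_, ?_, by ring, rfl⟩
    · grind
    · grind
  exact n0 hKD.main.2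

/-- Entry: rational root. -/
theorem C2 {S m : ℚ} (hE : S ^ 5 - 5 * S ^ 3 * m + 5 * S * m ^ 2 = 1) (hm : m ≠ 0) (hm2 : m ≠ S ^ 2) : False := by
  have hS : S ≠ 0 := by rintro rfl; simp at hE
  have hP : m = (m / S ^ 2) * S ^ 2 := by field_simp
  rcases int_or_inv (m / S ^ 2) with ⟨P, hPq⟩ | ⟨e, he, hr⟩
  · rcases red_zero_or_one (red P) with h | h
    · exact C2_even hE hm hP hPq h
    · refine C2_even (S := S) (m := S ^ 2 - m) (P := 1 - m / S ^ 2) (P' := 1 - P) ?_ ?_ ?_ ?_ ?_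
      · linear_combination hE
      · intro h; apply hm2; linear_combination -h
      · field_simp
      · push_cast; rw [hPq]
      · simp [h]
  · exact C2_inv hE hm hP he hr
end FQ

namespace FQ

theorem c3id {s y Q q5 p q A1 A2 t0 t1 t2 : ℚ} (hs : s ≠ 0) (hQ : Q ≠ 0) (hq5 : q5 ≠ 0)
    (eQ : Q = s ^ 2 + 5 * s + 5) (eq5 : q5 = 7 * s ^ 5 + 60 * s ^ 4 + 180 * s ^ 3 + 200 * s ^ 2 - 100)
    (hy : y ^ 2 = - s * q5)
    (hp : p = (4 * s ^ 5 + 25 * s ^ 4 + 40 * s ^ 3 + 25 * s + 100) / q5)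
    (hq : q = (2 * s ^ 5 + 20 * s ^ 4 + 80 * s ^ 3 + 150 * s ^ 2 + 100 * s - 25) / q5)
    (hA1 : A1 = -3 + 15 * (s + 1) / Q + 25 * (s + 1) ^ 2 / (s * Q ^ 2))
    (hA2 : A2 = 3 - 5 * (s + 1) * (s + 3) / Q)
    (ht0 : t0 = - (s ^ 2 + 10 * s + 20) / q5)
    (ht1 : t1 = 10 * (s ^ 4 + 5 * s ^ 3 + 5 * s ^ 2 - 5 * s - 5) / (s * Q * q5))
    (ht2 : t2 = - 10 * (s ^ 5 + 7 * s ^ 4 + 15 * s ^ 3 + 5 * s ^ 2 - 15 * s - 10) / (s * Q * q5))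
    {b0 b1 b2 : ℚ} (hb0 : b0 = (y * t0 - 1) / 2) (hb1 : b1 = y * t1 / 2) (hb2 : b2 = y * t2 / 2) :
    b0 ^ 2 + b0 = - q ∧ 2 * b0 * b1 + b1 = - p - q * A2 ∧
    b1 ^ 2 + 2 * b0 * b2 + b2 = - 1 - p * A2 + q * A1 ∧ 2 * b1 * b2 = - A2 + p * A1 - q ∧
    b2 ^ 2 = A1 - p := by
  have I0 : s * q5 * t0 ^ 2 + 1 = 4 * q := by
    rw [ht0, hq]; field_simp; rw [eq5]; ring
  have I1 : s * q5 * (2 * t0 * t1) = 4 * (p + q * A2) := by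
    rw [ht0, ht1, hp, hq, hA2]; field_simp; rw [eQ]; ring
  have I2 : s * q5 * (t1 ^ 2 + 2 * t0 * t2) = 4 * (1 + p * A2 - q * A1) := by
    rw [ht0, ht1, ht2, hp, hq, hA2, hA1]; field_simp; rw [eq5, eQ]; ring
  have I3 : s * q5 * (2 * t1 * t2) = 4 * (A2 - p * A1 + q) := by
    rw [ht1, ht2, hp, hq, hA2, hA1]; field_simp; rw [eq5, eQ]; ring
  have I4 : s * q5 * t2 ^ 2 = 4 * (p - A1) := by
    rw [ht2, hp, hA1]; field_simp; rw [eq5, eQ]; ring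
  rw [hb0, hb1, hb2]
  refine ⟨?_, ?_, ?_, ?_, ?_⟩
  · linear_combination t0 ^ 2 / 4 * hy - I0 / 4
  · linear_combination (2 * t0 * t1) / 4 * hy - I1 / 4
  · linear_combination (t1 ^ 2 + 2 * t0 * t2) / 4 * hy - I2 / 4
  · linear_combination (2 * t1 * t2) / 4 * hy - I3 / 4
  · linear_combination (t2 ^ 2) / 4 * hy - I4 / 4

theorem odd_form {x : R} (h : red x = 1) : ∃ l : R, x ^ 2 = 1 + 8 * l := by
  obtain ⟨k, hk⟩ := even_iff.mp (show red (x - 1) = 0 by rw [map_sub, h, map_one, sub_self])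
  obtain ⟨l, hl⟩ := even_iff.mp (show red (k ^ 2 + k) = 0 by
    rw [map_add, map_pow]; rcases red_zero_or_one (red k) with h | h <;> rw [h] <;> decide)
  exact ⟨l, by linear_combination (x + 1 + 2 * k) * hk + 4 * hl⟩

theorem odd_ne_even {x y : R} (h : x = 2 * y) (hx : red x = 1) : False := by
  rw [h, map_mul, red_two, zero_mul] at hx; exact zero_ne_one hx

theorem C3_unit {s y : R} (h : y ^ 2 = - s * (7 * s ^ 5 + 60 * s ^ 4 + 180 * s ^ 3 + 200 * s ^ 2 - 100))
    (hs : red s = 1) : False := by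
  have r7 : red 7 = 1 := by rw [map_ofNat]; rfl
  have r47 : red 47 = 1 := by rw [map_ofNat]; rfl
  have hy : red y = 1 := by
    rcases red_zero_or_one (red y) with h0 | h0
    · have := congrArg red h
      have r60 : red 60 = 0 := by rw [map_ofNat]; rfl
      have r180 : red 180 = 0 := by rw [map_ofNat]; rfl
      have r200 : red 200 = 0 := by rw [map_ofNat]; rfl
      have r100 : red 100 = 0 := by rw [map_ofNat]; rfl
      simp only [map_mul, map_add, map_sub, map_neg, map_pow, h0, hs, r7, r60, r180, r200, r100] at this
      exact absurd this (by decide)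
    · exact h0
  obtain ⟨l, hl⟩ := odd_form hs
  obtain ⟨k, hk⟩ := odd_form hy
  have h4 : (4 : R) ≠ 0 := by
    intro h; have := congrArg Subtype.val h; push_cast at this; norm_num at this
  have key : (47 : R) = 2 * (- (k + 7 * (3 * l + 24 * l ^ 2 + 64 * l ^ 3) + (60 * s + 180) * (2 * l + 8 * l ^ 2) + 200 * s * l + 20 * s)) := by
    apply mul_left_cancel₀ h4
    linear_combination h - hk - (7 * (s ^ 4 + s ^ 2 * (1 + 8 * l) + (1 + 8 * l) ^ 2) + (60 * s + 180) * (s ^ 2 + 1 + 8 * l) + 200 * s) * hl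
  exact odd_ne_even key r47

end FQ

namespace FQ

theorem C3_inv_aux {r Y I J c b : R} (hr : red r = 0) (hr0 : r ≠ 0)
    (hI : (7 + 60 * r + 180 * r ^ 2 + 200 * r ^ 3 - 100 * r ^ 5) * I = 1)
    (hJ : (1 + 5 * r + 5 * r ^ 2) * J = 1)
    (hY : Y ^ 2 = - (7 + 60 * r + 180 * r ^ 2 + 200 * r ^ 3 - 100 * r ^ 5))
    (hc : c = - Y * (1 + 10 * r + 20 * r ^ 2) * I) (hb : c - 1 = 2 * b) (rb : red b = 0) : False := by
  have hrq : (r : ℚ) ≠ 0 := by intro h; exact hr0 (mod_up h)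
  have hIq : (7 + 60 * r + 180 * r ^ 2 + 200 * r ^ 3 - 100 * r ^ 5) * (I : ℚ) = 1 := by exact_mod_cast congrArg Subtype.val hI
  have hJq : (1 + 5 * r + 5 * r ^ 2) * (J : ℚ) = 1 := by exact_mod_cast congrArg Subtype.val hJ
  have hYq : (Y : ℚ) ^ 2 = - (7 + 60 * r + 180 * r ^ 2 + 200 * r ^ 3 - 100 * r ^ 5) := by exact_mod_cast congrArg Subtype.val hY
  have hcq : (c : ℚ) = - Y * (1 + 10 * r + 20 * r ^ 2) * I := by exact_mod_cast congrArg Subtype.val hc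
  have hbq : (c : ℚ) - 1 = 2 * b := by exact_mod_cast congrArg Subtype.val hb
  obtain ⟨s, hs⟩ : ∃ s : ℚ, s = 1 / r := ⟨_, rfl⟩
  have hD : (7 + 60 * r + 180 * r ^ 2 + 200 * r ^ 3 - 100 * r ^ 5 : ℚ) ≠ 0 := left_ne_zero_of_mul (by rw [hIq]; norm_num)
  have hE : (1 + 5 * r + 5 * r ^ 2 : ℚ) ≠ 0 := left_ne_zero_of_mul (by rw [hJq]; norm_num)
  have hIe : (I : ℚ) = 1 / (7 + 60 * r + 180 * r ^ 2 + 200 * r ^ 3 - 100 * r ^ 5) := eq_one_div_of_mul_eq_one_right hIq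
  have hJe : (J : ℚ) = 1 / (1 + 5 * r + 5 * r ^ 2) := eq_one_div_of_mul_eq_one_right hJq
  have e5 : (7 + 60 * r + 180 * r ^ 2 + 200 * r ^ 3 - 100 * r ^ 5 : ℚ) / r ^ 5 = 7 * s ^ 5 + 60 * s ^ 4 + 180 * s ^ 3 + 200 * s ^ 2 - 100 := by
    rw [hs]; field_simp
  have eQ : (1 + 5 * r + 5 * r ^ 2 : ℚ) / r ^ 2 = s ^ 2 + 5 * s + 5 := by rw [hs]; field_simp
  obtain ⟨D, hDD⟩ : ∃ D : ℚ, D = 7 + 60 * r + 180 * r ^ 2 + 200 * r ^ 3 - 100 * r ^ 5 := ⟨_, rfl⟩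
  obtain ⟨E, hEE⟩ : ∃ E : ℚ, E = 1 + 5 * r + 5 * r ^ 2 := ⟨_, rfl⟩
  rw [← hDD] at hD hIe e5 hYq
  rw [← hEE] at hE hJe eQ
  obtain ⟨d0, d1, d2, d3, d4⟩ := c3id (s := s) (y := Y / r ^ 3) (Q := E / r ^ 2) (q5 := D / r ^ 5)
    (p := (4 + 25 * r + 40 * r ^ 2 + 25 * r ^ 4 + 100 * r ^ 5) * I)
    (q := (2 + 20 * r + 80 * r ^ 2 + 150 * r ^ 3 + 100 * r ^ 4 - 25 * r ^ 5) * I)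
    (A1 := - 3 + 15 * (1 + r) * r * J + 25 * (1 + r) ^ 2 * r ^ 3 * J ^ 2)
    (A2 := 3 - 5 * (1 + r) * (1 + 3 * r) * J)
    (t0 := - (1 + 10 * r + 20 * r ^ 2) * r ^ 3 * I)
    (t1 := 10 * r ^ 4 * (1 + 5 * r + 5 * r ^ 2 - 5 * r ^ 3 - 5 * r ^ 4) * I * J)
    (t2 := - 10 * r ^ 3 * (1 + 7 * r + 15 * r ^ 2 + 5 * r ^ 3 - 15 * r ^ 4 - 10 * r ^ 5) * I * J)
    (b0 := b) (b1 := 5 * Y * r * (1 + 5 * r + 5 * r ^ 2 - 5 * r ^ 3 - 5 * r ^ 4) * I * J)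
    (b2 := - 5 * Y * (1 + 7 * r + 15 * r ^ 2 + 5 * r ^ 3 - 15 * r ^ 4 - 10 * r ^ 5) * I * J)
    (by rw [hs]; exact one_div_ne_zero hrq) (div_ne_zero hE (pow_ne_zero 2 hrq)) (div_ne_zero hD (pow_ne_zero 5 hrq))
    eQ e5 (by rw [hs]; field_simp; linear_combination hYq)
    (by rw [hIe, hs]; field_simp)
    (by rw [hIe, hs]; field_simp)
    (by rw [hJe, hs]; field_simp)
    (by rw [hJe, hs]; field_simp)
    (by rw [hIe, hs]; field_simp)
    (by rw [hIe, hJe, hs]; field_simp)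
    (by rw [hIe, hJe, hs]; field_simp)
    (by field_simp; linear_combination - hbq + hcq)
    (by field_simp; ring) (by field_simp; ring)
  obtain ⟨g0, g1, k1, k2, k3, f0, f1, f2, f3, f4⟩ := lemmaM (l1 := 1)
    (l2 := (4 + 25 * r + 40 * r ^ 2 + 25 * r ^ 4 + 100 * r ^ 5) * I)
    (l3 := (2 + 20 * r + 80 * r ^ 2 + 150 * r ^ 3 + 100 * r ^ 4 - 25 * r ^ 5) * I)
    (b0 := b) (b1 := 5 * Y * r * (1 + 5 * r + 5 * r ^ 2 - 5 * r ^ 3 - 5 * r ^ 4) * I * J)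
    (b2 := - 5 * Y * (1 + 7 * r + 15 * r ^ 2 + 5 * r ^ 3 - 15 * r ^ 4 - 10 * r ^ 5) * I * J)
    (b3 := 0) (A0 := - 1) (A1 := - (3 - 5 * (1 + r) * (1 + 3 * r) * J))
    (A2 := - 3 + 15 * (1 + r) * r * J + 25 * (1 + r) ^ 2 * r ^ 3 * J ^ 2) (A3 := - 1) (A4 := 0) rb
    (mod_up (by push_cast; linear_combination d0))
    (mod_up (by push_cast; linear_combination d1))
    (mod_up (by push_cast; linear_combination d2))
    (mod_up (by push_cast; linear_combination d3))
    (mod_up (by push_cast; linear_combination d4))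
    (by ring) (by ring)
  have r4 : red 4 = 0 := by rw [map_ofNat]; rfl
  have hKD : KD ((4 + 25 * r + 40 * r ^ 2 + 25 * r ^ 4 + 100 * r ^ 5) * I)
      ((2 + 20 * r + 80 * r ^ 2 + 150 * r ^ 3 + 100 * r ^ 4 - 25 * r ^ 5) * I) g0 g1 k1 k2 k3 :=
    ⟨by simp [hr, r4], by simp [hr, red_two], f0, f1, by linear_combination f2, by linear_combination f3, by linear_combination f4⟩
  have hq := hKD.main.2
  have hN : (2 + 20 * r + 80 * r ^ 2 + 150 * r ^ 3 + 100 * r ^ 4 - 25 * r ^ 5) = 0 := by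
    linear_combination (7 + 60 * r + 180 * r ^ 2 + 200 * r ^ 3 - 100 * r ^ 5) * hq
      - (2 + 20 * r + 80 * r ^ 2 + 150 * r ^ 3 + 100 * r ^ 4 - 25 * r ^ 5) * hI
  obtain ⟨r', hr'⟩ := even_iff.mp hr
  rw [hr'] at hN
  have h2 : (2 : R) ≠ 0 := by
    intro h; have := congrArg Subtype.val h; push_cast at this; norm_num at this
  have key : (1 : R) = 2 * (- (10 * r' + 80 * r' ^ 2 + 300 * r' ^ 3 + 400 * r' ^ 4 - 200 * r' ^ 5)) := by
    apply mul_left_cancel₀ h2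
    linear_combination hN
  exact odd_ne_even key (map_one _)

theorem C3_inv {s y : ℚ} {r : R} (h : y ^ 2 = - s * (7 * s ^ 5 + 60 * s ^ 4 + 180 * s ^ 3 + 200 * s ^ 2 - 100))
    (hrs : (r : ℚ) * s = 1) (hr : red r = 0) : False := by
  have r7 : red 7 = 1 := by rw [map_ofNat]; rfl
  have hr0 : r ≠ 0 := by rintro rfl; simp at hrs
  have hY : (y * r ^ 3) ^ 2 = ((- (7 + 60 * r + 180 * r ^ 2 + 200 * r ^ 3 - 100 * r ^ 5) : R) : ℚ) := by
    push_cast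
    have hs : s = 1 / r := by
      have hrq : (r : ℚ) ≠ 0 := by intro h; exact hr0 (mod_up h)
      field_simp; linear_combination hrs
    have hrq : (r : ℚ) ≠ 0 := by intro h; exact hr0 (mod_up h)
    rw [mul_pow, h, hs]; field_simp
  obtain ⟨Y, hYq⟩ := int_of_pow (by norm_num) hY
  have hY' : Y ^ 2 = - (7 + 60 * r + 180 * r ^ 2 + 200 * r ^ 3 - 100 * r ^ 5) :=
    mod_up (by rw [← hY, ← hYq]; push_cast; rfl)
  obtain ⟨I, hI⟩ := unit_of_red (x := 7 + 60 * r + 180 * r ^ 2 + 200 * r ^ 3 - 100 * r ^ 5) (by simp [hr, r7])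
  obtain ⟨J, hJ⟩ := unit_of_red (x := 1 + 5 * r + 5 * r ^ 2) (by simp [hr])
  have rI : red I = 1 := by have := congrArg red hI; simpa [hr, r7] using this
  have rY : red Y = 1 := by
    rcases red_zero_or_one (red Y) with h | h
    · have := congrArg red hY'; simp [hr, r7, h] at this
    · exact h
  obtain ⟨c, hc⟩ : ∃ c : R, c = - Y * (1 + 10 * r + 20 * r ^ 2) * I := ⟨_, rfl⟩
  have rc : red c = 1 := by rw [hc]; simp [hr, rI, rY]
  obtain ⟨b, hb⟩ := even_iff.mp (show red (c - 1) = 0 by rw [map_sub, rc, map_one, sub_self])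
  rcases red_zero_or_one (red b) with rb | rb
  · exact C3_inv_aux hr hr0 hI hJ hY' hc hb rb
  · refine C3_inv_aux (Y := - Y) (c := - c) (b := - 1 - b) hr hr0 hI hJ (by linear_combination hY')
      (by linear_combination - hc) (by linear_combination - hb) ?_
    rw [map_sub, map_neg, map_one, rb]; decide

end FQ

namespace FQ

theorem shift {p q A1 A2 b0 b1 b2 m B1 B2 p1 q1 : ℚ} (hq : q ≠ 0)
    (d0 : b0 ^ 2 + b0 = - q) (d1 : 2 * b0 * b1 + b1 = - p - q * A2)
    (d2 : b1 ^ 2 + 2 * b0 * b2 + b2 = - 1 - p * A2 + q * A1) (d3 : 2 * b1 * b2 = - A2 + p * A1 - q)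
    (d4 : b2 ^ 2 = A1 - p) (hm : m * q = - b0) (hB1 : B1 = b1 + m * p) (hB2 : B2 = b2 + m)
    (hp1 : p1 = - B2 ^ 2 - p) (hq1 : q1 * q = - B1) :
    B1 ^ 2 + B2 = - p1 * q - q1 * p ∧ 2 * B1 * B2 = - q - p1 * p - q1 := by
  have hmm : m ^ 2 * q - m = - 1 := by
    apply mul_right_cancel₀ hq
    linear_combination d0 + (m * q - b0 - 1) * hm
  have hp1' : p1 = - A1 - 2 * m * b2 - m ^ 2 := by rw [hp1, hB2]; linear_combination - d4
  have hq1' : q1 = A2 - 2 * m * b1 - m ^ 2 * p := by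
    apply mul_right_cancel₀ hq
    rw [hq1, hB1]
    linear_combination - d1 + p * hmm + 2 * b1 * hm
  rw [hB1, hB2]
  constructor
  · linear_combination d2 + q * hp1' + p * hq1' - hmm - 2 * b2 * hm
  · linear_combination d3 + p * hp1' + hq1'

theorem C3_even_aux {σ ζ I J L V N u5 Q p c m G1 G2 : R} (hζ : ζ ≠ 0)
    (hσ : ζ ^ 2 = - σ * u5)
    (hu : u5 = - 25 + 800 * σ ^ 2 + 2880 * σ ^ 3 + 3840 * σ ^ 4 + 1792 * σ ^ 5)
    (hN : N = 2048 * σ ^ 5 + 5120 * σ ^ 4 + 5120 * σ ^ 3 + 2400 * σ ^ 2 + 400 * σ - 25)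
    (hQ : Q = 16 * σ ^ 2 + 20 * σ + 5)
    (hI : u5 * I = 1) (hJ : Q * J = 1) (hL : N * L = 1)
    (hp : p = (1024 * σ ^ 5 + 1600 * σ ^ 4 + 640 * σ ^ 3 + 25 * σ + 25) * I)
    (hc : c = - 4 * ζ * (4 * σ ^ 2 + 10 * σ + 5) * I)
    (hm : m = - 2 * (c - 1) * u5 * L)
    (hG1 : G1 = - 5 * (256 * σ ^ 4 + 320 * σ ^ 3 + 80 * σ ^ 2 - 20 * σ - 5) * J + 4 * ζ * m * p)
    (hG2 : G2 = 5 * (512 * σ ^ 5 + 896 * σ ^ 4 + 480 * σ ^ 3 + 40 * σ ^ 2 - 30 * σ - 5) * J + 2 * ζ * m)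
    (hV : (G2 ^ 2 + 4 * ζ ^ 2 * p) * V = 1) : False := by
  have up : ∀ {x y : R}, x = y → (x : ℚ) = y := fun h => congrArg Subtype.val h
  have r4 : red 4 = 0 := by rw [map_ofNat]; rfl
  have l1z : red (- 4 * ζ ^ 2 * V) = 0 := by simp [r4]
  have l3z : red (4 * ζ * G1 * u5 * L * V) = 0 := by simp [r4]
  have h4 : (4 : R) ≠ 0 := by
    intro h; have := congrArg Subtype.val h; push_cast at this; norm_num at this
  have hVne : V ≠ 0 := right_ne_zero_of_mul (by rw [hV]; exact one_ne_zero)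
  have l1ne : - 4 * ζ ^ 2 * V ≠ 0 :=
    mul_ne_zero (mul_ne_zero (neg_ne_zero.mpr h4) (pow_ne_zero 2 hζ)) hVne
  replace hσ := up hσ
  replace hu := up hu
  replace hN := up hN
  replace hQ := up hQ
  replace hI := up hI
  replace hJ := up hJ
  replace hL := up hL
  replace hp := up hp
  replace hc := up hc
  replace hm := up hm
  replace hG1 := up hG1
  replace hG2 := up hG2
  replace hV := up hV
  replace hζ : (ζ : ℚ) ≠ 0 := fun h => hζ (mod_up h)
  have key : ∀ σ ζ I J L V N u5 Q p c m G1 G2 l1 l2 l3 : ℚ, ζ ≠ 0 → ζ ^ 2 = - σ * u5 →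
    u5 = - 25 + 800 * σ ^ 2 + 2880 * σ ^ 3 + 3840 * σ ^ 4 + 1792 * σ ^ 5 →
    N = 2048 * σ ^ 5 + 5120 * σ ^ 4 + 5120 * σ ^ 3 + 2400 * σ ^ 2 + 400 * σ - 25 →
    Q = 16 * σ ^ 2 + 20 * σ + 5 → u5 * I = 1 → Q * J = 1 → N * L = 1 →
    p = (1024 * σ ^ 5 + 1600 * σ ^ 4 + 640 * σ ^ 3 + 25 * σ + 25) * I →
    c = - 4 * ζ * (4 * σ ^ 2 + 10 * σ + 5) * I → m = - 2 * (c - 1) * u5 * L →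
    G1 = - 5 * (256 * σ ^ 4 + 320 * σ ^ 3 + 80 * σ ^ 2 - 20 * σ - 5) * J + 4 * ζ * m * p →
    G2 = 5 * (512 * σ ^ 5 + 896 * σ ^ 4 + 480 * σ ^ 3 + 40 * σ ^ 2 - 30 * σ - 5) * J + 2 * ζ * m →
    (G2 ^ 2 + 4 * ζ ^ 2 * p) * V = 1 → l1 = - 4 * ζ ^ 2 * V → l2 = 1 → l3 = 4 * ζ * G1 * u5 * L * V →
    ∃ b0 b1 b2 A0 A1 A2 A3 : ℚ, b0^2+b0=l3*A0 ∧ 2*b0*b1+b1=l2*A0+l3*A1 ∧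
     b1^2+2*b0*b2+b2=l1*A0+l2*A1+l3*A2 ∧ 2*b1*b2=l1*A1+l2*A2+l3*A3 ∧ b2^2=l1*A2+l2*A3 ∧ -1=l1*A3 := by
    clear hσ hu hN hQ hI hJ hL hp hc hm hG1 hG2 hV hζ l1z l3z l1ne hVne
    intro σ ζ I J L V N u5 Q p c m G1 G2 l1 l2 l3 hζ hσ hu hN hQ hI hJ hL hp hc hm hG1 hG2 hV hl1 hl2 hl3
    have hu0 : u5 ≠ 0 := left_ne_zero_of_mul (by rw [hI]; norm_num)
    have hQ0 : Q ≠ 0 := left_ne_zero_of_mul (by rw [hJ]; norm_num)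
    have hN0 : N ≠ 0 := left_ne_zero_of_mul (by rw [hL]; norm_num)
    have hσ0 : σ ≠ 0 := by rintro rfl; simp at hσ; exact hζ hσ
    have hIe := eq_one_div_of_mul_eq_one_right hI
    have hJe := eq_one_div_of_mul_eq_one_right hJ
    have hLe := eq_one_div_of_mul_eq_one_right hL
    have hq0 : N * I / 4 ≠ 0 := div_ne_zero (mul_ne_zero hN0 (right_ne_zero_of_mul (by rw [hI]; norm_num : u5 * I ≠ 0))) (by norm_num)
    obtain ⟨d0, d1, d2, d3, d4⟩ := c3id (s := 4 * σ) (y := 4 * ζ) (Q := Q) (q5 := 4 * u5)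
      (p := p) (q := N * I / 4) (b0 := (c - 1) / 2)
      (b1 := - 5 * (256 * σ ^ 4 + 320 * σ ^ 3 + 80 * σ ^ 2 - 20 * σ - 5) * J / (4 * ζ))
      (b2 := 5 * (512 * σ ^ 5 + 896 * σ ^ 4 + 480 * σ ^ 3 + 40 * σ ^ 2 - 30 * σ - 5) * J / (2 * ζ))
      (by simpa using hσ0) hQ0 (by simpa using hu0) (by rw [hQ]; ring) (by rw [hu]; ring)
      (by linear_combination 16 * hσ) (by rw [hp, hIe]; field_simp; ring) (by rw [hIe]; field_simp; rw [hN]; ring)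
      rfl rfl rfl rfl rfl
      (by rw [hc, hIe]; field_simp; ring)
      (by rw [hJe]; field_simp; rw [hσ]; field_simp; ring)
      (by rw [hJe]; field_simp; rw [hσ]; field_simp; ring)
    obtain ⟨p1, hp1⟩ : ∃ p1 : ℚ, p1 = - (G2 ^ 2 + 4 * ζ ^ 2 * p) / (4 * ζ ^ 2) := ⟨_, rfl⟩
    obtain ⟨q1, hq1⟩ : ∃ q1 : ℚ, q1 = - G1 * u5 * L / ζ := ⟨_, rfl⟩
    have B2s : (G2 / (2 * ζ)) ^ 2 = - p - p1 := by rw [hp1]; field_simp; ring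
    have q1q : q1 * (N * I / 4) = - (G1 / (4 * ζ)) := by
      rw [hq1, hIe, hLe]; field_simp
    obtain ⟨e1, e2⟩ := shift (m := m) (B1 := G1 / (4 * ζ)) (B2 := G2 / (2 * ζ)) (p1 := p1) (q1 := q1)
      hq0 d0 d1 d2 d3 d4 (by rw [hm, hIe, hLe]; field_simp; ring)
      (by rw [hG1]; field_simp) (by rw [hG2]; field_simp) (by linear_combination B2s) q1q
    have l1p1 : l1 * p1 = 1 := by
      rw [hl1, hp1]; field_simp; linear_combination hV
    have l3e : l3 = q1 * l1 := by rw [hl3, hq1, hl1]; field_simp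
    refine ⟨0, G1 / (4 * ζ), G2 / (2 * ζ), 0, - p1 * (N * I / 4), - p1 * p, - p1, by ring, ?_, ?_, ?_, ?_, ?_⟩
    · rw [l3e, hl2]; linear_combination q1q + q1 * (N * I / 4) * l1p1
    · rw [l3e, hl2]; linear_combination e1 + q1 * p * l1p1
    · rw [l3e, hl2]; linear_combination e2 + (N * I / 4 + q1) * l1p1
    · rw [hl2]; linear_combination B2s + p * l1p1
    · linear_combination l1p1
  obtain ⟨b0, b1, b2, A0, A1, A2, A3, c0, c1, c2, c3, c4, c5⟩ := key σ ζ I J L V N u5 Q p c m G1 G2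
    ((- 4 * ζ ^ 2 * V : R) : ℚ) ((1 : R) : ℚ) ((4 * ζ * G1 * u5 * L * V : R) : ℚ)
    hζ hσ hu hN hQ hI hJ hL hp hc hm hG1 hG2 hV rfl rfl rfl
  exact classP l1z (map_one _) l3z l1ne c0 c1 c2 c3 c4 c5

theorem C3_even {s y : R} (h : y ^ 2 = - s * (7 * s ^ 5 + 60 * s ^ 4 + 180 * s ^ 3 + 200 * s ^ 2 - 100))
    (hs : red s = 0) (hs0 : s ≠ 0) : False := by
  have h4 : (4 : R) ≠ 0 := by
    intro h; have := congrArg Subtype.val h; push_cast at this; norm_num at this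
  have h2 : (2 : R) ≠ 0 := by
    intro h; have := congrArg Subtype.val h; push_cast at this; norm_num at this
  have r25 : red 25 = 1 := by rw [map_ofNat]; rfl
  have r5 : red 5 = 1 := by rw [map_ofNat]; rfl
  have r4 : red 4 = 0 := by rw [map_ofNat]; rfl
  have ev : ∀ {x z : R}, x ^ 2 = 2 * z → ∃ w : R, x = 2 * w := fun {x z} hx => even_iff.mp (by
    have := congrArg red hx
    rw [map_pow, map_mul, red_two, zero_mul] at this
    exact (pow_eq_zero_iff two_ne_zero).mp this)
  obtain ⟨s', hs'⟩ := even_iff.mp hs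
  obtain ⟨y1, hy1⟩ := ev (x := y) (z := - s' * (7 * s ^ 5 + 60 * s ^ 4 + 180 * s ^ 3 + 200 * s ^ 2 - 100)) (by
    rw [h]; linear_combination (- (7 * s ^ 5 + 60 * s ^ 4 + 180 * s ^ 3 + 200 * s ^ 2 - 100)) * hs')
  have h1 : y1 ^ 2 = - (2 * s') * (- 25 + 200 * s' ^ 2 + 360 * s' ^ 3 + 240 * s' ^ 4 + 56 * s' ^ 5) := by
    apply mul_left_cancel₀ h4
    rw [hy1, hs'] at h
    linear_combination h
  obtain ⟨ζ, hζ⟩ := ev (x := y1) (z := - s' * (- 25 + 200 * s' ^ 2 + 360 * s' ^ 3 + 240 * s' ^ 4 + 56 * s' ^ 5)) (by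
    rw [h1]; ring)
  have h3 : 2 * ζ ^ 2 = - s' * (- 25 + 200 * s' ^ 2 + 360 * s' ^ 3 + 240 * s' ^ 4 + 56 * s' ^ 5) := by
    apply mul_left_cancel₀ h2
    rw [hζ] at h1
    linear_combination h1
  obtain ⟨σ, hσ⟩ : ∃ σ : R, s' = 2 * σ := ⟨ζ ^ 2 - s' * (12 - 100 * s' ^ 2 - 180 * s' ^ 3 - 120 * s' ^ 4 - 28 * s' ^ 5), by linear_combination -h3⟩
  have h5 : ζ ^ 2 = - σ * (- 25 + 800 * σ ^ 2 + 2880 * σ ^ 3 + 3840 * σ ^ 4 + 1792 * σ ^ 5) := by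
    apply mul_left_cancel₀ h2
    rw [hσ] at h3
    linear_combination h3
  have r400 : red 400 = 0 := by rw [map_ofNat]; rfl
  have r800 : red 800 = 0 := by rw [map_ofNat]; rfl
  have r2880 : red 2880 = 0 := by rw [map_ofNat]; rfl
  have r3840 : red 3840 = 0 := by rw [map_ofNat]; rfl
  have r1792 : red 1792 = 0 := by rw [map_ofNat]; rfl
  have r2048 : red 2048 = 0 := by rw [map_ofNat]; rfl
  have r5120 : red 5120 = 0 := by rw [map_ofNat]; rfl
  have r2400 : red 2400 = 0 := by rw [map_ofNat]; rfl
  have r16 : red 16 = 0 := by rw [map_ofNat]; rfl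
  have r20 : red 20 = 0 := by rw [map_ofNat]; rfl
  have r512 : red 512 = 0 := by rw [map_ofNat]; rfl
  have r896 : red 896 = 0 := by rw [map_ofNat]; rfl
  have r480 : red 480 = 0 := by rw [map_ofNat]; rfl
  have r40 : red 40 = 0 := by rw [map_ofNat]; rfl
  have r30 : red 30 = 0 := by rw [map_ofNat]; rfl
  obtain ⟨u5, hu⟩ : ∃ u5 : R, u5 = - 25 + 800 * σ ^ 2 + 2880 * σ ^ 3 + 3840 * σ ^ 4 + 1792 * σ ^ 5 := ⟨_, rfl⟩
  obtain ⟨N, hN⟩ : ∃ N : R, N = 2048 * σ ^ 5 + 5120 * σ ^ 4 + 5120 * σ ^ 3 + 2400 * σ ^ 2 + 400 * σ - 25 := ⟨_, rfl⟩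
  obtain ⟨Q, hQ⟩ : ∃ Q : R, Q = 16 * σ ^ 2 + 20 * σ + 5 := ⟨_, rfl⟩
  have ru : red u5 ≠ 0 := by rw [hu]; simp [r25, r800, r2880, r3840, r1792]
  have rN : red N ≠ 0 := by rw [hN]; simp [r25, r2048, r5120, r2400, r400]
  have rQ : red Q ≠ 0 := by rw [hQ]; simp [r5, r16, r20]
  obtain ⟨I, hI⟩ := unit_of_red ru
  obtain ⟨J, hJ⟩ := unit_of_red rQ
  obtain ⟨L, hL⟩ := unit_of_red rN
  have rJ : red J = 1 := by
    have := congrArg red hJ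
    rw [hQ] at this
    simpa [r5, r16, r20] using this
  rw [← hu] at h5
  have hζ0 : ζ ≠ 0 := by
    rintro rfl
    have hu0 : u5 ≠ 0 := left_ne_zero_of_mul (by rw [hI]; exact one_ne_zero)
    have : σ * u5 = 0 := by linear_combination h5
    rcases mul_eq_zero.mp this with h | h
    · exact hs0 (by rw [hs', hσ, h]; ring)
    · exact hu0 h
  obtain ⟨p, hp⟩ : ∃ p : R, p = (1024 * σ ^ 5 + 1600 * σ ^ 4 + 640 * σ ^ 3 + 25 * σ + 25) * I := ⟨_, rfl⟩
  obtain ⟨c, hc⟩ : ∃ c : R, c = - 4 * ζ * (4 * σ ^ 2 + 10 * σ + 5) * I := ⟨_, rfl⟩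
  obtain ⟨m, hm⟩ : ∃ m : R, m = - 2 * (c - 1) * u5 * L := ⟨_, rfl⟩
  obtain ⟨G1, hG1⟩ : ∃ G1 : R, G1 = - 5 * (256 * σ ^ 4 + 320 * σ ^ 3 + 80 * σ ^ 2 - 20 * σ - 5) * J + 4 * ζ * m * p := ⟨_, rfl⟩
  obtain ⟨G2, hG2⟩ : ∃ G2 : R, G2 = 5 * (512 * σ ^ 5 + 896 * σ ^ 4 + 480 * σ ^ 3 + 40 * σ ^ 2 - 30 * σ - 5) * J + 2 * ζ * m := ⟨_, rfl⟩
  have rG2 : red G2 = 1 := by rw [hG2]; simp [r5, r512, r896, r480, r40, r30, red_two, rJ]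
  obtain ⟨V, hV⟩ := unit_of_red (x := G2 ^ 2 + 4 * ζ ^ 2 * p) (by simp [rG2, r4])
  exact C3_even_aux hζ0 h5 hu hN hQ hI hJ hL hp hc hm hG1 hG2 hV

/-- Entry: square discriminant. -/
theorem C3 {s y : ℚ} (hs : s ≠ 0)
    (h : y ^ 2 = - s * (7 * s ^ 5 + 60 * s ^ 4 + 180 * s ^ 3 + 200 * s ^ 2 - 100)) : False := by
  rcases int_or_inv s with ⟨s', rfl⟩ | ⟨r, hrs, hr⟩
  · obtain ⟨y', rfl⟩ := int_of_pow (x := y) (n := 2)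
      (y := - s' * (7 * s' ^ 5 + 60 * s' ^ 4 + 180 * s' ^ 3 + 200 * s' ^ 2 - 100)) (by norm_num) (by push_cast; exact h)
    have h' : y' ^ 2 = - s' * (7 * s' ^ 5 + 60 * s' ^ 4 + 180 * s' ^ 3 + 200 * s' ^ 2 - 100) :=
      mod_up (by push_cast; exact h)
    rcases red_zero_or_one (red s') with h0 | h0
    · exact C3_even h' h0 (by rintro rfl; exact hs rfl)
    · exact C3_unit h' h0
  · exact C3_inv h hrs hr
end FQ

namespace FQ

theorem cub_roots {F : Type*} [Field F] {L : Type*} [Field L] [Algebra F L] (e2 e3 : F) {x1 x2 x3 y : L} (h1 : x1 + x2 + x3 = 1)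
    (h2 : x1 * x2 + x1 * x3 + x2 * x3 = algebraMap F L e2) (h3 : x1 * x2 * x3 = algebraMap F L e3)
    (hy : y ^ 3 - y ^ 2 + algebraMap F L e2 * y - algebraMap F L e3 = 0) : y = x1 ∨ y = x2 ∨ y = x3 := by
  have : (y - x1) * ((y - x2) * (y - x3)) = 0 := by
    linear_combination hy - y ^ 2 * h1 + y * h2 - h3
  rcases mul_eq_zero.mp this with h | h
  · left; exact sub_eq_zero.mp h
  · rcases mul_eq_zero.mp h with h | h
    · right; left; exact sub_eq_zero.mp h
    · right; right; exact sub_eq_zero.mp h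

theorem three_dvd {F : Type*} [Field F] (L : Type*) [Field L] [Algebra F L] [FiniteDimensional F L] (e2 e3 : F)
    (hnr : ∀ z : F, z ^ 3 - z ^ 2 + e2 * z - e3 ≠ 0) (x : L)
    (hx : x ^ 3 - x ^ 2 + algebraMap F L e2 * x - algebraMap F L e3 = 0) : 3 ∣ Module.finrank F L := by
  have hdeg : (X ^ 3 - X ^ 2 + C e2 * X - C e3 : F[X]).natDegree = 3 := by compute_degree!
  have hmon : (X ^ 3 - X ^ 2 + C e2 * X - C e3 : F[X]).Monic := by monicity!
  have hirr : Irreducible (X ^ 3 - X ^ 2 + C e2 * X - C e3 : F[X]) := by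
    rw [hmon.irreducible_iff_roots_eq_zero_of_degree_le_three (by omega) (by omega)]
    rw [Multiset.eq_zero_iff_forall_notMem]
    intro z hz
    have := isRoot_of_mem_roots hz
    apply hnr z
    simpa [IsRoot] using this
  have hm := minpoly.eq_of_irreducible_of_monic hirr (x := x) (by simpa using hx) hmon
  have := minpoly.degree_dvd (K := F) (L := L) (x := x) (Algebra.IsIntegral.isIntegral x)
  rwa [← hm, hdeg] at this

theorem two_dvd {F : Type*} [Field F] (L : Type*) [Field L] [Algebra F L] [FiniteDimensional F L] (D : F)
    (hD : ∀ y : F, y ^ 2 ≠ D) (x : L) (hx : x ^ 2 = algebraMap F L D) : 2 ∣ Module.finrank F L := by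
  have hdeg : (X ^ 2 - C D : F[X]).natDegree = 2 := by compute_degree!
  have hmon : (X ^ 2 - C D : F[X]).Monic := by monicity!
  have hirr : Irreducible (X ^ 2 - C D : F[X]) := by
    rw [hmon.irreducible_iff_roots_eq_zero_of_degree_le_three (by omega) (by omega)]
    rw [Multiset.eq_zero_iff_forall_notMem]
    intro z hz
    have := isRoot_of_mem_roots hz
    apply hD z
    rw [IsRoot, eval_sub, eval_pow, eval_X, eval_C] at this
    linear_combination this
  have hm := minpoly.eq_of_irreducible_of_monic hirr (x := x) (by simp [hx]) hmon
  have := minpoly.degree_dvd (K := F) (L := L) (x := x) (Algebra.IsIntegral.isIntegral x)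
  rwa [← hm, hdeg] at this

theorem gal {F : Type*} [Field F] {K : Type*} [Field K] [Algebra F K] [IsGalois F K] (e2 e3 : F) {x1 x2 x3 : K} (h1 : x1 + x2 + x3 = 1)
    (h2 : x1 * x2 + x1 * x3 + x2 * x3 = algebraMap F K e2) (h3 : x1 * x2 * x3 = algebraMap F K e3)
    (hnr : ∀ z : F, z ^ 3 - z ^ 2 + e2 * z - e3 ≠ 0)
    (hD : ∀ y : F, y ^ 2 ≠ e2 ^ 2 - 4 * e2 ^ 3 - 4 * e3 + 18 * e2 * e3 - 27 * e3 ^ 2) :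
    6 ≤ (minpoly F (x1 / x2)).natDegree := by
  have hDK : ((x1 - x2) * (x1 - x3) * (x2 - x3)) ^ 2 =
      algebraMap F K (e2 ^ 2 - 4 * e2 ^ 3 - 4 * e3 + 18 * e2 * e3 - 27 * e3 ^ 2) := by
    simp only [map_sub, map_add, map_mul, map_pow, map_ofNat]
    rw [← h2, ← h3]
    have : x3 = 1 - x1 - x2 := by linear_combination h1
    rw [this]; ring
  have hc0 : e3 ≠ 0 := by intro h; exact hnr 0 (by rw [h]; ring)
  have hprod : x1 * x2 * x3 ≠ 0 := by rw [h3]; simpa using hc0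
  have z3 : x3 ≠ 0 := right_ne_zero_of_mul hprod
  have z1 : x1 ≠ 0 := left_ne_zero_of_mul (left_ne_zero_of_mul hprod)
  have z2 : x2 ≠ 0 := right_ne_zero_of_mul (left_ne_zero_of_mul hprod)
  have hδ : (x1 - x2) * (x1 - x3) * (x2 - x3) ≠ 0 := by
    intro h
    rw [h] at hDK
    refine hD 0 ?_
    have : algebraMap F K 0 = algebraMap F K (e2 ^ 2 - 4 * e2 ^ 3 - 4 * e3 + 18 * e2 * e3 - 27 * e3 ^ 2) := by
      rw [← hDK, map_zero]; ring
    rw [← (algebraMap F K).injective this]; ring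
  have d23 : x2 - x3 ≠ 0 := right_ne_zero_of_mul hδ
  have d13 : x1 - x3 ≠ 0 := right_ne_zero_of_mul (left_ne_zero_of_mul hδ)
  have d12 : x1 - x2 ≠ 0 := left_ne_zero_of_mul (left_ne_zero_of_mul hδ)
  have r1 : x1 ^ 3 - x1 ^ 2 + algebraMap F K e2 * x1 - algebraMap F K e3 = 0 := by
    rw [← h2, ← h3]; linear_combination x1 ^ 2 * h1
  have r2 : x2 ^ 3 - x2 ^ 2 + algebraMap F K e2 * x2 - algebraMap F K e3 = 0 := by
    rw [← h2, ← h3]; linear_combination x2 ^ 2 * h1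
  obtain ⟨ρ, hρ⟩ : ∃ ρ : K, ρ = x1 / x2 := ⟨_, rfl⟩
  have x1e : x1 = ρ * x2 := by rw [hρ]; field_simp
  rw [← hρ]
  have fixed : ∀ σ : K ≃ₐ[F] K, σ ρ = ρ → σ x2 = x2 := by
    intro σ hσ
    have s1 : (σ x1) ^ 3 - (σ x1) ^ 2 + algebraMap F K e2 * σ x1 - algebraMap F K e3 = 0 := by
      have := congrArg σ r1; simpa using this
    have s2 : (σ x2) ^ 3 - (σ x2) ^ 2 + algebraMap F K e2 * σ x2 - algebraMap F K e3 = 0 := by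
      have := congrArg σ r2; simpa using this
    have sx1 : σ x1 = ρ * σ x2 := by conv_lhs => rw [x1e, map_mul, hσ]
    have hrel : σ x1 * x2 = x1 * σ x2 := by rw [sx1, x1e]; ring
    have ssum : σ x1 + σ x2 + σ x3 = 1 := by rw [← map_add, ← map_add, h1, map_one]
    have abs0 : x1 + x2 + x3 = 0 → False := fun h => one_ne_zero (h1.symm.trans h)
    rcases cub_roots e2 e3 h1 h2 h3 s2 with a | a | a
    · exfalso
      rw [a] at hrel ssum
      rcases cub_roots e2 e3 h1 h2 h3 s1 with b | b | b
      · rw [b] at hrel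
        exact mul_ne_zero z1 d12 (by linear_combination - hrel)
      · rw [b] at hrel
        have : x1 + x2 = 0 := by
          apply mul_left_cancel₀ d12; linear_combination - hrel
        have x31 : x3 = 1 := by linear_combination h1 - this
        refine hnr 1 ?_
        apply (algebraMap F K).injective
        simp only [map_sub, map_add, map_mul, map_pow, map_one, map_zero]
        rw [← h2, ← h3, x31]; linear_combination this
      · rw [b] at hrel ssum
        have h' := congrArg σ hrel
        simp only [map_mul, a, b] at h'
        apply abs0
        have s3 : σ x3 = x2 := by linear_combination ssum - h1
        rw [s3] at h'
        apply mul_left_cancel₀ d13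
        linear_combination h' - hrel
    · exact a
    · exfalso
      rw [a] at hrel ssum
      rcases cub_roots e2 e3 h1 h2 h3 s1 with b | b | b
      · rw [b] at hrel
        exact mul_ne_zero z1 d23 (by linear_combination hrel)
      · rw [b] at hrel ssum
        have h' := congrArg σ hrel
        simp only [map_mul, a, b] at h'
        apply abs0
        have s3 : σ x3 = x1 := by linear_combination ssum - h1
        rw [s3] at h'
        apply mul_left_cancel₀ d23
        linear_combination hrel - h'
      · rw [b] at hrel
        exact mul_ne_zero z3 d12 (by linear_combination - hrel)
  have hIntg : IsIntegral F ρ := Algebra.IsIntegral.isIntegral ρ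
  have mem2 : x2 ∈ IntermediateField.adjoin F {ρ} := by
    rw [← InfiniteGalois.fixedField_fixingSubgroup (IntermediateField.adjoin F {ρ})]
    rw [IntermediateField.mem_fixedField_iff]
    intro σ hσ
    apply fixed
    exact (IntermediateField.mem_fixingSubgroup_iff _ _).mp hσ ρ (IntermediateField.mem_adjoin_simple_self F ρ)
  have mem1 : x1 ∈ IntermediateField.adjoin F {ρ} := by
    rw [x1e]; exact mul_mem (IntermediateField.mem_adjoin_simple_self F ρ) mem2
  have mem3 : x3 ∈ IntermediateField.adjoin F {ρ} := by
    have : x3 = 1 - x1 - x2 := by linear_combination h1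
    rw [this]; exact sub_mem (sub_mem (one_mem _) mem1) mem2
  have := IntermediateField.adjoin.finiteDimensional hIntg
  have t3 := three_dvd (IntermediateField.adjoin F {ρ}) e2 e3 hnr ⟨x2, mem2⟩ (by
    apply Subtype.ext; exact r2)
  have t2 := two_dvd (IntermediateField.adjoin F {ρ}) _ hD
    ⟨(x1 - x2) * (x1 - x3) * (x2 - x3), mul_mem (mul_mem (sub_mem mem1 mem2) (sub_mem mem1 mem3)) (sub_mem mem2 mem3)⟩ (by
    apply Subtype.ext; exact hDK)
  have hpos : 0 < Module.finrank F (IntermediateField.adjoin F {ρ}) := Module.finrank_pos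
  rw [IntermediateField.adjoin.finrank hIntg] at t3 t2 hpos
  omega
end FQ


namespace FQ

theorem Q_ne (t : ℚ) : t ^ 2 + t - 1 ≠ 0 := by
  intro h
  have h5 : IsSquare (5 : ℚ) := ⟨2 * t + 1, by linear_combination -4 * h⟩
  have h5' : IsSquare ((5 : ℕ) : ℚ) := by exact_mod_cast h5
  rw [Rat.isSquare_natCast_iff] at h5'
  obtain ⟨r, hr⟩ := h5'
  have hr3 : r < 3 := by nlinarith
  interval_cases r <;> omega

theorem no_root {e2 e3 : ℚ} (h5 : 1 - 5 * e2 + 5 * e3 + 5 * e2 ^ 2 - 5 * e2 * e3 = 0) (he3 : e3 ≠ 0) (z : ℚ) :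
    z ^ 3 - z ^ 2 + e2 * z - e3 ≠ 0 := by
  intro hz
  have z0 : z ≠ 0 := by rintro rfl; apply he3; linear_combination -hz
  obtain ⟨n, hn⟩ : ∃ n : ℚ, n = z ^ 2 - z + e2 := ⟨_, rfl⟩
  have he2 : e2 = n - z ^ 2 + z := by rw [hn]; ring
  have he3' : e3 = z * n := by rw [hn]; linear_combination -hz
  have n0 : n ≠ 0 := by rintro rfl; apply he3; rw [he3', mul_zero]
  rw [he2, he3'] at h5
  have hE : ((z - 1) / z) ^ 5 - 5 * ((z - 1) / z) ^ 3 * (n / z ^ 2) + 5 * ((z - 1) / z) * (n / z ^ 2) ^ 2 = 1 := by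
    field_simp
    linear_combination - h5
  refine C2 hE (div_ne_zero n0 (pow_ne_zero 2 z0)) ?_
  intro hm
  rw [hm] at hE
  have hS5 : ((z - 1) / z) ^ 5 = 1 := by linear_combination hE
  have hS1 : (z - 1) / z = 1 := by
    have hodd : Odd 5 := by decide
    exact hodd.strictMono_pow.injective (by simpa using hS5)
  rw [div_eq_one_iff_eq z0] at hS1
  linarith

theorem root_f {K : Type*} [Field K] {x1 x2 x3 e2 e3 : K} (h1 : x1 + x2 + x3 = 1)
    (h2 : x1 * x2 + x1 * x3 + x2 * x3 = e2) (h3 : x1 * x2 * x3 = e3) (he3 : e3 ≠ 0) {U V W : K}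
    (hU : U = 3 - e2 / e3) (hV : V = 3 + ((1 - 2 * e2) * e3 + e2 ^ 3 - 3 * e2 * e3 + 3 * e3 ^ 2) / e3 ^ 2)
    (hW : W = 6 - 2 * e2 / e3 - ((1 - 2 * e2) * (e2 ^ 2 - 2 * e3) - e3 ^ 2) / e3 ^ 2) :
    (x1 / x2) ^ 6 + U * (x1 / x2) ^ 5 + V * (x1 / x2) ^ 4 + W * (x1 / x2) ^ 3 + V * (x1 / x2) ^ 2 + U * (x1 / x2) + 1 = 0 := by
  rw [← h3] at he3
  have z3 : x3 ≠ 0 := right_ne_zero_of_mul he3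
  have z1 : x1 ≠ 0 := left_ne_zero_of_mul (left_ne_zero_of_mul he3)
  have z2 : x2 ≠ 0 := right_ne_zero_of_mul (left_ne_zero_of_mul he3)
  have hU' : U = - ((x1 ^ 2 + x2 ^ 2) / (x1 * x2) + (x1 ^ 2 + x3 ^ 2) / (x1 * x3) + (x2 ^ 2 + x3 ^ 2) / (x2 * x3)) := by
    have : e2 = (x1 * x2 + x1 * x3 + x2 * x3) * (x1 + x2 + x3) := by rw [h1, h2, mul_one]
    rw [hU, this, ← h3]; field_simp; ring
  have hV' : V = 3 + ((x1 ^ 2 + x2 ^ 2) / (x1 * x2) * ((x1 ^ 2 + x3 ^ 2) / (x1 * x3)) +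
      (x1 ^ 2 + x2 ^ 2) / (x1 * x2) * ((x2 ^ 2 + x3 ^ 2) / (x2 * x3)) +
      (x1 ^ 2 + x3 ^ 2) / (x1 * x3) * ((x2 ^ 2 + x3 ^ 2) / (x2 * x3))) := by
    have : (1 - 2 * e2) * e3 + e2 ^ 3 - 3 * e2 * e3 + 3 * e3 ^ 2 =
      ((x1 + x2 + x3) ^ 2 - 2 * e2) * (x1 + x2 + x3) * e3 + e2 ^ 3 - 3 * e2 * (x1 + x2 + x3) * e3 + 3 * e3 ^ 2 := by
      rw [h1]; ring
    rw [hV, this, ← h2, ← h3]; field_simp; ring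
  have hW' : W = - 2 * ((x1 ^ 2 + x2 ^ 2) / (x1 * x2) + (x1 ^ 2 + x3 ^ 2) / (x1 * x3) + (x2 ^ 2 + x3 ^ 2) / (x2 * x3)) -
      (x1 ^ 2 + x2 ^ 2) / (x1 * x2) * ((x1 ^ 2 + x3 ^ 2) / (x1 * x3)) * ((x2 ^ 2 + x3 ^ 2) / (x2 * x3)) := by
    have e : W = 2 * U - ((1 - 2 * e2) * (e2 ^ 2 - 2 * e3) - e3 ^ 2) / e3 ^ 2 := by rw [hW, hU]; ring
    have : (1 - 2 * e2) * (e2 ^ 2 - 2 * e3) - e3 ^ 2 =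
      ((x1 + x2 + x3) ^ 2 - 2 * e2) * (e2 ^ 2 - 2 * (x1 + x2 + x3) * e3) - e3 ^ 2 := by
      rw [h1]; ring
    rw [e, hU', this, ← h2, ← h3]; field_simp; ring
  obtain ⟨r, hr⟩ : ∃ r : K, r = (x1 ^ 2 + x3 ^ 2) / (x1 * x3) := ⟨_, rfl⟩
  obtain ⟨r', hr'⟩ : ∃ r' : K, r' = (x2 ^ 2 + x3 ^ 2) / (x2 * x3) := ⟨_, rfl⟩
  rw [hU', hV', hW', ← hr, ← hr']
  field_simp
  ring

/-- The irreducibility criterion over a general field. -/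
theorem irr_gen {F : Type*} [Field F] [CharZero F] (e2 e3 U V W : F) (e30 : e3 ≠ 0)
    (hnr : ∀ z : F, z ^ 3 - z ^ 2 + e2 * z - e3 ≠ 0)
    (hD : ∀ y : F, y ^ 2 ≠ e2 ^ 2 - 4 * e2 ^ 3 - 4 * e3 + 18 * e2 * e3 - 27 * e3 ^ 2)
    (hU : U = 3 - e2 / e3) (hV : V = 3 + ((1 - 2 * e2) * e3 + e2 ^ 3 - 3 * e2 * e3 + 3 * e3 ^ 2) / e3 ^ 2)
    (hW : W = 6 - 2 * e2 / e3 - ((1 - 2 * e2) * (e2 ^ 2 - 2 * e3) - e3 ^ 2) / e3 ^ 2) :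
    Irreducible (X ^ 6 + C U * X ^ 5 + C V * X ^ 4 + C W * X ^ 3 + C V * X ^ 2 + C U * X + 1 : F[X]) := by
  obtain ⟨P, hP⟩ : ∃ P : F[X], P = X ^ 6 + C U * X ^ 5 + C V * X ^ 4 + C W * X ^ 3 + C V * X ^ 2 + C U * X + 1 := ⟨_, rfl⟩
  rw [← hP]
  obtain ⟨x1, hx1⟩ := IsAlgClosed.exists_aeval_eq_zero (AlgebraicClosure F) (X ^ 3 - X ^ 2 + C e2 * X - C e3 : F[X]) (by
    have : (X ^ 3 - X ^ 2 + C e2 * X - C e3 : F[X]).degree = 3 := by compute_degree!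
    rw [this]; norm_num)
  obtain ⟨x2, hx2⟩ := IsAlgClosed.exists_root
    (X ^ 2 - C (1 - x1) * X + C (x1 ^ 2 - x1 + algebraMap F (AlgebraicClosure F) e2)) (by
    have : (X ^ 2 - C (1 - x1) * X + C (x1 ^ 2 - x1 + algebraMap F (AlgebraicClosure F) e2)).degree = 2 := by compute_degree!
    rw [this]; norm_num)
  have k1 : x1 ^ 3 - x1 ^ 2 + algebraMap F (AlgebraicClosure F) e2 * x1 - algebraMap F (AlgebraicClosure F) e3 = 0 := by
    simpa using hx1
  have k2 : x2 ^ 2 - (1 - x1) * x2 + (x1 ^ 2 - x1 + algebraMap F (AlgebraicClosure F) e2) = 0 := by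
    rw [IsRoot, eval_add, eval_sub, eval_mul, eval_C, eval_C, eval_pow, eval_X] at hx2
    exact hx2
  have s1 : x1 + x2 + (1 - x1 - x2) = 1 := by ring
  have s2 : x1 * x2 + x1 * (1 - x1 - x2) + x2 * (1 - x1 - x2) = algebraMap F (AlgebraicClosure F) e2 := by
    linear_combination - k2
  have s3 : x1 * x2 * (1 - x1 - x2) = algebraMap F (AlgebraicClosure F) e3 := by
    linear_combination k1 - x1 * k2
  have h6 := gal e2 e3 s1 s2 s3 hnr hD
  have hroot := root_f s1 s2 s3 (by simpa using e30)
    (U := algebraMap F (AlgebraicClosure F) U) (V := algebraMap F (AlgebraicClosure F) V)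
    (W := algebraMap F (AlgebraicClosure F) W) (by rw [hU]; simp only [map_sub, map_add, map_mul, map_div₀, map_pow, map_neg, map_one, map_ofNat]) (by rw [hV]; simp only [map_sub, map_add, map_mul, map_div₀, map_pow, map_neg, map_one, map_ofNat]) (by rw [hW]; simp only [map_sub, map_add, map_mul, map_div₀, map_pow, map_neg, map_one, map_ofNat])
  have hmon : P.Monic := by rw [hP]; monicity!
  have hdeg : P.natDegree = 6 := by rw [hP]; compute_degree!
  have hf : aeval (x1 / x2) P = 0 := by
    rw [hP]
    simp only [map_add, map_mul, map_pow, aeval_X, aeval_C, map_one]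
    exact hroot
  have hIntg : IsIntegral F (x1 / x2) := ⟨P, hmon, hf⟩
  have heq : P = minpoly F (x1 / x2) :=
    eq_of_monic_of_dvd_of_natDegree_le (minpoly.monic hIntg) hmon (minpoly.dvd F _ hf) (by rw [hdeg]; exact h6)
  rw [heq]
  exact minpoly.irreducible hIntg

end FQ

/-- For every rational `t ≠ 1, 2`, the polynomial `f t` is irreducible over `ℚ`. -/
theorem f_irreducible (t : ℚ) (h1 : t ≠ 1) (h2 : t ≠ 2) : Irreducible (f t) := by
  have hQ := FQ.Q_ne t
  have a1 : t - 1 ≠ 0 := sub_ne_zero.mpr h1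
  have a2 : t - 2 ≠ 0 := sub_ne_zero.mpr h2
  obtain ⟨e2, he2⟩ : ∃ e2 : ℚ, e2 = - 1 / (t - 2) := ⟨_, rfl⟩
  obtain ⟨e3, he3⟩ : ∃ e3 : ℚ, e3 = - (t ^ 2 + t - 1) / (5 * (t - 2) * (t - 1)) := ⟨_, rfl⟩
  have e30 : e3 ≠ 0 := by
    rw [he3]; exact div_ne_zero (neg_ne_zero.mpr hQ) (mul_ne_zero (mul_ne_zero (by norm_num) a2) a1)
  have h5 : 1 - 5 * e2 + 5 * e3 + 5 * e2 ^ 2 - 5 * e2 * e3 = 0 := by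
    rw [he2, he3]; field_simp; ring
  have hnr := FQ.no_root h5 e30
  have hD : ∀ y : ℚ, y ^ 2 ≠ e2 ^ 2 - 4 * e2 ^ 3 - 4 * e3 + 18 * e2 * e3 - 27 * e3 ^ 2 := by
    intro y hy
    refine FQ.C3 (s := t - 2) (y := 5 * (t - 2) ^ 2 * (t - 1) * y) a2 ?_
    rw [mul_pow, hy, he2, he3]
    field_simp
    ring
  obtain ⟨q, hq⟩ : ∃ q : ℚ, q = t ^ 2 + t - 1 := ⟨_, rfl⟩
  have hq0 : q ≠ 0 := by rw [hq]; exact hQ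
  have hU : u t = 3 - e2 / e3 := by
    rw [u, he2, he3, ← hq]; field_simp; rw [hq]; ring
  have hV : v t = 3 + ((1 - 2 * e2) * e3 + e2 ^ 3 - 3 * e2 * e3 + 3 * e3 ^ 2) / e3 ^ 2 := by
    rw [v, he2, he3, ← hq]; field_simp; rw [hq]; ring
  have hW : w t = 6 - 2 * e2 / e3 - ((1 - 2 * e2) * (e2 ^ 2 - 2 * e3) - e3 ^ 2) / e3 ^ 2 := by
    rw [w, he2, he3, ← hq]; field_simp; rw [hq]; ring
  exact FQ.irr_gen e2 e3 (u t) (v t) (w t) e30 hnr hD hU hV hW
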